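/- For any partitions μ and ν one has (α^{ℓ(μ)} z_μ)/(α^{ℓ(ν)} z_ν) · θ_{μ/ν}^{(α)}(v) = [t^{|μ|−|ν|} p_ν] exp(B_∞^{(α)⊥}(−t,p,−αv)) · p_μ, where B_∞^{(α)⊥} denotes the adjoint of B_∞^{(α)} with respect to the α-deformed Hall scalar product. -/

import Mathlib

open scoped Classical

noncomputable section

/-- The base field `ℚ(α)` of rational functions in the Jack parameter `α`. -/
abbrev F : Type := RatFunc ℚ

/-- The Jack deformation parameter `α`. -/
def alpha : F := RatFunc.X

/-- An integer partition, encoded as a multiset of positive integers (its parts). -/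
abbrev JPartition : Type := Multiset ℕ+

/-- The size `|λ|` of a partition. -/
def psize (l : JPartition) : ℕ := (l.map fun i => (i : ℕ)).sum

/-- The length `ℓ(λ)` of a partition. -/
def plen (l : JPartition) : ℕ := Multiset.card l

/-- `m_i(λ)`, the number of parts of `λ` equal to `i`. -/
def pmult (l : JPartition) (i : ℕ+) : ℕ := Multiset.count i l

/-- `λ ∪ 1^k`, adjoining `k` parts equal to `1`. -/
def addOnes (l : JPartition) (k : ℕ) : JPartition := l + Multiset.replicate k 1

/-- `λ̃`, the partition obtained by deleting all parts equal to `1`. -/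
def removeOnes (l : JPartition) : JPartition := Multiset.filter (fun i => i ≠ 1) l

/-- Exponent vectors of monomials in the power-sum generators `p₁, p₂, …`. -/
abbrev Exp : Type := ℕ+ →₀ ℕ

/-- The exponent vector of the monomial `p_λ`. -/
def toExp (l : JPartition) : Exp := l.toFinset.sum fun i => Finsupp.single i (Multiset.count i l)

/-- The partition corresponding to an exponent vector. -/
def toPart (m : Exp) : JPartition := m.sum fun i k => Multiset.replicate k i

/-- The weighted degree (`deg p_i = i`) of an exponent vector; this is the size of the
corresponding partition. -/
def wt (m : Exp) : ℕ := m.sum fun i k => k * (i : ℕ)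

/-- The algebra `ℚ(α)[p₁, p₂, …]` of symmetric functions written in the power-sum basis. -/
abbrev SymA : Type := MvPolynomial ℕ+ F

/-- The power-sum monomial `p_λ`. -/
def pPow (l : JPartition) : SymA := (l.map fun i => MvPolynomial.X i).prod

/-- `z_λ α^{ℓ(λ)}`, attached to the exponent vector of `p_λ`. -/
def zalpha (m : Exp) : F :=
  algebraMap ℚ F (m.prod fun i k => (Nat.factorial k : ℚ) * ((i : ℕ) : ℚ) ^ k) *
    alpha ^ (m.sum fun _ k => k)

/-- The `α`-deformed Hall scalar product: `⟨p_λ, p_μ⟩ = δ_{λμ} z_λ α^{ℓ(λ)}`. -/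
def hall (f g : SymA) : F :=
  ∑ m ∈ f.support, MvPolynomial.coeff m f * MvPolynomial.coeff m g * zalpha m

/-- The parts of a partition, sorted in weakly decreasing order. -/
def sortedParts (l : JPartition) : List ℕ := ((l.map fun i => (i : ℕ)).sort (· ≤ ·)).reverse

/-- The sum of the `k` largest parts of a partition. -/
def topSum (l : JPartition) (k : ℕ) : ℕ := ((sortedParts l).take k).sum

/-- The dominance order on partitions: `μ ⊴ λ`. -/
def dominates (mu lam : JPartition) : Prop :=
  psize mu = psize lam ∧ ∀ k, topSum mu k ≤ topSum lam k

/-- Evaluation of a symmetric function (in power-sum coordinates) in `N` variables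
`x₁, …, x_N`: it sends `p_i ↦ x₁^i + ⋯ + x_N^i`. -/
def evalN (N : ℕ) : SymA →ₐ[F] MvPolynomial (Fin N) F :=
  MvPolynomial.aeval fun i : ℕ+ => ∑ j : Fin N, MvPolynomial.X j ^ (i : ℕ)

/-- The exponent of the monomial `x₁^{μ₁} ⋯ x_s^{μ_s}` in `N` variables, for `μ` a
partition; its coefficient in a symmetric polynomial is the coefficient of the monomial
symmetric function `m_μ` (provided `N ≥ ℓ(μ)`). -/
def xexp (mu : JPartition) (N : ℕ) : Fin N →₀ ℕ :=
  Finsupp.equivFunOnFinite.symm fun j => (sortedParts mu).getD (j : ℕ) 0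

/-- The defining properties of the family of Jack polynomials `J_λ^{(α)}` (Macdonald's
characterization): orthogonality for the `α`-deformed Hall product, triangularity with
respect to monomial symmetric functions in dominance order, and normalization
`[p_{1^n}] J_λ^{(α)} = 1`. -/
structure IsJackFamily (J : JPartition → SymA) : Prop where
  orthogonal : ∀ l m : JPartition, l ≠ m → hall (J l) (J m) = 0
  triangular : ∀ l m : JPartition, ¬ dominates m l →
    MvPolynomial.coeff (xexp m (psize l + psize m + plen m))
      (evalN (psize l + psize m + plen m) (J l)) = 0
  normalized : ∀ l : JPartition, MvPolynomial.coeff (Finsupp.single 1 (psize l)) (J l) = 1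

/-- The Jack character `θ_μ^{(α)}(λ)`. -/
def theta (J : JPartition → SymA) (mu lam : JPartition) : F :=
  if psize lam < psize mu then 0
  else (Nat.choose (psize lam - psize mu + pmult mu 1) (pmult mu 1) : F) *
    MvPolynomial.coeff (toExp (addOnes mu (psize lam - psize mu))) (J lam)

/-- `g` is the family of structure coefficients of Jack characters:
`θ_μ^{(α)} θ_ν^{(α)} = ∑_π g^π_{μ,ν}(α) θ_π^{(α)}` (as functions on Young diagrams,
with finitely many nonzero terms). -/
def IsStructCoeffs (J : JPartition → SymA) (g : JPartition → JPartition → JPartition → F) :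
    Prop :=
  (∀ mu nu : JPartition, {pi : JPartition | g pi mu nu ≠ 0}.Finite) ∧
  ∀ mu nu lam : JPartition,
    theta J mu lam * theta J nu lam = ∑ᶠ pi : JPartition, g pi mu nu * theta J pi lam


/-- The polynomial algebra `ℚ(α)[p₁,p₂,…][y₀,y₁,…]` containing the catalytic variables. -/
abbrev PY : Type := MvPolynomial (ℕ+ ⊕ ℕ) F

/-- The variable `p_i` inside `PY`. -/
def pv (i : ℕ+) : PY := MvPolynomial.X (Sum.inl i)

/-- The catalytic variable `y_j` inside `PY`. -/
def yv (j : ℕ) : PY := MvPolynomial.X (Sum.inr j)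

/-- The operator `Y₊ = ∑_{i≥0} y_{i+1} ∂/∂y_i`. -/
def Yplus (f : PY) : PY := ∑ᶠ j : ℕ, yv (j + 1) * MvPolynomial.pderiv (Sum.inr j) f

/-- The operator
`Γ_Y = (1+b) ∑_{i,j≥1} y_{i+j} j ∂²/(∂y_{i-1}∂p_j) + ∑_{i,j≥1} y_i p_j ∂/∂y_{i+j-1}
      + b ∑_{i≥1} y_{i+1} i ∂/∂y_i`, with `b = α - 1`. -/
def GammaY (f : PY) : PY :=
  alpha • (∑ᶠ i : ℕ+, ∑ᶠ j : ℕ+, ((j : ℕ) : F) •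
      (yv ((i : ℕ) + (j : ℕ)) *
        MvPolynomial.pderiv (Sum.inl j) (MvPolynomial.pderiv (Sum.inr ((i : ℕ) - 1)) f)))
  + (∑ᶠ i : ℕ+, ∑ᶠ j : ℕ+,
      yv (i : ℕ) * pv j * MvPolynomial.pderiv (Sum.inr ((i : ℕ) + (j : ℕ) - 1)) f)
  + (alpha - 1) • (∑ᶠ i : ℕ+, ((i : ℕ) : F) •
      (yv ((i : ℕ) + 1) * MvPolynomial.pderiv (Sum.inr (i : ℕ)) f))

/-- The operator `Θ_Y = ∑_{i≥1} p_i ∂/∂y_i`. -/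
def ThetaY (f : PY) : PY := ∑ᶠ i : ℕ+, pv i * MvPolynomial.pderiv (Sum.inr (i : ℕ)) f

/-- Ordered composite of the operators `Y₊` (for `true`) and `Γ_Y` (for `false`). -/
def wordOp : List Bool → PY → PY
  | [], f => f
  | b :: w, f => (if b then Yplus else GammaY) (wordOp w f)

/-- Projection `PY → SymA` killing the catalytic variables. -/
def dropY : PY →ₐ[F] SymA :=
  MvPolynomial.aeval fun v => match v with
    | Sum.inl i => MvPolynomial.X i
    | Sum.inr _ => 0

/-- `Bc n ℓ` is the coefficient of `u^ℓ` in the operator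
`B_n^{(α)}(p, u) = Θ_Y (Γ_Y + u Y₊)^n (y₀ / (1+b))`, viewed as an operator on `ℚ(α)[p]`. -/
def Bc (n ℓ : ℕ) (f : SymA) : SymA :=
  dropY (ThetaY (∑ s ∈ Finset.univ.filter
      (fun s : Fin n → Bool => (Finset.univ.filter fun i => s i = true).card = ℓ),
    wordOp (List.ofFn s) (alpha⁻¹ • (yv 0 * MvPolynomial.rename Sum.inl f))))

/-- Matrix entries of `Bc n ℓ` in the basis of power-sum monomials. -/
def Bmat (n ℓ : ℕ) (m m' : Exp) : F :=
  MvPolynomial.coeff m (Bc n ℓ (MvPolynomial.monomial m' 1))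

/-- The adjoint of `Bc n ℓ` with respect to the `α`-deformed Hall scalar product
(`⟨Bperp f, g⟩ = ⟨f, Bc g⟩`), given by its matrix in the power-sum basis. -/
def Bperp (n ℓ : ℕ) (f : SymA) : SymA :=
  ∑ m' ∈ f.support, MvPolynomial.coeff m' f •
    ∑ᶠ m : Exp, (Bmat n ℓ m' m * zalpha m' / zalpha m) • (MvPolynomial.monomial m (1 : F))



/-- `Th μ ν` is the family of skew Jack characters `θ_{μ/ν}^{(α)}(v)` (polynomials in the
single variable `v`), defined by the expansion
`θ_μ^{(α)}(v, u₁, u₂, …) = ∑_ν θ_{μ/ν}^{(α)}(v) θ_ν^{(α)}(u₁, u₂, …)`.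
Since shifted symmetric functions are determined by their values on partitions, this is
characterized by: for every partition `λ` and every `v ∈ ℕ₊` at least as large as all
parts of `λ` (so that `(v, λ₁, λ₂, …)` is again a partition),
`θ_μ^{(α)}(v ::ₘ λ) = ∑_ν θ_{μ/ν}^{(α)}(v) θ_ν^{(α)}(λ)`, with finitely many nonzero
summands. -/
def IsSkewTheta (J : JPartition → SymA)
    (Th : JPartition → JPartition → Polynomial F) : Prop :=
  (∀ mu : JPartition, {nu : JPartition | Th mu nu ≠ 0}.Finite) ∧
  ∀ (mu lam : JPartition) (v : ℕ+), (∀ i ∈ lam, i ≤ v) →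
    theta J mu (v ::ₘ lam) =
      ∑ᶠ nu : JPartition, Polynomial.eval (((v : ℕ) : F)) (Th mu nu) * theta J nu lam

/-- `B_n^{(α)}(p, u)` with the variable `u` specialized to the scalar `c`. -/
def Bn (n : ℕ) (c : F) (f : SymA) : SymA := ∑ ℓ ∈ Finset.range (n + 1), c ^ ℓ • Bc n ℓ f

/-- Ordered composite `B_{n₁}(p,c) ∘ B_{n₂}(p,c) ∘ ⋯` over a list of indices. -/
def BnList (c : F) : List ℕ → SymA → SymA
  | [], f => f
  | n :: L, f => Bn n c (BnList c L f)

/-- The coefficient of `t^N` in `exp(B_∞^{(α)}(-t, p, c)) ⬝ f`, where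
`B_∞^{(α)}(t,p,u) = ∑_{n≥1} (t^n/n) B_n^{(α)}(p,u)`:  expanding the exponential,
this is `∑_{k≥0} (1/k!) ∑_{(n₁,…,n_k), nᵢ≥1, ∑nᵢ=N} ∏ᵢ ((-1)^{nᵢ}/nᵢ) ⬝ B_{n₁} ⋯ B_{n_k} f`. -/
def expBcoef (c : F) (N : ℕ) (f : SymA) : SymA :=
  ∑ᶠ L : List ℕ, if L.sum = N ∧ ∀ n ∈ L, 1 ≤ n then
    ((L.map fun n : ℕ => (-1 : F) ^ n / (n : F)).prod / (Nat.factorial L.length : F)) •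
      BnList c L f
  else 0

/-- `B_n^{(α)⊥}(p, u)` (the Hall-adjoint of `B_n`) with `u` specialized to `c`. -/
def BnPerp (n : ℕ) (c : F) (f : SymA) : SymA :=
  ∑ ℓ ∈ Finset.range (n + 1), c ^ ℓ • Bperp n ℓ f

/-- Ordered composite of adjoint operators over a list of indices. -/
def BnPerpList (c : F) : List ℕ → SymA → SymA
  | [], f => f
  | n :: L, f => BnPerp n c (BnPerpList c L f)

/-- The coefficient of `t^N` in `exp(B_∞^{(α)⊥}(-t, p, c)) ⬝ f`. -/
def expBperpCoef (c : F) (N : ℕ) (f : SymA) : SymA :=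
  ∑ᶠ L : List ℕ, if L.sum = N ∧ ∀ n ∈ L, 1 ≤ n then
    ((L.map fun n : ℕ => (-1 : F) ^ n / (n : F)).prod / (Nat.factorial L.length : F)) •
      BnPerpList c L f
  else 0


namespace Dk
open MvPolynomial

variable {K : Type*} [Field K] {N : ℕ}

/-- the transposition of two variables -/
abbrev sw (i j : Fin N) : MvPolynomial (Fin N) K →ₐ[K] MvPolynomial (Fin N) K :=
  rename (Equiv.swap i j)

theorem dvd_sub_sw (i j : Fin N) (f : MvPolynomial (Fin N) K) :
    (X i - X j : MvPolynomial (Fin N) K) ∣ f - sw i j f := by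
  induction f using MvPolynomial.induction_on with
  | C c => simp
  | add p q hp hq =>
    have : p + q - sw i j (p + q) = (p - sw i j p) + (q - sw i j q) := by
      rw [map_add]; ring
    rw [this]; exact dvd_add hp hq
  | mul_X p k hp =>
    have : p * X k - sw i j (p * X k) =
        (p - sw i j p) * X k + sw i j p * (X k - X (Equiv.swap i j k)) := by
      rw [map_mul, rename_X]; ring
    rw [this]
    refine dvd_add (hp.mul_right _) (Dvd.dvd.mul_left ?_ _)
    by_cases hi : k = i
    · subst hi; simp
    · by_cases hj : k = j
      · subst hj
        rw [Equiv.swap_apply_right]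
        exact ⟨-1, by ring⟩
      · rw [Equiv.swap_apply_of_ne_of_ne hi hj]; simp

theorem X_sub_ne {i j : Fin N} (h : i ≠ j) : (X i - X j : MvPolynomial (Fin N) K) ≠ 0 := by
  rw [sub_ne_zero]
  intro e
  exact h (X_injective e)

/-- divided difference -/
def ddFun (i j : Fin N) (f : MvPolynomial (Fin N) K) : MvPolynomial (Fin N) K :=
  if i = j then 0 else Classical.choose (dvd_sub_sw i j f)

theorem ddFun_spec (i j : Fin N) (f : MvPolynomial (Fin N) K) :
    (X i - X j) * ddFun i j f = f - sw i j f := by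
  unfold ddFun
  split_ifs with h
  · subst h; simp [sw, Equiv.swap_self, Equiv.coe_refl]
  · exact (Classical.choose_spec (dvd_sub_sw i j f)).symm

theorem ddFun_unique {i j : Fin N} (h : i ≠ j) {f g : MvPolynomial (Fin N) K}
    (e : (X i - X j) * g = f - sw i j f) : ddFun i j f = g :=
  mul_left_cancel₀ (X_sub_ne (K := K) h) ((ddFun_spec i j f).trans e.symm)

/-- divided difference as a linear map -/
def dd (i j : Fin N) : MvPolynomial (Fin N) K →ₗ[K] MvPolynomial (Fin N) K where
  toFun := ddFun i j
  map_add' f g := by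
    by_cases h : i = j
    · simp [ddFun, h]
    · apply ddFun_unique h
      rw [mul_add, ddFun_spec, ddFun_spec, map_add]; ring
  map_smul' c f := by
    by_cases h : i = j
    · simp [ddFun, h]
    · apply ddFun_unique h
      rw [RingHom.id_apply, mul_smul_comm, ddFun_spec, map_smul, smul_sub]

theorem dd_spec (i j : Fin N) (f : MvPolynomial (Fin N) K) :
    (X i - X j) * dd i j f = f - sw i j f := ddFun_spec i j f

theorem dd_unique {i j : Fin N} (h : i ≠ j) {f g : MvPolynomial (Fin N) K}
    (e : (X i - X j) * g = f - sw i j f) : dd i j f = g := ddFun_unique h e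

theorem dd_of_inv {i j : Fin N} {f : MvPolynomial (Fin N) K} (hf : sw i j f = f) :
    dd i j f = 0 := by
  by_cases h : i = j
  · subst h; show ddFun i i f = 0; simp [ddFun]
  · apply dd_unique h; rw [hf]; ring

theorem dd_inv_mul {i j : Fin N} {f : MvPolynomial (Fin N) K} (hf : sw i j f = f)
    (g : MvPolynomial (Fin N) K) : dd i j (f * g) = f * dd i j g := by
  by_cases h : i = j
  · subst h; show ddFun i i _ = _ * ddFun i i g; simp [ddFun]
  · apply dd_unique h
    rw [map_mul, hf, mul_left_comm, dd_spec]; ring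

theorem dd_X_left {i j : Fin N} (h : i ≠ j) (f : MvPolynomial (Fin N) K) :
    dd i j (X i * f) = X i * dd i j f + sw i j f := by
  apply dd_unique h
  rw [map_mul, rename_X, Equiv.swap_apply_left, mul_add, mul_left_comm, dd_spec]; ring

theorem dd_X_right {i j : Fin N} (h : i ≠ j) (f : MvPolynomial (Fin N) K) :
    dd i j (X j * f) = X j * dd i j f - sw i j f := by
  apply dd_unique h
  rw [map_mul, rename_X, Equiv.swap_apply_right, mul_sub, mul_left_comm, dd_spec]; ring

theorem dd_X_other {i j k : Fin N} (hi : k ≠ i) (hj : k ≠ j) (f : MvPolynomial (Fin N) K) :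
    dd i j (X k * f) = X k * dd i j f := by
  apply dd_inv_mul
  rw [rename_X, Equiv.swap_apply_of_ne_of_ne hi hj]

theorem rename_sw (s : Equiv.Perm (Fin N)) (i j : Fin N) (f : MvPolynomial (Fin N) K) :
    rename s (sw i j f) = sw (s i) (s j) (rename s f) := by
  rw [rename_rename, rename_rename]
  congr 2
  funext k
  simp only [Function.comp]
  rw [Equiv.swap_apply_apply]; simp

theorem rename_dd (s : Equiv.Perm (Fin N)) (i j : Fin N) (f : MvPolynomial (Fin N) K) :
    rename s (dd i j f) = dd (s i) (s j) (rename s f) := by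
  by_cases h : i = j
  · subst h; show rename s (ddFun i i f) = ddFun (s i) (s i) _; simp [ddFun]
  · symm
    apply dd_unique (fun e => h (s.injective e))
    rw [← rename_sw, ← map_sub, ← dd_spec i j f, map_mul, map_sub, rename_X, rename_X]

theorem dd_C_mul (i j : Fin N) (c : K) (f : MvPolynomial (Fin N) K) :
    dd i j (C c * f) = C c * dd i j f := by
  rw [C_mul', C_mul', map_smul]

theorem dd_C (i j : Fin N) (c : K) : dd i j (C c : MvPolynomial (Fin N) K) = 0 :=
  dd_of_inv (by simp)

theorem rename_pderiv (s : Equiv.Perm (Fin N)) (i : Fin N) (f : MvPolynomial (Fin N) K) :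
    rename s (pderiv i f) = pderiv (s i) (rename s f) := by
  rw [pderiv_rename s.injective]

/-- the Dunkl operator -/
def T (a g : K) (i : Fin N) : MvPolynomial (Fin N) K →ₗ[K] MvPolynomial (Fin N) K where
  toFun f := C a * pderiv i f + C g * ∑ j ∈ Finset.univ.erase i, dd i j f
  map_add' f h := by simp only [map_add, Finset.sum_add_distrib]; ring
  map_smul' c f := by
    simp only [RingHom.id_apply, map_smul, ← Finset.smul_sum, smul_add, mul_smul_comm,
      Derivation.map_smul]

theorem T_apply (a g : K) (i : Fin N) (f : MvPolynomial (Fin N) K) :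
    T a g i f = C a * pderiv i f + C g * ∑ j ∈ Finset.univ.erase i, dd i j f := rfl

theorem T_C_mul (a g : K) (i : Fin N) (c : K) (f : MvPolynomial (Fin N) K) :
    T a g i (C c * f) = C c * T a g i f := by
  rw [C_mul', C_mul', map_smul]

theorem T_C (a g : K) (i : Fin N) (c : K) : T a g i (C c) = 0 := by
  simp [T_apply, dd_C]

theorem T_X_ne (a g : K) {i j : Fin N} (h : i ≠ j) (f : MvPolynomial (Fin N) K) :
    T a g i (X j * f) = X j * T a g i f - C g * sw i j f := by
  rw [T_apply, T_apply, Derivation.leibniz, pderiv_X_of_ne h.symm]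
  have : ∑ k ∈ Finset.univ.erase i, dd i k (X j * f) =
      ∑ k ∈ Finset.univ.erase i, (X j * dd i k f - if k = j then sw i j f else 0) := by
    refine Finset.sum_congr rfl fun k hk => ?_
    have hk : k ≠ i := (Finset.mem_erase.mp hk).1
    split_ifs with e
    · subst e; exact dd_X_right h f
    · rw [dd_X_other h.symm (Ne.symm e), sub_zero]
  rw [this, Finset.sum_sub_distrib, ← Finset.mul_sum, Finset.sum_ite_eq',
    if_pos (Finset.mem_erase.mpr ⟨h.symm, Finset.mem_univ _⟩)]
  simp only [smul_eq_mul]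
  ring

theorem T_X_self (a g : K) (i : Fin N) (f : MvPolynomial (Fin N) K) :
    T a g i (X i * f) = X i * T a g i f + C a * f +
      C g * ∑ j ∈ Finset.univ.erase i, sw i j f := by
  rw [T_apply, T_apply, Derivation.leibniz, pderiv_X_self]
  have : ∑ k ∈ Finset.univ.erase i, dd i k (X i * f) =
      ∑ k ∈ Finset.univ.erase i, (X i * dd i k f + sw i k f) := by
    refine Finset.sum_congr rfl fun k hk => ?_
    exact dd_X_left (Finset.mem_erase.mp hk).1.symm f
  rw [this, Finset.sum_add_distrib, ← Finset.mul_sum]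
  simp only [smul_eq_mul]
  ring

theorem sum_erase_perm {M : Type*} [AddCommMonoid M] (s : Equiv.Perm (Fin N)) (i : Fin N)
    (F : Fin N → M) :
    ∑ j ∈ Finset.univ.erase i, F (s j) = ∑ j ∈ Finset.univ.erase (s i), F j := by
  refine Finset.sum_equiv s ?_ (fun _ _ => rfl)
  intro j; simp

theorem rename_T (a g : K) (s : Equiv.Perm (Fin N)) (i : Fin N) (f : MvPolynomial (Fin N) K) :
    rename s (T a g i f) = T a g (s i) (rename s f) := by
  rw [T_apply, T_apply, map_add, map_mul, map_mul, map_sum, rename_pderiv, rename_C, rename_C]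
  congr 2
  rw [← sum_erase_perm s i (fun k => dd (s i) k (rename s f))]
  exact Finset.sum_congr rfl fun j _ => rename_dd s i j f

theorem sw_comm' (i j : Fin N) : (sw i j : MvPolynomial (Fin N) K →ₐ[K] _) = sw j i := by
  unfold sw; rw [Equiv.swap_comm]

theorem T_comm (a g : K) (i j : Fin N) (f : MvPolynomial (Fin N) K) :
    T a g i (T a g j f) = T a g j (T a g i f) := by
  by_cases hij : i = j
  · rw [hij]
  have key : ∀ (i j : Fin N), i ≠ j → ∀ p : MvPolynomial (Fin N) K,
      T a g i (T a g j p) = T a g j (T a g i p) →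
      T a g i (T a g j (X j * p)) = T a g j (T a g i (X j * p)) := by
    intro i j hij p hp
    rw [T_X_self, map_add, map_add, T_X_ne a g hij, T_C_mul, T_C_mul, map_sum,
      T_X_ne a g hij, map_sub, T_X_self, T_C_mul]
    have h1 : ∑ k ∈ Finset.univ.erase j, T a g i (sw j k p) =
        ∑ k ∈ Finset.univ.erase j, (sw j k (T a g i p) +
          if k = i then (T a g i (sw i j p) - sw i j (T a g i p)) else 0) := by
      refine Finset.sum_congr rfl fun k hk => ?_
      have hk : k ≠ j := (Finset.mem_erase.mp hk).1
      split_ifs with e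
      · subst e; rw [sw_comm' j k]; ring
      · rw [rename_T, Equiv.swap_apply_of_ne_of_ne hij (Ne.symm e)]; simp
    rw [h1, Finset.sum_add_distrib, Finset.sum_ite_eq',
      if_pos (Finset.mem_erase.mpr ⟨hij, Finset.mem_univ _⟩), hp]
    have h2 : sw i j (T a g i p) = T a g j (sw i j p) := by
      rw [rename_T, Equiv.swap_apply_left]
    have h3 : sw i j (T a g j p) = T a g i (sw i j p) := by
      rw [rename_T, Equiv.swap_apply_right]
    rw [h2, h3]
    ring
  induction f using MvPolynomial.induction_on with
  | C c => simp [T_C]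
  | add p q hp hq => simp only [map_add, hp, hq]
  | mul_X p k hp =>
    rw [mul_comm p]
    by_cases hi : k = i
    · subst hi
      exact (key j k (Ne.symm hij) p hp.symm).symm
    by_cases hj : k = j
    · subst hj
      exact key i k hij p hp
    rw [T_X_ne a g (Ne.symm hj), map_sub, T_X_ne a g (Ne.symm hi), T_C_mul,
      T_X_ne a g (Ne.symm hi), map_sub, T_X_ne a g (Ne.symm hj), T_C_mul, hp]
    have h2 : sw i k (T a g j p) = T a g j (sw i k p) := by
      rw [rename_T, Equiv.swap_apply_of_ne_of_ne (Ne.symm hij) (Ne.symm hj)]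
    have h3 : sw j k (T a g i p) = T a g i (sw j k p) := by
      rw [rename_T, Equiv.swap_apply_of_ne_of_ne hij (Ne.symm hi)]
    rw [h2, h3]
    ring
end Dk


namespace Dk
open MvPolynomial

variable {K : Type*} [Field K] {N : ℕ}

/-- the Heckman-type operator -/
def Lam (a g : K) (i : Fin N) : MvPolynomial (Fin N) K →ₗ[K] MvPolynomial (Fin N) K where
  toFun f := C a * (X i * pderiv i f) + C g * ∑ j ∈ Finset.univ.erase i, X j * dd i j f
  map_add' f h := by simp only [map_add, mul_add, Finset.sum_add_distrib]; ring
  map_smul' c f := by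
    simp only [RingHom.id_apply, map_smul, ← Finset.smul_sum, smul_add, mul_smul_comm,
      Derivation.map_smul]

theorem Lam_apply (a g : K) (i : Fin N) (f : MvPolynomial (Fin N) K) :
    Lam a g i f = C a * (X i * pderiv i f) +
      C g * ∑ j ∈ Finset.univ.erase i, X j * dd i j f := rfl

/-- the sum of transpositions -/
def Sw (i : Fin N) (f : MvPolynomial (Fin N) K) : MvPolynomial (Fin N) K :=
  ∑ j ∈ Finset.univ.erase i, sw i j f

theorem Lam_eq_T (a g : K) (i : Fin N) (f : MvPolynomial (Fin N) K) :
    Lam a g i f = X i * T a g i f + C g * Sw i f - C g * (((Finset.univ.erase i).card : ℕ) • f) := by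
  rw [Lam_apply, T_apply]
  have : ∑ j ∈ Finset.univ.erase i, X j * dd i j f =
      ∑ j ∈ Finset.univ.erase i, (X i * dd i j f + sw i j f - f) := by
    refine Finset.sum_congr rfl fun j _ => ?_
    have := dd_spec i j f
    linear_combination -this
  rw [this, Finset.sum_sub_distrib, Finset.sum_add_distrib, Finset.sum_const, ← Finset.mul_sum, Sw]
  ring

theorem Lam_C_mul (a g : K) (i : Fin N) (c : K) (f : MvPolynomial (Fin N) K) :
    Lam a g i (C c * f) = C c * Lam a g i f := by
  rw [C_mul', C_mul', map_smul]

theorem Lam_C (a g : K) (i : Fin N) (c : K) : Lam a g i (C c) = 0 := by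
  simp [Lam_apply, dd_C]

theorem Lam_X_ne (a g : K) {i j : Fin N} (h : i ≠ j) (f : MvPolynomial (Fin N) K) :
    Lam a g i (X j * f) = X j * Lam a g i f - C g * (X j * sw i j f) := by
  rw [Lam_apply, Lam_apply, Derivation.leibniz, pderiv_X_of_ne h.symm]
  have : ∑ k ∈ Finset.univ.erase i, X k * dd i k (X j * f) =
      ∑ k ∈ Finset.univ.erase i, (X j * (X k * dd i k f) - if k = j then X j * sw i j f else 0) := by
    refine Finset.sum_congr rfl fun k hk => ?_
    have hk : k ≠ i := (Finset.mem_erase.mp hk).1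
    split_ifs with e
    · subst e; rw [dd_X_right h f]; ring
    · rw [dd_X_other h.symm (Ne.symm e), sub_zero]; ring
  rw [this, Finset.sum_sub_distrib, ← Finset.mul_sum, Finset.sum_ite_eq',
    if_pos (Finset.mem_erase.mpr ⟨h.symm, Finset.mem_univ _⟩)]
  simp only [smul_eq_mul]
  ring

theorem Lam_X_self (a g : K) (i : Fin N) (f : MvPolynomial (Fin N) K) :
    Lam a g i (X i * f) = X i * Lam a g i f + C a * (X i * f) +
      C g * ∑ j ∈ Finset.univ.erase i, X j * sw i j f := by
  rw [Lam_apply, Lam_apply, Derivation.leibniz, pderiv_X_self]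
  have : ∑ k ∈ Finset.univ.erase i, X k * dd i k (X i * f) =
      ∑ k ∈ Finset.univ.erase i, (X i * (X k * dd i k f) + X k * sw i k f) := by
    refine Finset.sum_congr rfl fun k hk => ?_
    rw [dd_X_left (Finset.mem_erase.mp hk).1.symm f]; ring
  rw [this, Finset.sum_add_distrib, ← Finset.mul_sum]
  simp only [smul_eq_mul]
  ring

theorem rename_Lam (a g : K) (s : Equiv.Perm (Fin N)) (i : Fin N) (f : MvPolynomial (Fin N) K) :
    rename s (Lam a g i f) = Lam a g (s i) (rename s f) := by
  rw [Lam_apply, Lam_apply, map_add, map_mul, map_mul, map_mul, map_sum, rename_pderiv,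
    rename_C, rename_C, rename_X]
  congr 2
  rw [← sum_erase_perm s i (fun k => X k * dd (s i) k (rename s f))]
  exact Finset.sum_congr rfl fun j _ => by rw [map_mul, rename_dd, rename_X]

theorem rename_Sw (s : Equiv.Perm (Fin N)) (i : Fin N) (f : MvPolynomial (Fin N) K) :
    rename s (Sw i f) = Sw (s i) (rename s f) := by
  rw [Sw, Sw, map_sum]
  rw [← sum_erase_perm s i (fun k => sw (s i) k (rename s f))]
  exact Finset.sum_congr rfl fun j _ => rename_sw _ _ _ _

/-- the sum of transpositions, with one more removed -/
def Sw2 (i j : Fin N) (f : MvPolynomial (Fin N) K) : MvPolynomial (Fin N) K :=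
  ∑ k ∈ (Finset.univ.erase i).erase j, sw i k f

theorem Sw_eq {i j : Fin N} (h : i ≠ j) (f : MvPolynomial (Fin N) K) :
    Sw i f = sw i j f + Sw2 i j f := by
  rw [Sw, Sw2, Finset.add_sum_erase _ (fun k => sw i k f)]
  exact Finset.mem_erase.mpr ⟨h.symm, Finset.mem_univ _⟩

theorem Sw_add (i : Fin N) (f h : MvPolynomial (Fin N) K) : Sw i (f + h) = Sw i f + Sw i h := by
  simp [Sw, Finset.sum_add_distrib]

theorem Sw2_add (i j : Fin N) (f h : MvPolynomial (Fin N) K) :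
    Sw2 i j (f + h) = Sw2 i j f + Sw2 i j h := by
  simp [Sw2, Finset.sum_add_distrib]

theorem sw_Sw2 (i j : Fin N) (f : MvPolynomial (Fin N) K) :
    sw i j (Sw2 i j f) = Sw2 j i (sw i j f) := by
  rw [Sw2, Sw2, map_sum, Finset.erase_right_comm]
  refine Finset.sum_congr rfl fun k hk => ?_
  simp only [Finset.mem_erase] at hk
  rw [rename_sw, Equiv.swap_apply_left, Equiv.swap_apply_of_ne_of_ne hk.1 hk.2.1]

theorem Sw2_Sw2 {i j : Fin N} (h : i ≠ j) (f : MvPolynomial (Fin N) K) :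
    Sw2 i j (Sw2 j i f) + Sw2 i j (sw i j f) = Sw2 j i (Sw2 i j f) + Sw2 j i (sw i j f) := by
  unfold Sw2
  rw [Finset.erase_right_comm (a := j) (b := i)]
  set E := (Finset.univ.erase i).erase j with hE
  have hmem : ∀ k ∈ E, k ≠ j ∧ k ≠ i := fun k hk => by
    simp only [hE, Finset.mem_erase] at hk; exact ⟨hk.1, hk.2.1⟩
  simp only [map_sum]
  -- isolate the diagonal
  have e1 : ∑ k ∈ E, ∑ l ∈ E, sw i k (sw j l f) =
      ∑ k ∈ E, ∑ l ∈ E, (sw j l (sw i k f) +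
        if l = k then sw i k (sw j k f) - sw j k (sw i k f) else 0) := by
    refine Finset.sum_congr rfl fun k hk => Finset.sum_congr rfl fun l hl => ?_
    split_ifs with e
    · subst e; ring
    · rw [rename_sw (Equiv.swap i k) j l, Equiv.swap_apply_of_ne_of_ne h.symm (hmem k hk).1.symm,
        Equiv.swap_apply_of_ne_of_ne (hmem l hl).2 e, add_zero]
  have e2 : ∀ k ∈ E, ∑ l ∈ E, (sw j l (sw i k f) +
        if l = k then sw i k (sw j k f) - sw j k (sw i k f) else 0) =
      (∑ l ∈ E, sw j l (sw i k f)) + (sw j k (sw i j f) - sw i k (sw i j f)) := by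
    intro k hk
    rw [Finset.sum_add_distrib, Finset.sum_ite_eq', if_pos hk]
    have a1 : sw j k (sw i j f) = sw i k (sw j k f) := by
      rw [rename_sw (Equiv.swap j k) i j, Equiv.swap_apply_left,
        Equiv.swap_apply_of_ne_of_ne h (hmem k hk).2.symm]
    have a2 : sw i k (sw i j f) = sw j k (sw i k f) := by
      rw [rename_sw (Equiv.swap i k) i j, Equiv.swap_apply_left,
        Equiv.swap_apply_of_ne_of_ne h.symm (hmem k hk).1.symm, sw_comm' k j]
    rw [a1, a2]
  rw [e1, Finset.sum_congr rfl e2, Finset.sum_add_distrib, Finset.sum_sub_distrib,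
    Finset.sum_comm]
  ring

theorem sw_sw (i j : Fin N) (f : MvPolynomial (Fin N) K) : sw i j (sw i j f) = f := by
  rw [rename_rename]
  have : (Equiv.swap i j : Fin N → Fin N) ∘ (Equiv.swap i j) = id := by
    funext k; simp
  rw [this, rename_id_apply]

theorem Sw_C_mul (i : Fin N) (c : K) (f : MvPolynomial (Fin N) K) :
    Sw i (C c * f) = C c * Sw i f := by
  simp only [Sw, map_mul, rename_C, Finset.mul_sum]

theorem Lam_Lam (a g : K) {i j : Fin N} (h : i ≠ j) (f : MvPolynomial (Fin N) K) :
    Lam a g i (Lam a g j f) - Lam a g j (Lam a g i f) =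
      C g * (Lam a g i (sw i j f) - Lam a g j (sw i j f)) := by
  have hc : (Finset.univ.erase i).card = (Finset.univ.erase j).card := by simp
  -- D-type relations
  let D : Fin N → MvPolynomial (Fin N) K → MvPolynomial (Fin N) K := fun i f => X i * T a g i f
  have hL : ∀ k f, k = i ∨ k = j → Lam a g k f =
      D k f + C g * Sw k f - C g * (((Finset.univ.erase j).card : ℕ) • f) := by
    intro k f hk
    rw [Lam_eq_T]
    rcases hk with rfl | rfl
    · rw [hc]
    · rfl
  have hDs : ∀ (s : Equiv.Perm (Fin N)) k f, rename s (D k f) = D (s k) (rename s f) := by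
    intro s k f
    simp only [D, map_mul, rename_X, rename_T]
  have hDadd : ∀ k f f', D k (f + f') = D k f + D k f' := by
    intro k f f'; simp only [D, map_add]; ring
  have hDC : ∀ k c f, D k (C c * f) = C c * D k f := by
    intro k c f; simp only [D, T_C_mul]; ring
  have hDn : ∀ k (c : ℕ) f, D k (c • f) = c • D k f := by
    intro k c f; simp only [D, map_nsmul, mul_smul_comm]
  have hDD : D i (D j f) - D j (D i f) = C g * (D j (sw i j f) - D i (sw i j f)) := by
    simp only [D]
    rw [T_X_ne a g h, T_X_ne a g h.symm, T_comm a g i j, sw_comm' j i, rename_T, rename_T,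
      Equiv.swap_apply_left, Equiv.swap_apply_right]
    ring
  have hDSw2 : ∀ f, D i (Sw2 j i f) = Sw2 j i (D i f) := by
    intro f
    simp only [Sw2, map_sum]
    simp only [D, map_sum, Finset.mul_sum]
    refine Finset.sum_congr rfl fun k hk => ?_
    simp only [Finset.mem_erase] at hk
    rw [map_mul, rename_X, rename_T, Equiv.swap_apply_of_ne_of_ne h (Ne.symm hk.1)]
  have hDSw2' : ∀ f, D j (Sw2 i j f) = Sw2 i j (D j f) := by
    intro f
    simp only [Sw2, map_sum]
    simp only [D, map_sum, Finset.mul_sum]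
    refine Finset.sum_congr rfl fun k hk => ?_
    simp only [Finset.mem_erase] at hk
    rw [map_mul, rename_X, rename_T, Equiv.swap_apply_of_ne_of_ne h.symm (Ne.symm hk.1)]
  have hsub : ∀ (k : Fin N) (x y : MvPolynomial (Fin N) K), Sw k (x - y) = Sw k x - Sw k y := by
    intro k x y; simp [Sw, Finset.sum_sub_distrib]
  have hDsub : ∀ k x y, D k (x - y) = D k x - D k y := by
    intro k f f'; simp only [D, map_sub]; ring
  have hSn : ∀ (k : Fin N) (c : ℕ) x, Sw k (c • x : MvPolynomial (Fin N) K) = c • Sw k x := by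
    intro k c x; simp only [Sw, map_nsmul, Finset.smul_sum]
  rw [hL i (Lam a g j f) (Or.inl rfl), hL j (Lam a g i f) (Or.inr rfl), hL j f (Or.inr rfl),
    hL i f (Or.inl rfl), hL i (sw i j f) (Or.inl rfl), hL j (sw i j f) (Or.inr rfl)]
  simp only [hsub, hDsub, Sw_add, hDadd, hDC, Sw_C_mul, hDn, hSn]
  simp only [Sw_eq h, Sw_eq h.symm, sw_comm' j i, map_add, hDadd, Sw2_add, hDSw2, hDSw2', hDs,
    Equiv.swap_apply_left, Equiv.swap_apply_right, sw_sw, sw_Sw2]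
  have e1 : sw i j (Sw2 j i f) = Sw2 i j (sw i j f) := by
    have := sw_Sw2 j i f
    rwa [sw_comm' j i] at this
  rw [e1]
  have e2 := Sw2_Sw2 h f
  simp only [nsmul_eq_mul]
  linear_combination hDD + C g * C g * e2

/-- the raising operator -/
def Xop (a g u : K) (i : Fin N) : MvPolynomial (Fin N) K →ₗ[K] MvPolynomial (Fin N) K where
  toFun f := X i * (Lam a g i f + C u * f)
  map_add' f h := by simp only [map_add]; ring
  map_smul' c f := by
    rw [RingHom.id_apply, map_smul, mul_smul_comm, ← smul_add, mul_smul_comm]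

theorem Xop_apply (a g u : K) (i : Fin N) (f : MvPolynomial (Fin N) K) :
    Xop a g u i f = X i * (Lam a g i f + C u * f) := rfl

theorem rename_Xop (a g u : K) (s : Equiv.Perm (Fin N)) (i : Fin N)
    (f : MvPolynomial (Fin N) K) :
    rename s (Xop a g u i f) = Xop a g u (s i) (rename s f) := by
  simp only [Xop_apply, map_mul, map_add, rename_X, rename_C, rename_Lam]

theorem Xop_comm (a g u : K) (i j : Fin N) (f : MvPolynomial (Fin N) K) :
    Xop a g u i (Xop a g u j f) = Xop a g u j (Xop a g u i f) := by
  by_cases h : i = j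
  · rw [h]
  have := Lam_Lam a g h f
  simp only [Xop_apply]
  rw [Lam_X_ne a g h, Lam_X_ne a g (Ne.symm h)]
  simp only [map_add, Lam_C_mul, rename_Lam, sw_comm' j i, Equiv.swap_apply_left,
    Equiv.swap_apply_right, map_mul, rename_C]
  linear_combination (X i * X j) * this

theorem Lam_Xop_ne (a g u : K) {i j : Fin N} (h : i ≠ j) (f : MvPolynomial (Fin N) K) :
    Lam a g i (Xop a g u j f) = Xop a g u j (Lam a g i f) - C g * Xop a g u j (sw i j f) := by
  have := Lam_Lam a g h f
  simp only [Xop_apply]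
  rw [Lam_X_ne a g h]
  simp only [map_add, Lam_C_mul, rename_Lam, Equiv.swap_apply_right, map_mul, rename_C]
  linear_combination (X j) * this

theorem Lam_Xop_self (a g u : K) (i : Fin N) (f : MvPolynomial (Fin N) K) :
    Lam a g i (Xop a g u i f) = Xop a g u i (Lam a g i f) + C a * Xop a g u i f +
      C g * ∑ j ∈ Finset.univ.erase i, Xop a g u j (sw i j f) := by
  simp only [Xop_apply]
  rw [Lam_X_self]
  simp only [map_add, Lam_C_mul, rename_Lam, Equiv.swap_apply_left, map_mul, rename_C]

theorem Xop_commute (a g u : K) (i j : Fin N) :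
    Xop a g u i * Xop a g u j = Xop a g u j * Xop a g u i :=
  LinearMap.ext fun f => Xop_comm a g u i j f

/-- the commutative algebra generated by the raising operators -/
abbrev XA (a g u : K) (N : ℕ) : Subalgebra K (Module.End K (MvPolynomial (Fin N) K)) :=
  Algebra.adjoin K (Set.range (Xop (N := N) a g u))

instance instXA (a g u : K) : CommRing (XA a g u N) :=
  Algebra.adjoinCommRingOfComm K (by
    rintro _ ⟨i, rfl⟩ _ ⟨j, rfl⟩
    exact Xop_commute a g u i j)

/-- evaluation at the raising operators -/
def XE (a g u : K) : MvPolynomial (Fin N) K →ₐ[K] XA a g u N :=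
  aeval fun i => (⟨Xop a g u i, Algebra.subset_adjoin ⟨i, rfl⟩⟩ : XA a g u N)

/-- the intertwiner `f ↦ f(X_1,…,X_N) ⬝ 1` -/
def UN (a g u : K) : MvPolynomial (Fin N) K →ₗ[K] MvPolynomial (Fin N) K where
  toFun f := (XE a g u f : Module.End K (MvPolynomial (Fin N) K)) 1
  map_add' f h := by simp
  map_smul' c f := by simp

theorem UN_C (a g u : K) (c : K) : UN (N := N) a g u (C c) = C c := by
  have : (C c : MvPolynomial (Fin N) K) = c • 1 := by rw [smul_eq_C_mul, mul_one]
  rw [this, map_smul]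
  congr 1
  show ((XE (N := N) a g u 1 : XA a g u N) : Module.End K (MvPolynomial (Fin N) K)) 1 = 1
  rw [map_one (XE a g u)]; rfl

theorem UN_X_mul (a g u : K) (i : Fin N) (f : MvPolynomial (Fin N) K) :
    UN a g u (X i * f) = Xop a g u i (UN a g u f) := by
  show (XE a g u (X i * f) : Module.End K (MvPolynomial (Fin N) K)) 1 = _
  rw [map_mul]
  show (XE a g u (X i) : Module.End K (MvPolynomial (Fin N) K)) (UN a g u f) = _
  rw [XE, aeval_X]

theorem UN_rename (a g u : K) (s : Equiv.Perm (Fin N)) (f : MvPolynomial (Fin N) K) :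
    UN a g u (rename s f) = rename s (UN a g u f) := by
  induction f using MvPolynomial.induction_on with
  | C c => simp [UN_C]
  | add p q hp hq => simp only [map_add, hp, hq]
  | mul_X p k hp => rw [mul_comm, map_mul, rename_X, UN_X_mul, UN_X_mul, hp, rename_Xop]

theorem UN_Lam (a g u : K) (i : Fin N) (f : MvPolynomial (Fin N) K) :
    UN a g u (Lam a g i f) = Lam a g i (UN a g u f) := by
  have hC : ∀ (c : K) (f : MvPolynomial (Fin N) K), UN a g u (C c * f) = C c * UN a g u f := by
    intro c f; rw [C_mul', C_mul', map_smul]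
  induction f using MvPolynomial.induction_on with
  | C c => simp [UN_C, Lam_C]
  | add p q hp hq => simp only [map_add, hp, hq]
  | mul_X p k hp =>
    rw [mul_comm]
    by_cases h : i = k
    · subst h
      rw [Lam_X_self, UN_X_mul, Lam_Xop_self]
      simp only [map_add, hC, map_sum, UN_X_mul, hp, UN_rename]
    · rw [Lam_X_ne a g h, UN_X_mul, Lam_Xop_ne a g u h]
      simp only [map_sub, hC, UN_X_mul, hp, UN_rename]
end Dk


namespace Dk
open MvPolynomial

variable {K : Type*} [Field K] {N : ℕ}

/-- dominance on exponent vectors -/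
def Dm (k h : Fin N →₀ ℕ) : Prop :=
  ∑ i, k i = ∑ i, h i ∧ ∀ S : Finset (Fin N), ∃ S' : Finset (Fin N),
    S'.card ≤ S.card ∧ ∑ i ∈ S, k i ≤ ∑ i ∈ S', h i

theorem Dm.refl (k : Fin N →₀ ℕ) : Dm k k := ⟨rfl, fun S => ⟨S, le_rfl, le_rfl⟩⟩

theorem Dm.trans {k h l : Fin N →₀ ℕ} (a : Dm k h) (b : Dm h l) : Dm k l := by
  refine ⟨a.1.trans b.1, fun S => ?_⟩
  obtain ⟨S', h1, h2⟩ := a.2 S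
  obtain ⟨S'', h3, h4⟩ := b.2 S'
  exact ⟨S'', h3.trans h1, h2.trans h4⟩

theorem Dm_perm (s : Equiv.Perm (Fin N)) (k : Fin N →₀ ℕ) : Dm (k.mapDomain s) k := by
  have h : ∀ i, k.mapDomain s i = k (s.symm i) := by
    intro i
    conv_lhs => rw [← s.apply_symm_apply i]
    exact Finsupp.mapDomain_apply s.injective _ _
  refine ⟨?_, fun S => ⟨S.map s.symm.toEmbedding, ?_, ?_⟩⟩
  · simp only [h]; exact Equiv.sum_comp s.symm k
  · simp
  · rw [Finset.sum_map]; simp [h]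

theorem Dm_pinch {i j : Fin N} (hij : i ≠ j) {k h : Fin N →₀ ℕ}
    (ho : ∀ l, l ≠ i → l ≠ j → k l = h l) (hs : k i + k j = h i + h j)
    (hi : k i ≤ max (h i) (h j)) (hj : k j ≤ max (h i) (h j)) : Dm k h := by
  have hu : ∀ (f : Fin N →₀ ℕ), ∑ l, f l = f i + f j + ∑ l ∈ (Finset.univ.erase i).erase j, f l := by
    intro f
    rw [add_assoc, Finset.add_sum_erase _ _ (Finset.mem_erase.mpr ⟨hij.symm, Finset.mem_univ _⟩),
      Finset.add_sum_erase _ _ (Finset.mem_univ _)]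
  refine ⟨?_, fun S => ?_⟩
  · rw [hu, hu h, hs]
    congr 1
    refine Finset.sum_congr rfl fun l hl => ?_
    simp only [Finset.mem_erase] at hl
    exact ho l hl.2.1 hl.1
  · -- split S
    set R := (S.erase i).erase j with hR
    have hiR : i ∉ R := by simp [hR]
    have hjR : j ∉ R := by simp [hR]
    have hRs : ∑ l ∈ R, k l = ∑ l ∈ R, h l := by
      refine Finset.sum_congr rfl fun l hl => ?_
      simp only [hR, Finset.mem_erase] at hl
      exact ho l hl.2.1 hl.1
    -- the one-element case
    have one : ∀ x, x ≤ max (h i) (h j) → R.card + 1 ≤ S.card →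
        ∃ S' : Finset (Fin N), S'.card ≤ S.card ∧ x + ∑ l ∈ R, k l ≤ ∑ l ∈ S', h l := by
      intro x hx hc
      rcases le_max_iff.mp hx with hx | hx
      · refine ⟨insert i R, by rw [Finset.card_insert_of_notMem hiR]; exact hc, ?_⟩
        rw [Finset.sum_insert hiR, hRs]; omega
      · refine ⟨insert j R, by rw [Finset.card_insert_of_notMem hjR]; exact hc, ?_⟩
        rw [Finset.sum_insert hjR, hRs]; omega
    by_cases his : i ∈ S
    · by_cases hjs : j ∈ S
      · refine ⟨S, le_rfl, ?_⟩
        rw [← Finset.add_sum_erase S _ his, ← Finset.add_sum_erase (S.erase i) _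
          (Finset.mem_erase.mpr ⟨hij.symm, hjs⟩), ← Finset.add_sum_erase S _ his,
          ← Finset.add_sum_erase (S.erase i) _ (Finset.mem_erase.mpr ⟨hij.symm, hjs⟩)]
        rw [← hR, hRs]; omega
      · have : R = S.erase i := by rw [hR, Finset.erase_eq_of_notMem (by simp [hjs])]
        rw [← Finset.add_sum_erase S _ his, ← this]
        exact one _ hi (by rw [this, Finset.card_erase_add_one his])
    · by_cases hjs : j ∈ S
      · have : R = S.erase j := by rw [hR, Finset.erase_eq_of_notMem his]
        rw [← Finset.add_sum_erase S _ hjs, ← this]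
        exact one _ hj (by rw [this, Finset.card_erase_add_one hjs])
      · have : R = S := by
          rw [hR, Finset.erase_eq_of_notMem his, Finset.erase_eq_of_notMem hjs]
        rw [← this, hRs]
        exact ⟨R, le_rfl, le_rfl⟩

/-- explicit form of `x_j dd_ij` on monomials -/
theorem X_mul_dd {i j : Fin N} (hij : i ≠ j) (k : Fin N →₀ ℕ) :
    ∃ (e : ℤ) (p : ℕ) (ks : ℕ → Fin N →₀ ℕ), (∀ l < p, Dm (ks l) k) ∧
      ∀ (K : Type) [Field K], X j * dd i j (monomial k (1 : K)) =
        (e : MvPolynomial (Fin N) K) * ∑ l ∈ Finset.range p, monomial (ks l) 1 := by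
  set base : Fin N →₀ ℕ := (k.erase i).erase j + Finsupp.single i (min (k i) (k j)) +
    Finsupp.single j (min (k i) (k j)) with hbase
  set m := min (k i) (k j) with hm
  have bi : base i = m := by simp [hbase, hij]
  have bj : base j = m := by simp [hbase, hij.symm]
  have bo : ∀ l, l ≠ i → l ≠ j → base l = k l := by
    intro l h1 h2
    simp [hbase, h1, h2]
  have binv : base.mapDomain (Equiv.swap i j) = base := by
    ext l
    have h : base.mapDomain (Equiv.swap i j) l = base (Equiv.swap i j l) := by
      conv_lhs => rw [← Equiv.swap_apply_self i j l]
      exact Finsupp.mapDomain_apply (Equiv.swap i j).injective _ _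
    rw [h]
    by_cases h1 : l = i
    · subst h1; rw [Equiv.swap_apply_left, bi, bj]
    by_cases h2 : l = j
    · subst h2; rw [Equiv.swap_apply_right, bi, bj]
    rw [Equiv.swap_apply_of_ne_of_ne h1 h2]
  set p := max (k i) (k j) - m with hp
  have hks : ∀ l < p, Dm (base + Finsupp.single i l + Finsupp.single j (p - l)) k := by
    intro l hl
    refine Dm_pinch hij ?_ ?_ ?_ ?_
    · intro q h1 h2; simp [h1, h2, bo q h1 h2]
    all_goals simp [bi, bj, hij, hij.symm]
    all_goals omega
  rcases le_total (k j) (k i) with h | h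
  · refine ⟨1, p, fun l => base + Finsupp.single i l + Finsupp.single j (p - l), hks, ?_⟩
    intro K _
    have hk : k = base + Finsupp.single i p := by
      ext q
      by_cases h1 : q = i
      · subst h1; simp [bi]; omega
      by_cases h2 : q = j
      · subst h2; simp [bj, h1]; omega
      simp [bo q h1 h2, h1]
    have hmon : (monomial k (1 : K)) = monomial base 1 * X i ^ p := by
      rw [X_pow_eq_monomial, monomial_mul, ← hk, one_mul]
    have hb : sw i j (monomial base (1 : K)) = monomial base 1 := by
      rw [rename_monomial, binv]
    rw [hmon, dd_inv_mul hb]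
    have hd : dd i j (X i ^ p : MvPolynomial (Fin N) K) =
        ∑ l ∈ Finset.range p, X i ^ l * X j ^ (p - 1 - l) := by
      apply dd_unique hij
      rw [mul_comm, geom_sum₂_mul, map_pow, rename_X, Equiv.swap_apply_left]
    rw [hd, Finset.mul_sum, Finset.mul_sum, Int.cast_one, one_mul]
    refine Finset.sum_congr rfl fun l hl => ?_
    have hl := Finset.mem_range.mp hl
    have : (monomial (base + Finsupp.single i l + Finsupp.single j (p - l)) (1 : K)) =
        monomial base 1 * X i ^ l * X j ^ (p - l) := by
      rw [X_pow_eq_monomial, X_pow_eq_monomial, monomial_mul, monomial_mul]; simp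
    rw [this, show p - l = (p - 1 - l) + 1 by omega, pow_succ]; ring
  · refine ⟨-1, p, fun l => base + Finsupp.single i l + Finsupp.single j (p - l), hks, ?_⟩
    intro K _
    have hk : k = base + Finsupp.single j p := by
      ext q
      by_cases h1 : q = i
      · subst h1; simp [bi, hij]; omega
      by_cases h2 : q = j
      · subst h2; simp [bj]; omega
      simp [bo q h1 h2, h2]
    have hmon : (monomial k (1 : K)) = monomial base 1 * X j ^ p := by
      rw [X_pow_eq_monomial, monomial_mul, ← hk, one_mul]
    have hb : sw i j (monomial base (1 : K)) = monomial base 1 := by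
      rw [rename_monomial, binv]
    rw [hmon, dd_inv_mul hb]
    have hd : dd i j (X j ^ p : MvPolynomial (Fin N) K) =
        -∑ l ∈ Finset.range p, X i ^ l * X j ^ (p - 1 - l) := by
      apply dd_unique hij
      rw [mul_neg, mul_comm, geom_sum₂_mul, map_pow, rename_X, Equiv.swap_apply_right]; ring
    rw [hd, mul_neg, mul_neg, Finset.mul_sum, Finset.mul_sum, Int.cast_neg, Int.cast_one, neg_mul,
      one_mul]
    congr 1
    refine Finset.sum_congr rfl fun l hl => ?_
    have hl := Finset.mem_range.mp hl
    have : (monomial (base + Finsupp.single i l + Finsupp.single j (p - l)) (1 : K)) =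
        monomial base 1 * X i ^ l * X j ^ (p - l) := by
      rw [X_pow_eq_monomial, X_pow_eq_monomial, monomial_mul, monomial_mul]; simp
    rw [this, show p - l = (p - 1 - l) + 1 by omega, pow_succ]; ring

variable {K : Type} [Field K]

/-- polynomials all of whose exponents are dominated by `h` -/
def W (K : Type) [Field K] (h : Fin N →₀ ℕ) : Submodule K (MvPolynomial (Fin N) K) where
  carrier := {f | ∀ k, coeff k f ≠ 0 → Dm k h}
  add_mem' := by
    intro f g hf hg k hk
    rw [coeff_add] at hk
    by_cases h0 : coeff k f = 0
    · rw [h0, zero_add] at hk; exact hg k hk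
    · exact hf k h0
  zero_mem' := by intro k hk; simp at hk
  smul_mem' := by
    intro c f hf k hk
    rw [coeff_smul, smul_eq_mul] at hk
    exact hf k (right_ne_zero_of_mul hk)

theorem mem_W {h : Fin N →₀ ℕ} {f : MvPolynomial (Fin N) K} :
    f ∈ W K h ↔ ∀ k, coeff k f ≠ 0 → Dm k h := Iff.rfl

theorem monomial_mem_W {k h : Fin N →₀ ℕ} (hk : Dm k h) (c : K) : monomial k c ∈ W K h := by
  intro l hl
  rw [coeff_monomial] at hl
  split_ifs at hl with e
  · exact e ▸ hk
  · exact absurd rfl hl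

theorem W_mono {k h : Fin N →₀ ℕ} (hk : Dm k h) : W K k ≤ W K h :=
  fun _ hf l hl => (hf l hl).trans hk

theorem W_map (L : MvPolynomial (Fin N) K →ₗ[K] MvPolynomial (Fin N) K)
    (hL : ∀ k, L (monomial k 1) ∈ W K k) {h : Fin N →₀ ℕ} {f : MvPolynomial (Fin N) K}
    (hf : f ∈ W K h) : L f ∈ W K h := by
  rw [f.as_sum, map_sum]
  refine Submodule.sum_mem _ fun k hk => ?_
  have : (monomial k (coeff k f)) = coeff k f • monomial k (1 : K) := by
    rw [smul_monomial, smul_eq_mul, mul_one]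
  rw [this, map_smul]
  exact Submodule.smul_mem _ _ (W_mono (hf k (mem_support_iff.mp hk)) (hL k))

theorem W_rename (s : Equiv.Perm (Fin N)) {h : Fin N →₀ ℕ} {f : MvPolynomial (Fin N) K}
    (hf : f ∈ W K h) : rename s f ∈ W K h := by
  refine W_map (rename s).toLinearMap (fun k => ?_) hf
  rw [AlgHom.toLinearMap_apply, rename_monomial]
  exact monomial_mem_W (Dm_perm s k) 1

theorem C_mul_mem_W {h : Fin N →₀ ℕ} {f : MvPolynomial (Fin N) K} (c : K)
    (hf : f ∈ W K h) : C c * f ∈ W K h := by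
  rw [C_mul']; exact Submodule.smul_mem _ _ hf

theorem int_mul_mem_W {h : Fin N →₀ ℕ} {f : MvPolynomial (Fin N) K} (c : ℤ)
    (hf : f ∈ W K h) : (c : MvPolynomial (Fin N) K) * f ∈ W K h := by
  have : (c : MvPolynomial (Fin N) K) = C (c : K) := by simp
  rw [this]; exact C_mul_mem_W _ hf

theorem X_pderiv_monomial (i : Fin N) (k : Fin N →₀ ℕ) (c : K) :
    X i * pderiv i (monomial k c) = C (k i : K) * monomial k c := by
  rw [pderiv_monomial]
  by_cases h : k i = 0
  · simp [h]
  rw [C_mul_monomial, X, monomial_mul, one_mul, mul_comm c]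
  congr 2
  refine Finsupp.ext fun l => ?_
  by_cases e : i = l
  · subst e; simp; omega
  · simp [e]

theorem W_Lam (a g : K) (i : Fin N) {h : Fin N →₀ ℕ} {f : MvPolynomial (Fin N) K}
    (hf : f ∈ W K h) : Lam a g i f ∈ W K h := by
  refine W_map _ (fun k => ?_) hf
  rw [Lam_apply, X_pderiv_monomial]
  refine Submodule.add_mem _ (C_mul_mem_W _ (C_mul_mem_W _ (monomial_mem_W (Dm.refl k) _)))
    (C_mul_mem_W _ (Submodule.sum_mem _ fun j hj => ?_))
  obtain ⟨e, p, ks, h1, h2⟩ := X_mul_dd (Finset.mem_erase.mp hj).1.symm k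
  rw [h2 K]
  exact int_mul_mem_W _ (Submodule.sum_mem _ fun l hl =>
    monomial_mem_W (h1 l (Finset.mem_range.mp hl)) _)

/-- squarefree monomial -/
abbrev xA (K : Type) [Field K] (A : Finset (Fin N)) : MvPolynomial (Fin N) K := ∏ a ∈ A, X a

theorem Lam_xA (a g : K) (i : Fin N) (A : Finset (Fin N)) (hi : i ∉ A) {h : Fin N →₀ ℕ} 
    {f : MvPolynomial (Fin N) K} (hf : f ∈ W K h) :
    ∃ f' ∈ W K h, Lam a g i (xA K A * f) = xA K A * f' := by
  induction A using Finset.induction_on with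
  | empty => exact ⟨_, W_Lam a g i hf, by simp⟩
  | insert b A hb ih =>
    have hib : i ≠ b := fun e => hi (by simp [e])
    have hiA : i ∉ A := fun e => hi (by simp [e])
    obtain ⟨f', hf', e⟩ := ih hiA
    refine ⟨f' - C g * sw i b f, Submodule.sub_mem _ hf' (C_mul_mem_W _ (W_rename _ hf)), ?_⟩
    have e2 : sw i b (xA K A) = xA K A := by
      rw [map_prod]
      refine Finset.prod_congr rfl fun c hc => ?_
      rw [rename_X, Equiv.swap_apply_of_ne_of_ne]
      · rintro rfl; exact hiA hc
      · rintro rfl; exact hb hc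
    rw [xA, Finset.prod_insert hb, mul_assoc, Lam_X_ne a g hib, e, map_mul, e2]
    ring

theorem UN_C_mul (a g u : K) (c : K) (f : MvPolynomial (Fin N) K) :
    UN a g u (C c * f) = C c * UN a g u f := by rw [C_mul', C_mul', map_smul]

theorem UN_xA (a g u : K) (A : Finset (Fin N)) {h : Fin N →₀ ℕ} {f : MvPolynomial (Fin N) K}
    (hf : UN a g u f ∈ W K h) : ∃ f' ∈ W K h, UN a g u (xA K A * f) = xA K A * f' := by
  induction A using Finset.induction_on with
  | empty => exact ⟨_, hf, by simp⟩
  | insert b A hb ih =>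
    obtain ⟨f', hf', e⟩ := ih
    obtain ⟨f'', hf'', e'⟩ := Lam_xA a g b A hb hf'
    refine ⟨f'' + C u * f', Submodule.add_mem _ hf'' (C_mul_mem_W _ hf'), ?_⟩
    rw [xA, Finset.prod_insert hb, mul_assoc, UN_X_mul, e, Xop_apply, e']
    ring

theorem xA_mul_mem {h : Fin N →₀ ℕ} {f : MvPolynomial (Fin N) K} (hf : f ∈ W K h)
    (A : Finset (Fin N)) (hA : ∀ i ∉ A, h i = 0) :
    xA K A * f ∈ W K (h + Finset.sum A fun i => Finsupp.single i 1) := by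
  have hx : xA K A = monomial (Finset.sum A fun i => Finsupp.single i 1) 1 := by
    rw [monomial_sum_one]; rfl
  have hval : ∀ i, (Finset.sum A fun i => Finsupp.single i 1 : Fin N →₀ ℕ) i =
      if i ∈ A then 1 else 0 := by
    intro i
    rw [Finsupp.finsetSum_apply]
    simp [Finsupp.single_apply]
  intro k hk
  rw [hx, coeff_monomial_mul', one_mul] at hk
  split_ifs at hk with hle
  · have hd := hf _ hk
    set s := (Finset.sum A fun i => Finsupp.single i 1 : Fin N →₀ ℕ) with hs
    obtain ⟨k', rfl⟩ : ∃ k', k = k' + s := ⟨k - s, (tsub_add_cancel_of_le hle).symm⟩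
    rw [add_tsub_cancel_right] at hd
    clear hk
    refine ⟨by simp only [Finsupp.add_apply, Finset.sum_add_distrib, hd.1], fun S => ?_⟩
    obtain ⟨S', h1, h2⟩ := hd.2 S
    have hS : ∀ T : Finset (Fin N), ∑ i ∈ T, s i = (T ∩ A).card := by
      intro T; simp only [hval]; simp
    obtain ⟨S'', h3, h4, h5⟩ := Finset.exists_subsuperset_card_eq
      (s := S' ∩ A) (t := A) (n := min A.card S.card) Finset.inter_subset_right
      (le_min (Finset.card_le_card Finset.inter_subset_right)
        ((Finset.card_le_card Finset.inter_subset_left).trans h1)) (min_le_left _ _)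
    refine ⟨S'', h5.le.trans (min_le_right _ _), ?_⟩
    simp only [Finsupp.add_apply, Finset.sum_add_distrib, hS]
    rw [Finset.inter_eq_left.mpr h4, h5]
    have e1 : ∑ i ∈ S', h i = ∑ i ∈ S' ∩ A, h i := by
      symm; apply Finset.sum_subset Finset.inter_subset_left
      intro i hi hi'; apply hA; intro h; exact hi' (Finset.mem_inter.mpr ⟨hi, h⟩)
    have e2 : ∑ i ∈ S' ∩ A, h i ≤ ∑ i ∈ S'', h i := Finset.sum_le_sum_of_subset h3
    have e3 : (S ∩ A).card ≤ min A.card S.card :=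
      le_min (Finset.card_le_card Finset.inter_subset_right)
        (Finset.card_le_card Finset.inter_subset_left)
    omega
  · exact absurd rfl hk

theorem UN_monomial_mem (a g u : K) (h : Fin N →₀ ℕ) : UN a g u (monomial h (1 : K)) ∈ W K h := by
  induction hd : (∑ i, h i) using Nat.strong_induction_on generalizing h with
  | _ n ih =>
    by_cases h0 : h = 0
    · subst h0
      have : (monomial 0 (1 : K) : MvPolynomial (Fin N) K) = C 1 := rfl
      rw [this, UN_C]; exact monomial_mem_W (Dm.refl 0) 1
    set s := (Finset.sum h.support fun i => Finsupp.single i 1 : Fin N →₀ ℕ) with hs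
    have hval : ∀ i, s i = if i ∈ h.support then 1 else 0 := by
      intro i
      rw [hs, Finsupp.finsetSum_apply]
      simp [Finsupp.single_apply]
    have hle : s ≤ h := by
      intro i; rw [hval]; split_ifs with e
      · have := Finsupp.mem_support_iff.mp e; omega
      · exact Nat.zero_le _
    obtain ⟨h', hh'⟩ : ∃ h', h = h' + s := ⟨h - s, (tsub_add_cancel_of_le hle).symm⟩
    clear_value s
    subst hh'
    have hs' := hs
    have hx : xA K (h' + s).support = monomial s 1 := by
      have e := monomial_sum_one (R := K) (h' + s).support (fun i => Finsupp.single i 1)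
      rw [← hs'] at e; rw [e]; rfl
    have hlt : ∑ i, h' i < n := by
      rw [← hd]
      obtain ⟨i, hi⟩ := Finsupp.support_nonempty_iff.mpr h0
      refine Finset.sum_lt_sum (fun i _ => by simp) ⟨i, Finset.mem_univ _, ?_⟩
      rw [Finsupp.add_apply, hval, if_pos hi]; omega
    have hm : monomial (h' + s) (1 : K) = xA K (h' + s).support * monomial h' 1 := by
      rw [hx, monomial_mul, one_mul, add_comm]
    obtain ⟨f', hf', e⟩ := UN_xA a g u (h' + s).support (ih _ hlt h' rfl)
    rw [hm, e]
    have := xA_mul_mem hf' (h' + s).support (by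
      intro i hi
      have := Finsupp.notMem_support_iff.mp hi
      simp at this; exact this.1)
    rwa [← hs'] at this

theorem W_UN (a g u : K) {h : Fin N →₀ ℕ} {f : MvPolynomial (Fin N) K}
    (hf : f ∈ W K h) : UN a g u f ∈ W K h :=
  W_map _ (UN_monomial_mem a g u) hf

end Dk

namespace Jk
open MvPolynomial Dk

theorem alpha_ne : alpha ≠ 0 := RatFunc.X_ne_zero

theorem toExp_eq (l : JPartition) : toExp l = Multiset.toFinsupp l := by
  ext i
  rw [toExp, Multiset.toFinsupp_apply, Finsupp.finsetSum_apply]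
  simp only [Finsupp.single_apply, Finset.sum_ite_eq', Multiset.mem_toFinset]
  split_ifs with h
  · rfl
  · exact (Multiset.count_eq_zero.mpr h).symm

/-- partitions and exponents -/
def ex : JPartition ≃+ Exp := Multiset.toFinsupp

theorem toExp_eq_ex (l : JPartition) : toExp l = ex l := toExp_eq l

theorem toExp_add (l m : JPartition) : toExp (l + m) = toExp l + toExp m := by
  simp only [toExp_eq_ex, map_add]

theorem toExp_cons (k : ℕ+) (m : JPartition) : toExp (k ::ₘ m) = Finsupp.single k 1 + toExp m := by
  rw [← Multiset.singleton_add, toExp_add]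
  congr 1
  rw [toExp_eq, Multiset.toFinsupp_singleton]

theorem toExp_zero : toExp 0 = 0 := by simp only [toExp_eq_ex, map_zero]

theorem toExp_inj {l m : JPartition} (h : toExp l = toExp m) : l = m := by
  simp only [toExp_eq_ex] at h; exact ex.injective h

theorem toExp_surj (e : Exp) : ∃ l, toExp l = e := ⟨ex.symm e, by rw [toExp_eq_ex]; simp⟩

theorem wt_add (a b : Exp) : wt (a + b) = wt a + wt b := by
  rw [wt, wt, wt, Finsupp.sum_add_index']
  · simp
  · intros; ring

theorem wt_single (k : ℕ+) (n : ℕ) : wt (Finsupp.single k n) = n * k := by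
  rw [wt, Finsupp.sum_single_index]; simp

theorem wt_zero : wt 0 = 0 := by simp [wt]

theorem psize_cons (k : ℕ+) (m : JPartition) : psize (k ::ₘ m) = k + psize m := by
  simp [psize]

theorem psize_zero : psize 0 = 0 := by simp [psize]

theorem psize_add (l m : JPartition) : psize (l + m) = psize l + psize m := by
  simp [psize]

theorem wt_toExp (l : JPartition) : wt (toExp l) = psize l := by
  induction l using Multiset.induction_on with
  | empty => rw [toExp_zero, wt_zero, psize_zero]
  | cons a s ih => rw [toExp_cons, wt_add, wt_single, ih, psize_cons, one_mul]

theorem pPow_zero : pPow 0 = 1 := by simp [pPow]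
theorem pPow_cons (k : ℕ+) (m : JPartition) : pPow (k ::ₘ m) = X k * pPow m := by
  simp [pPow]

theorem pPow_eq (l : JPartition) : pPow l = monomial (toExp l) 1 := by
  induction l using Multiset.induction_on with
  | empty => rw [toExp_zero, pPow_zero]; rfl
  | cons a s ih => rw [toExp_cons, pPow_cons, ih, X, monomial_mul, one_mul]

/-- weights -/
abbrev w0 : ℕ+ → ℕ := fun i => (i : ℕ)

theorem wt_eq (m : Exp) : Finsupp.weight w0 m = wt m := by
  rw [Finsupp.weight_apply, wt]; rfl

/-- homogeneous of weight n -/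
abbrev Hom (n : ℕ) (f : SymA) : Prop := IsWeightedHomogeneous w0 f n

/-- weight at most n -/
def LE (n : ℕ) (f : SymA) : Prop := ∀ m, coeff m f ≠ 0 → wt m ≤ n

theorem Hom.LE {n : ℕ} {f : SymA} (h : Hom n f) : LE n f := fun m hm => by
  rw [← wt_eq, h hm]

theorem LE.mono {n k : ℕ} (hk : n ≤ k) {f : SymA} (h : LE n f) : LE k f :=
  fun m hm => (h m hm).trans hk

theorem coeff_pderiv' (k : ℕ+) (f : SymA) (m : Exp) :
    coeff m (pderiv k f) = (m k + 1 : ℕ) * coeff (m + Finsupp.single k 1) f := by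
  induction f using MvPolynomial.induction_on' with
  | add p q hp hq => simp only [map_add, coeff_add, hp, hq]; ring
  | monomial u a =>
    rw [pderiv_monomial, coeff_monomial, coeff_monomial]
    by_cases h : u = m + Finsupp.single k 1
    · subst h
      simp; ring
    · rw [if_neg h, mul_zero]
      split_ifs with e
      · by_cases hu : u k = 0
        · simp [hu]
        · exfalso; apply h
          rw [← e]
          refine (tsub_add_cancel_of_le ?_).symm
          rw [Finsupp.single_le_iff]; omega
      · rfl

theorem LE.pderiv {n : ℕ} {f : SymA} (h : LE n f) (k : ℕ+) (g : SymA) (hg : g = pderiv k f) :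
    LE (n - k) g := by
  subst hg
  intro m hm
  rw [coeff_pderiv'] at hm
  have := h _ (right_ne_zero_of_mul hm)
  rw [wt_add, wt_single] at this
  omega

theorem LE.pderiv_zero {n : ℕ} {f : SymA} (h : LE n f) {k : ℕ+} (hk : n < k) :
    MvPolynomial.pderiv k f = 0 := by
  ext m
  rw [coeff_pderiv', coeff_zero]
  by_contra hc
  have := h _ (right_ne_zero_of_mul hc)
  rw [wt_add, wt_single] at this
  omega

theorem Hom.pderiv {n : ℕ} {f : SymA} (h : Hom n f) (k : ℕ+) :
    ∀ m, coeff m (MvPolynomial.pderiv k f) ≠ 0 → wt m + k = n := by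
  intro m hm
  rw [coeff_pderiv'] at hm
  have := h (right_ne_zero_of_mul hm)
  rw [wt_eq, wt_add, wt_single] at this
  omega

theorem pd_finite (f : SymA) : (Function.support fun k => pderiv k f).Finite := by
  refine Set.Finite.subset (Finset.finite_toSet f.vars) ?_
  intro k hk
  by_contra hc
  exact hk (pderiv_eq_zero_of_notMem_vars hc)

/-- evaluation with a sign/multiplicity -/
def ph (g : F) (N : ℕ) : SymA →ₐ[F] MvPolynomial (Fin N) F :=
  aeval fun k : ℕ+ => C g * ∑ j : Fin N, X j ^ (k : ℕ)

theorem ph_X (g : F) (N : ℕ) (k : ℕ+) : ph g N (X k) = C g * ∑ j : Fin N, X j ^ (k : ℕ) := by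
  rw [ph, aeval_X]

theorem ph_C (g : F) (N : ℕ) (c : F) : ph g N (C c) = C c := by
  rw [ph, aeval_C]; rfl

theorem ph_one (N : ℕ) : ph 1 N = evalN N := by
  unfold ph evalN; simp

theorem ph_rename (g : F) (N : ℕ) (s : Equiv.Perm (Fin N)) (f : SymA) :
    rename s (ph g N f) = ph g N f := by
  induction f using MvPolynomial.induction_on with
  | C c => rw [ph_C, rename_C]
  | add p q hp hq => simp only [map_add, hp, hq]
  | mul_X p k hp =>
    rw [map_mul, map_mul, hp, ph_X, map_mul, rename_C, map_sum]
    simp only [map_pow, rename_X]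
    rw [Equiv.sum_comp s (fun j => (X j : MvPolynomial (Fin N) F) ^ (k : ℕ))]

theorem chain_fin (g : F) (N : ℕ) (i : Fin N) (f : SymA) :
    X i * pderiv i (ph g N f) = ∑ᶠ k : ℕ+, C g * (C ((k : ℕ) : F) * (X i ^ (k : ℕ) * ph g N (pderiv k f))) := by
  have fin : ∀ f : SymA, (Function.support fun k : ℕ+ =>
      C g * (C ((k : ℕ) : F) * (X i ^ (k : ℕ) * ph g N (pderiv k f)))).Finite := by
    intro f
    refine (pd_finite f).subset ?_
    intro k hk hc
    apply hk
    simp only at hc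
    simp [hc]
  induction f using MvPolynomial.induction_on with
  | C c => simp [ph_C]
  | add p q hp hq =>
    rw [map_add, map_add, mul_add, hp, hq, ← finsum_add_distrib (fin p) (fin q)]
    refine finsum_congr fun k => ?_
    rw [map_add, map_add]; ring
  | mul_X p n hp =>
    rw [map_mul, Derivation.leibniz, smul_eq_mul, smul_eq_mul, mul_add]
    have e1 : X i * (ph g N (X n) * pderiv i (ph g N p)) = ph g N (X n) * (X i * pderiv i (ph g N p)) := by
      ring
    rw [e1, hp, mul_finsum]
    have e2 : X i * (ph g N p * pderiv i (ph g N (X n))) =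
        ∑ᶠ k : ℕ+, if k = n then C g * (C ((k : ℕ) : F) * (X i ^ (k : ℕ) * ph g N p)) else 0 := by
      rw [finsum_eq_single _ n (by intro k hk; rw [if_neg hk]), if_pos rfl, ph_X]
      rw [Derivation.leibniz, pderiv_C, smul_zero, add_zero, map_sum, smul_eq_mul,
        Finset.sum_eq_single i]
      · rw [pderiv_pow, pderiv_X_self]
        have hx : (X i : MvPolynomial (Fin N) F) ^ (n : ℕ) = X i ^ ((n : ℕ) - 1) * X i := by
          rw [← pow_succ, Nat.sub_add_cancel n.pos]
        rw [hx]
        simp only [map_natCast]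
        ring
      · intro j _ hj; rw [pderiv_pow, pderiv_X_of_ne hj, mul_zero]
      · intro h; exact absurd (Finset.mem_univ _) h
    rw [e2, ← finsum_add_distrib]
    · refine finsum_congr fun k => ?_
      rw [Derivation.leibniz, smul_eq_mul, smul_eq_mul, map_add, map_mul, map_mul]
      split_ifs with e
      · subst e; rw [pderiv_X_self, map_one]; ring
      · rw [pderiv_X_of_ne (Ne.symm e), map_zero]; ring
    · refine Set.Finite.subset (Set.finite_singleton n) ?_
      intro k hk; by_contra hc; apply hk; exact if_neg hc
    · refine (fin p).subset ?_
      intro k hk hc; apply hk; simp only at hc; simp only [hc, mul_zero]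

theorem chain (g : F) (N : ℕ) (i : Fin N) (f : SymA) (s : Finset ℕ+) (hs : ∀ j ∉ s, pderiv j f = 0) :
    X i * pderiv i (ph g N f) =
      C g * ∑ k ∈ s, C ((k : ℕ) : F) * (X i ^ (k : ℕ) * ph g N (pderiv k f)) := by
  rw [chain_fin, finsum_eq_sum_of_support_subset (s := s), Finset.mul_sum]
  intro k hk
  by_contra hc
  apply hk
  show C g * (C ((k : ℕ) : F) * (X i ^ (k : ℕ) * ph g N (pderiv k f))) = 0
  rw [hs k (by simpa using hc)]; simp

/-- power sums with natural indices -/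
def pn (k : ℕ) : SymA := if 0 < k then X k.toPNat' else 0

theorem pn_coe (k : ℕ+) : pn k = X k := by
  rw [pn, if_pos k.pos, PNat.coe_toPNat']

theorem ph_pn (g : F) (N : ℕ) {k : ℕ} (h : 0 < k) : ph g N (pn k) = C g * ∑ j : Fin N, X j ^ k := by
  rw [pn, if_pos h, ph_X]; simp only [Nat.toPNat'_coe, if_pos h]

theorem X_mul_dd_pow {N : ℕ} {i j : Fin N} (hij : i ≠ j) (k : ℕ) :
    X j * dd i j (X i ^ k : MvPolynomial (Fin N) F) =
      ∑ l ∈ Finset.range k, X i ^ l * X j ^ (k - l) := by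
  have hd : dd i j (X i ^ k : MvPolynomial (Fin N) F) =
      ∑ l ∈ Finset.range k, X i ^ l * X j ^ (k - 1 - l) := by
    apply dd_unique hij
    rw [mul_comm, geom_sum₂_mul, map_pow, rename_X, Equiv.swap_apply_left]
  rw [hd, Finset.mul_sum]
  refine Finset.sum_congr rfl fun l hl => ?_
  have hl := Finset.mem_range.mp hl
  rw [show k - l = (k - 1 - l) + 1 by omega, pow_succ]; ring

/-- the two admissible parameters -/
def Good (a g : F) : Prop := a * g = alpha ∧ a - g = alpha - 1

theorem good_one : Good alpha 1 := ⟨by ring, rfl⟩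
theorem good_neg : Good (-1) (-alpha) := ⟨by ring, by ring⟩

theorem lax {a g : F} (hag : Good a g) (N : ℕ) (i : Fin N) (k : ℕ) (f : SymA) (s : Finset ℕ+)
    (hs : ∀ j ∉ s, pderiv j f = 0) :
    Lam a g i (X i ^ k * ph g N f) =
      C alpha * ∑ j ∈ s, C ((j : ℕ) : F) * (X i ^ (k + j : ℕ) * ph g N (pderiv j f)) +
      ∑ l ∈ Finset.range k, X i ^ l * ph g N (pn (k - l) * f) +
      C (alpha - 1) * (C (k : F) * (X i ^ k * ph g N f)) := by
  have h1 : X i * pderiv i (X i ^ k * ph g N f) = C (k : F) * (X i ^ k * ph g N f) +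
      X i ^ k * (X i * pderiv i (ph g N f)) := by
    rw [Derivation.leibniz, pderiv_pow, pderiv_X_self, smul_eq_mul, smul_eq_mul]
    rcases k with _ | k
    · simp
    · rw [Nat.add_sub_cancel, pow_succ]
      simp only [map_natCast]
      ring
  have h2 : ∑ j ∈ Finset.univ.erase i, X j * dd i j (X i ^ k * ph g N f) =
      ph g N f * ∑ j ∈ Finset.univ.erase i, ∑ l ∈ Finset.range k, X i ^ l * X j ^ (k - l) := by
    rw [Finset.mul_sum]
    refine Finset.sum_congr rfl fun j hj => ?_
    rw [mul_comm (X i ^ k), dd_inv_mul (ph_rename g N _ f), ← X_mul_dd_pow (Finset.mem_erase.mp hj).1.symm]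
    ring
  have h3 : ∑ j ∈ Finset.univ.erase i, ∑ l ∈ Finset.range k, (X i ^ l * X j ^ (k - l) : MvPolynomial (Fin N) F) =
      ∑ l ∈ Finset.range k, X i ^ l * (∑ j, X j ^ (k - l)) - C (k : F) * X i ^ k := by
    rw [Finset.sum_comm]
    have : (C (k : F) * X i ^ k : MvPolynomial (Fin N) F) = ∑ l ∈ Finset.range k, X i ^ k := by
      simp
    rw [this, ← Finset.sum_sub_distrib]
    refine Finset.sum_congr rfl fun l hl => ?_
    have hl := Finset.mem_range.mp hl
    rw [← Finset.mul_sum, ← Finset.add_sum_erase _ _ (Finset.mem_univ i), mul_add, ← pow_add,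
      show l + (k - l) = k by omega]
    ring
  rw [Lam_apply, h1, h2, h3, chain g N i f s hs]
  have h4 : ∑ l ∈ Finset.range k, X i ^ l * ph g N (pn (k - l) * f) =
      C g * (ph g N f * ∑ l ∈ Finset.range k, X i ^ l * (∑ j, X j ^ (k - l))) := by
    rw [Finset.mul_sum, Finset.mul_sum]
    refine Finset.sum_congr rfl fun l hl => ?_
    have hl := Finset.mem_range.mp hl
    rw [map_mul, ph_pn g N (by omega)]; ring
  have h5 : ∑ j ∈ s, C ((j : ℕ) : F) * (X i ^ (k + j : ℕ) * ph g N (pderiv j f)) =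
      X i ^ k * ∑ j ∈ s, C ((j : ℕ) : F) * (X i ^ (j : ℕ) * ph g N (pderiv j f)) := by
    rw [Finset.mul_sum]
    refine Finset.sum_congr rfl fun j _ => ?_
    rw [pow_add]; ring
  rw [h4, h5, ← hag.2, ← hag.1]
  simp only [map_sub, map_mul]
  ring
end Jk

namespace Jk
open MvPolynomial Dk

/-- locally finite sums of linear maps -/
def fsum {A ι : Type} [AddCommGroup A] [Module F A] (L : ι → A →ₗ[F] A)
    (h : ∀ f, (Function.support fun j => L j f).Finite) : A →ₗ[F] A where
  toFun f := ∑ᶠ j, L j f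
  map_add' f g := by
    rw [← finsum_add_distrib (h f) (h g)]
    exact finsum_congr fun j => map_add _ _ _
  map_smul' c f := by
    rw [RingHom.id_apply, smul_finsum]
    exact finsum_congr fun j => map_smul _ _ _

theorem pdY_finite (f : PY) : {v : ℕ+ ⊕ ℕ | pderiv v f ≠ 0}.Finite := by
  refine Set.Finite.subset (Finset.finite_toSet f.vars) ?_
  intro k hk
  by_contra hc
  exact hk (pderiv_eq_zero_of_notMem_vars hc)

/-- multiplication by a fixed element -/
abbrev ml (g : PY) : PY →ₗ[F] PY := LinearMap.mulLeft F g
/-- derivative as a linear map -/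
abbrev dl (v : ℕ+ ⊕ ℕ) : PY →ₗ[F] PY := (pderiv v : Derivation F PY PY).toLinearMap

theorem finY (g : ℕ → PY) (v : ℕ → ℕ+ ⊕ ℕ) (hv : Function.Injective v) (f : PY) :
    (Function.support fun j => g j * pderiv (v j) f).Finite := by
  refine Set.Finite.subset ((pdY_finite f).preimage hv.injOn) ?_
  intro j hj hc
  apply hj
  simp only at hc ⊢
  rw [hc, mul_zero]

theorem finP (g : ℕ+ → PY) (v : ℕ+ → ℕ+ ⊕ ℕ) (hv : Function.Injective v) (f : PY) :
    (Function.support fun j => g j * pderiv (v j) f).Finite := by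
  refine Set.Finite.subset ((pdY_finite f).preimage hv.injOn) ?_
  intro j hj hc
  apply hj
  simp only at hc ⊢
  rw [hc, mul_zero]

/-- linear version of `Yplus` -/
def YL : PY →ₗ[F] PY := fsum (fun j : ℕ => ml (yv (j + 1)) ∘ₗ dl (Sum.inr j)) (fun f =>
  finY (fun j => yv (j + 1)) Sum.inr Sum.inr_injective f)

theorem YL_apply (f : PY) : YL f = Yplus f := rfl

/-- linear version of `ThetaY` -/
def TL : PY →ₗ[F] PY := fsum (fun j : ℕ+ => ml (pv j) ∘ₗ dl (Sum.inr (j : ℕ))) (fun f =>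
  finP (fun j => pv j) (fun j => Sum.inr (j : ℕ)) (fun a b h => by simpa using h) f)

theorem TL_apply (f : PY) : TL f = ThetaY f := rfl

/-- first summand -/
def G1 : PY →ₗ[F] PY := fsum (fun i : ℕ+ => fsum (fun j : ℕ+ =>
    ((j : ℕ) : F) • (ml (yv ((i : ℕ) + (j : ℕ))) ∘ₗ dl (Sum.inl j) ∘ₗ dl (Sum.inr ((i : ℕ) - 1))))
    (fun f => by
      refine (finP (fun j => yv ((i : ℕ) + (j : ℕ))) Sum.inl Sum.inl_injective
        (pderiv (Sum.inr ((i : ℕ) - 1)) f)).subset ?_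
      intro j hj hc
      apply hj
      simp only at hc
      show ((j : ℕ) : F) • (yv ((i : ℕ) + (j : ℕ)) *
        MvPolynomial.pderiv (Sum.inl j) (MvPolynomial.pderiv (Sum.inr ((i : ℕ) - 1)) f)) = 0
      rw [hc, smul_zero])) (fun f => by
        refine Set.Finite.subset ((pdY_finite f).preimage
          (f := fun i : ℕ+ => Sum.inr ((i : ℕ) - 1)) ?_) ?_
        · intro a _ b _ h
          simp only [Sum.inr.injEq] at h
          have := a.pos; have := b.pos
          exact PNat.coe_injective (by omega)
        · intro i hi hc
          apply hi
          show ∑ᶠ j : ℕ+, ((j : ℕ) : F) • (yv ((i : ℕ) + (j : ℕ)) *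
            MvPolynomial.pderiv (Sum.inl j) (MvPolynomial.pderiv (Sum.inr ((i : ℕ) - 1)) f)) = 0
          simp only at hc
          simp [hc])

/-- second summand -/
def G2 : PY →ₗ[F] PY := fsum (fun i : ℕ+ => fsum (fun j : ℕ+ =>
    ml (yv (i : ℕ) * pv j) ∘ₗ dl (Sum.inr ((i : ℕ) + (j : ℕ) - 1)))
    (fun f => by
      refine finP (fun j => yv (i : ℕ) * pv j) (fun j => Sum.inr ((i : ℕ) + (j : ℕ) - 1)) ?_ f
      intro a b h
      simp only [Sum.inr.injEq] at h
      have := a.pos; have := b.pos; have := i.pos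
      exact PNat.coe_injective (by omega))) (fun f => by
        obtain ⟨M, hM⟩ : ∃ M : ℕ, ∀ k, M ≤ k → pderiv (Sum.inr k : ℕ+ ⊕ ℕ) f = 0 := by
          have := ((pdY_finite f).preimage (f := (Sum.inr : ℕ → ℕ+ ⊕ ℕ))
            Sum.inr_injective.injOn).bddAbove
          obtain ⟨M, hM⟩ := this
          refine ⟨M + 1, fun k hk => ?_⟩
          by_contra hc
          have := hM (a := k) hc
          omega
        refine Set.Finite.subset (Set.finite_Iic (M.succPNat)) ?_
        intro i hi
        by_contra hc
        apply hi
        show ∑ᶠ j : ℕ+, yv (i : ℕ) * pv j * pderiv (Sum.inr ((i : ℕ) + (j : ℕ) - 1)) f = 0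
        rw [← finsum_zero (α := ℕ+)]
        refine finsum_congr fun j => ?_
        rw [hM, mul_zero]
        simp only [Set.mem_Iic, not_le, ← PNat.coe_lt_coe, Nat.succPNat_coe] at hc
        have := j.pos
        omega)

/-- third summand -/
def G3 : PY →ₗ[F] PY := fsum (fun i : ℕ+ => ((i : ℕ) : F) •
      (ml (yv ((i : ℕ) + 1)) ∘ₗ dl (Sum.inr (i : ℕ)))) (fun f => by
      refine (finP (fun j => yv ((j : ℕ) + 1)) (fun j => Sum.inr (j : ℕ))
        (fun a b h => by simpa using h) f).subset ?_
      intro j hj hc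
      apply hj
      simp only at hc
      show ((j : ℕ) : F) • (yv ((j : ℕ) + 1) * pderiv (Sum.inr (j : ℕ)) f) = 0
      rw [hc, smul_zero])

/-- linear version of `GammaY` -/
def GaL : PY →ₗ[F] PY := alpha • G1 + G2 + (alpha - 1) • G3

theorem GaL_apply (f : PY) : GaL f = GammaY f := rfl

/-- the basic y-linear elements -/
def yf (k : ℕ) (f : SymA) : PY := yv k * rename Sum.inl f

theorem pd_rename_inr (k : ℕ) (f : SymA) :
    pderiv (Sum.inr k) (rename (Sum.inl : ℕ+ → ℕ+ ⊕ ℕ) f) = 0 := by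
  apply pderiv_eq_zero_of_notMem_vars
  intro h
  have := vars_rename (Sum.inl : ℕ+ → ℕ+ ⊕ ℕ) f h
  simp at this

theorem pd_rename_inl (k : ℕ+) (f : SymA) :
    pderiv (Sum.inl k) (rename (Sum.inl : ℕ+ → ℕ+ ⊕ ℕ) f) = rename Sum.inl (pderiv k f) :=
  pderiv_rename Sum.inl_injective k f

theorem pd_yf_inr (j k : ℕ) (f : SymA) :
    pderiv (Sum.inr j) (yf k f) = if j = k then rename Sum.inl f else 0 := by
  rw [yf, Derivation.leibniz, pd_rename_inr, smul_zero, zero_add, yv]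
  split_ifs with h
  · subst h; rw [pderiv_X_self, smul_eq_mul, mul_one]
  · rw [pderiv_X_of_ne (by simpa using Ne.symm h), smul_zero]

theorem YL_yf (k : ℕ) (f : SymA) : YL (yf k f) = yf (k + 1) f := by
  rw [YL_apply, Yplus, finsum_eq_single _ k]
  · rw [pd_yf_inr, if_pos rfl]; rfl
  · intro j hj; rw [pd_yf_inr, if_neg hj, mul_zero]

theorem TL_yf (k : ℕ) (f : SymA) (hk : 0 < k) : dropY (TL (yf k f)) = pn k * f := by
  obtain ⟨k, rfl⟩ : ∃ k' : ℕ+, k = k' := ⟨⟨k, hk⟩, rfl⟩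
  rw [TL_apply, ThetaY, finsum_eq_single _ k]
  · rw [pd_yf_inr, if_pos rfl, map_mul, pn_coe, pv, dropY, aeval_X, aeval_rename]
    congr 1
    show aeval (fun i : ℕ+ => (X i : SymA)) f = f
    rw [aeval_X_left, AlgHom.id_apply]
  · intro j hj; rw [pd_yf_inr, if_neg (fun h => hj (PNat.coe_injective h)), mul_zero]

theorem G1_yf (k : ℕ) (f : SymA) (s : Finset ℕ+) (hs : ∀ j ∉ s, pderiv j f = 0) :
    G1 (yf k f) = ∑ j ∈ s, ((j : ℕ) : F) • yf (k + 1 + j) (pderiv j f) := by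
  show (∑ᶠ i : ℕ+, ∑ᶠ j : ℕ+, ((j : ℕ) : F) • (yv ((i : ℕ) + (j : ℕ)) *
        MvPolynomial.pderiv (Sum.inl j) (MvPolynomial.pderiv (Sum.inr ((i : ℕ) - 1)) (yf k f)))) = _
  rw [finsum_eq_single _ k.succPNat]
  · rw [finsum_eq_sum_of_support_subset (s := s)]
    · refine Finset.sum_congr rfl fun j _ => ?_
      rw [pd_yf_inr, if_pos (by simp), pd_rename_inl]; rfl
    · intro j hj
      by_contra hc
      apply hj
      show ((j : ℕ) : F) • (yv ((k.succPNat : ℕ) + (j : ℕ)) *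
        MvPolynomial.pderiv (Sum.inl j) (MvPolynomial.pderiv (Sum.inr ((k.succPNat : ℕ) - 1)) (yf k f))) = 0
      rw [pd_yf_inr, if_pos (by simp), pd_rename_inl, hs j (by simpa using hc)]
      simp
  · intro i hi
    rw [← finsum_zero (α := ℕ+)]
    refine finsum_congr fun j => ?_
    rw [pd_yf_inr, if_neg, map_zero, mul_zero, smul_zero]
    intro h
    apply hi
    have := i.pos
    apply PNat.coe_injective
    rw [Nat.succPNat_coe]; omega

theorem G2_yf (k : ℕ) (f : SymA) :
    G2 (yf k f) = ∑ l ∈ Finset.range k, yf (l + 1) (pn (k - l) * f) := by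
  show (∑ᶠ i : ℕ+, ∑ᶠ j : ℕ+, yv (i : ℕ) * pv j * pderiv (Sum.inr ((i : ℕ) + (j : ℕ) - 1)) (yf k f)) = _
  have h1 : ∀ i : ℕ+, (∑ᶠ j : ℕ+, yv (i : ℕ) * pv j *
      pderiv (Sum.inr ((i : ℕ) + (j : ℕ) - 1)) (yf k f)) =
      if (i : ℕ) ≤ k then yf i (pn (k + 1 - i) * f) else 0 := by
    intro i
    split_ifs with h
    · have hi := i.pos
      obtain ⟨j0, hj0⟩ : ∃ j : ℕ+, (j : ℕ) = k + 1 - (i : ℕ) := ⟨⟨k + 1 - (i : ℕ), by omega⟩, rfl⟩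
      rw [finsum_eq_single _ j0]
      · rw [pd_yf_inr, if_pos (by omega)]
        rw [yf, map_mul, ← hj0, pn_coe, rename_X, pv]; ring
      · intro j hjj
        rw [pd_yf_inr, if_neg, mul_zero]
        intro e
        apply hjj
        apply PNat.coe_injective
        have := j.pos
        omega
    · rw [← finsum_zero (α := ℕ+)]
      refine finsum_congr fun j => ?_
      rw [pd_yf_inr, if_neg, mul_zero]
      have := j.pos
      omega
  rw [finsum_congr h1, finsum_eq_sum_of_support_subset (s := (Finset.range k).map
    ⟨Nat.succPNat, Nat.succPNat_injective⟩), Finset.sum_map]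
  · refine Finset.sum_congr rfl fun l hl => ?_
    have hl := Finset.mem_range.mp hl
    show (if (Nat.succPNat l : ℕ) ≤ k then _ else _) = _
    rw [if_pos (by rw [Nat.succPNat_coe]; omega)]
    show yf (Nat.succPNat l : ℕ) (pn (k + 1 - (Nat.succPNat l : ℕ)) * f) = _
    rw [Nat.succPNat_coe, show k + 1 - l.succ = k - l by omega]
  · intro i hi
    by_contra hc
    apply hi
    refine if_neg ?_
    intro hle
    apply hc
    simp only [Finset.coe_map, Function.Embedding.coeFn_mk, Set.mem_image, Finset.coe_range, Set.mem_Iio]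
    exact ⟨(i : ℕ) - 1, by have := i.pos; omega, PNat.coe_injective (by
      have := i.pos; rw [Nat.succPNat_coe]; omega)⟩

theorem G3_yf (k : ℕ) (f : SymA) : G3 (yf k f) = (k : F) • yf (k + 1) f := by
  show (∑ᶠ i : ℕ+, ((i : ℕ) : F) • (yv ((i : ℕ) + 1) * pderiv (Sum.inr (i : ℕ)) (yf k f))) = _
  rcases Nat.eq_zero_or_pos k with rfl | hk
  · rw [Nat.cast_zero, zero_smul]
    refine (finsum_congr fun j : ℕ+ => ?_).trans (finsum_zero (α := ℕ+))
    rw [pd_yf_inr, if_neg j.pos.ne', mul_zero, smul_zero]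
  · obtain ⟨k, rfl⟩ : ∃ k' : ℕ+, k = k' := ⟨⟨k, hk⟩, rfl⟩
    rw [finsum_eq_single _ k]
    · rw [pd_yf_inr, if_pos rfl]; rfl
    · intro j hj
      rw [pd_yf_inr, if_neg, mul_zero, smul_zero]
      intro e; exact hj (PNat.coe_injective e)

/-- specialization of the catalytic variables -/
def chi (N : ℕ) (i : Fin N) : PY →ₐ[F] MvPolynomial (Fin N) F :=
  aeval (Sum.elim (fun k : ℕ+ => C 1 * ∑ j : Fin N, X j ^ (k : ℕ)) (fun k => X i ^ k))

theorem chi_yf (N : ℕ) (i : Fin N) (k : ℕ) (f : SymA) : chi N i (yf k f) = X i ^ k * ph 1 N f := by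
  rw [yf, map_mul, chi, yv, aeval_X, aeval_rename]; rfl

/-- y-linear elements -/
def V (b : ℕ) : Submodule F PY := Submodule.span F {P | ∃ k f, b ≤ k ∧ P = yf k f}

theorem yf_mem {b k : ℕ} (h : b ≤ k) (f : SymA) : yf k f ∈ V b :=
  Submodule.subset_span ⟨k, f, h, rfl⟩

theorem V_mono : V 1 ≤ V 0 := Submodule.span_mono fun _ ⟨k, f, _, h⟩ => ⟨k, f, Nat.zero_le _, h⟩

theorem pd_vars (f : SymA) : ∀ j ∉ f.vars, pderiv j f = 0 :=
  fun _ h => pderiv_eq_zero_of_notMem_vars h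

theorem GaL_yf (k : ℕ) (f : SymA) : GaL (yf k f) =
    alpha • (∑ j ∈ f.vars, ((j : ℕ) : F) • yf (k + 1 + j) (pderiv j f)) +
    ∑ l ∈ Finset.range k, yf (l + 1) (pn (k - l) * f) + (alpha - 1) • ((k : F) • yf (k + 1) f) := by
  rw [← G1_yf k f f.vars (pd_vars f), ← G2_yf, ← G3_yf]; rfl

/-- the full step operator -/
def PL (c : F) : PY →ₗ[F] PY := GaL + c • YL

theorem PL_mem (c : F) {P : PY} (hP : P ∈ V 0) : PL c P ∈ V 1 := by
  induction hP using Submodule.span_induction with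
  | mem P h =>
    obtain ⟨k, f, _, rfl⟩ := h
    rw [PL, LinearMap.add_apply, LinearMap.smul_apply, GaL_yf, YL_yf]
    refine Submodule.add_mem _ (Submodule.add_mem _ (Submodule.add_mem _
      (Submodule.smul_mem _ _ (Submodule.sum_mem _ fun j _ => Submodule.smul_mem _ _ ?_))
      (Submodule.sum_mem _ fun l _ => ?_)) (Submodule.smul_mem _ _ (Submodule.smul_mem _ _ ?_)))
      (Submodule.smul_mem _ _ ?_)
    all_goals exact yf_mem (by omega) _
  | zero => rw [map_zero]; exact Submodule.zero_mem _
  | add x y _ _ hx hy => rw [map_add]; exact Submodule.add_mem _ hx hy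
  | smul c x _ hx => rw [map_smul]; exact Submodule.smul_mem _ _ hx

theorem chi_smul (N : ℕ) (i : Fin N) (c : F) (P : PY) : chi N i (c • P) = C c * chi N i P := by
  rw [map_smul, smul_eq_C_mul]

theorem chi_PL_yf (N : ℕ) (i : Fin N) (c : F) (k : ℕ) (f : SymA) :
    chi N i (PL c (yf k f)) = Xop alpha 1 c i (chi N i (yf k f)) := by
  have e1 : chi N i (PL c (yf k f)) =
      C alpha * (∑ j ∈ f.vars, C ((j : ℕ) : F) * (X i ^ (k + 1 + j) * ph 1 N (pderiv j f))) +
      ∑ l ∈ Finset.range k, X i ^ (l + 1) * ph 1 N (pn (k - l) * f) +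
      C (alpha - 1) * (C (k : F) * (X i ^ (k + 1) * ph 1 N f)) + C c * (X i ^ (k + 1) * ph 1 N f) := by
    rw [PL, LinearMap.add_apply, LinearMap.smul_apply, GaL_yf, YL_yf]
    rw [map_add, map_add, map_add, chi_smul, chi_smul, chi_smul, chi_smul, chi_yf, map_sum, map_sum]
    congr 3
    · congr 1
      refine Finset.sum_congr rfl fun j _ => ?_
      rw [chi_smul, chi_yf]
    · exact Finset.sum_congr rfl fun l _ => by rw [chi_yf]
  have e2 : (∑ j ∈ f.vars, C ((j : ℕ) : F) * (X i ^ (k + 1 + j) * ph 1 N (pderiv j f))) =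
      X i * (∑ j ∈ f.vars, C ((j : ℕ) : F) * (X i ^ (k + j) * ph 1 N (pderiv j f))) := by
    rw [Finset.mul_sum]
    refine Finset.sum_congr rfl fun j _ => ?_
    rw [show k + 1 + (j : ℕ) = (k + j) + 1 by omega, pow_succ]; ring
  have e3 : ∑ l ∈ Finset.range k, X i ^ (l + 1) * ph 1 N (pn (k - l) * f) =
      X i * ∑ l ∈ Finset.range k, X i ^ l * ph 1 N (pn (k - l) * f) := by
    rw [Finset.mul_sum]
    refine Finset.sum_congr rfl fun j _ => ?_
    rw [pow_succ]; ring
  rw [e1, e2, e3, chi_yf, Xop_apply, lax good_one N i k f f.vars (pd_vars f), pow_succ]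
  ring

theorem chi_PL (N : ℕ) (i : Fin N) (c : F) {P : PY} (hP : P ∈ V 0) :
    chi N i (PL c P) = Xop alpha 1 c i (chi N i P) := by
  induction hP using Submodule.span_induction with
  | mem P h =>
    obtain ⟨k, f, _, rfl⟩ := h
    exact chi_PL_yf N i c k f
  | zero => simp only [map_zero]
  | add x y _ _ hx hy => simp only [map_add, hx, hy]
  | smul c x _ hx => simp only [map_smul, hx]

theorem ph_TL (N : ℕ) {P : PY} (hP : P ∈ V 1) : ph 1 N (dropY (TL P)) = ∑ i, chi N i P := by
  induction hP using Submodule.span_induction with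
  | mem P h =>
    obtain ⟨k, f, hk, rfl⟩ := h
    rw [TL_yf k f hk, map_mul, ph_pn 1 N hk]
    simp only [chi_yf, map_one, one_mul, Finset.sum_mul]
  | zero => simp only [map_zero, Finset.sum_const_zero]
  | add x y _ _ hx hy => simp only [map_add, hx, hy, Finset.sum_add_distrib]
  | smul c x _ hx => simp only [map_smul, hx, Finset.smul_sum]

theorem PLpow (N : ℕ) (i : Fin N) (c : F) (n : ℕ) {P : PY} (hP : P ∈ V 0) :
    (PL c ^ n) P ∈ V 0 ∧ chi N i ((PL c ^ n) P) = (Xop alpha 1 c i ^ n) (chi N i P) := by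
  induction n with
  | zero => exact ⟨hP, rfl⟩
  | succ n ih =>
    rw [pow_succ', pow_succ', Module.End.mul_apply, Module.End.mul_apply]
    exact ⟨V_mono (PL_mem c ih.1), by rw [chi_PL N i c ih.1, ih.2]⟩

theorem PLpow_mem (c : F) (n : ℕ) {P : PY} (hP : P ∈ V 0) : (PL c ^ n) P ∈ V 0 := by
  induction n with
  | zero => exact hP
  | succ n ih =>
    rw [pow_succ', Module.End.mul_apply]
    exact V_mono (PL_mem c ih)

theorem wordOp_sum (c : F) (n : ℕ) (g : PY) :
    ∑ s : Fin n → Bool, c ^ (Finset.univ.filter fun i => s i = true).card • wordOp (List.ofFn s) g =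
      (PL c ^ n) g := by
  induction n with
  | zero => simp [wordOp]
  | succ n ih =>
    rw [pow_succ', Module.End.mul_apply, ← ih, map_sum,
      ← Equiv.sum_comp (Fin.consEquiv (fun _ => Bool)), Fintype.sum_prod_type, Finset.sum_comm]
    refine Finset.sum_congr rfl fun s _ => ?_
    simp only [Fin.consEquiv_apply, List.ofFn_succ, Fin.cons_zero, Fin.cons_succ, wordOp,
      Fintype.sum_bool]
    have hcard : ∀ b : Bool, (Finset.univ.filter fun i : Fin (n + 1) =>
        (Fin.cons b s : Fin (n + 1) → Bool) i = true).card =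
        (if b = true then 1 else 0) + (Finset.univ.filter fun i => s i = true).card := by
      intro b
      rw [Fin.card_filter_univ_succ]
      simp [add_comm]
      split_ifs <;> simp [add_comm]
    rw [hcard, hcard, map_smul, PL, LinearMap.add_apply, LinearMap.smul_apply, GaL_apply, YL_apply]
    simp only [if_true, Bool.false_eq_true, if_false, zero_add, pow_add, pow_one, smul_add, mul_smul]
    rw [add_comm, smul_comm c]

theorem Bn_eq (n : ℕ) (c : F) (f : SymA) :
    Bn n c f = dropY (TL ((PL c ^ n) (alpha⁻¹ • yf 0 f))) := by
  rw [← wordOp_sum, Bn]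
  simp only [Bc, ← TL_apply, map_sum, map_smul, Finset.smul_sum]
  symm
  rw [← Finset.sum_fiberwise_of_maps_to (t := Finset.range (n + 1))
    (g := fun s : Fin n → Bool => (Finset.univ.filter fun i => s i = true).card)]
  · refine Finset.sum_congr rfl fun l _ => ?_
    refine Finset.sum_congr rfl fun s hs => ?_
    rw [(Finset.mem_filter.mp hs).2]; rfl
  · intro s _
    rw [Finset.mem_range, Nat.lt_succ_iff]
    exact (Finset.card_le_univ _).trans (by simp)

theorem ph_Bn (N n : ℕ) (hn : 0 < n) (c : F) (f : SymA) :
    ph 1 N (Bn n c f) = C alpha⁻¹ * ∑ i, (Xop alpha 1 c i ^ n) (ph 1 N f) := by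
  have h0 : alpha⁻¹ • yf 0 f ∈ V 0 := Submodule.smul_mem _ _ (yf_mem le_rfl f)
  rw [Bn_eq, ph_TL]
  · rw [Finset.mul_sum]
    refine Finset.sum_congr rfl fun i _ => ?_
    rw [(PLpow N i c n h0).2, map_smul, chi_yf, map_smul, pow_zero, one_mul, smul_eq_C_mul]
  · obtain ⟨m, rfl⟩ : ∃ m, n = m + 1 := ⟨n - 1, by omega⟩
    rw [pow_succ', Module.End.mul_apply]
    exact PL_mem c (PLpow_mem c m h0)

end Jk

namespace Jk
open MvPolynomial Dk

theorem pd_comm (j k : ℕ+) (f : SymA) : pderiv j (pderiv k f) = pderiv k (pderiv j f) := by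
  ext m
  simp only [coeff_pderiv']
  rw [add_right_comm]
  by_cases h : j = k
  · subst h; rfl
  · simp [h, Ne.symm h]; ring

theorem eq_C_of_pd {f : SymA} (h : ∀ k, pderiv k f = 0) : f = C (coeff 0 f) := by
  ext m
  rw [coeff_C]
  split_ifs with e
  · rw [← e]
  · obtain ⟨k, hk⟩ := Finsupp.support_nonempty_iff.mpr (Ne.symm e)
    have h1 := coeff_pderiv' k f (m - Finsupp.single k 1)
    rw [h k, coeff_zero, tsub_add_cancel_of_le] at h1
    · rcases mul_eq_zero.mp h1.symm with h2 | h2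
      · exact absurd h2 (Nat.cast_ne_zero.mpr (Nat.succ_ne_zero _))
      · exact h2
    · rw [Finsupp.single_le_iff]
      have := Finsupp.mem_support_iff.mp hk
      omega

theorem exists_LE (f : SymA) : ∃ n, LE n f := by
  refine ⟨f.support.sup wt, fun m hm => ?_⟩
  exact Finset.le_sup (f := wt) (mem_support_iff.mpr hm)

theorem ph_inj_aux {g : F} (hg : g ≠ 0) (N : ℕ) (n : ℕ) : ∀ f : SymA, LE n f →
    (∀ k : ℕ+, N < k → pderiv k f = 0) → ph g N f = 0 → f = 0 := by
  induction n using Nat.strong_induction_on with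
  | _ n ih =>
    intro f hf hN h0
    -- all derivatives have zero image
    set s : Finset ℕ+ := (Finset.range N).map ⟨Nat.succPNat, Nat.succPNat_injective⟩ with hs
    have hmem : ∀ k : ℕ+, k ∉ s → N < k := by
      intro k hk
      by_contra hc
      apply hk
      simp only [hs, Finset.mem_map, Finset.mem_range, Function.Embedding.coeFn_mk]
      have := k.pos
      exact ⟨(k : ℕ) - 1, by omega, PNat.coe_injective (by rw [Nat.succPNat_coe]; omega)⟩
    let Q : Polynomial (MvPolynomial (Fin N) F) :=
      ∑ k ∈ s, Polynomial.C (C ((k : ℕ) : F) * ph g N (pderiv k f)) * Polynomial.X ^ (k : ℕ)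
    have hQ : Q = 0 := by
      refine Polynomial.eq_zero_of_natDegree_lt_card_of_eval_eq_zero Q
        (f := fun o : Option (Fin N) => o.elim 0 X) ?_ ?_ ?_
      · intro a b hab
        rcases a with _ | a <;> rcases b with _ | b
        · rfl
        · exact absurd hab.symm (X_ne_zero b)
        · exact absurd hab (X_ne_zero a)
        · exact congrArg some (X_injective hab)
      · intro o
        rw [Polynomial.eval_finset_sum]
        rcases o with _ | i
        · refine Finset.sum_eq_zero fun k _ => ?_
          simp
        · have := chain g N i f s (fun j hj => hN j (hmem j hj))
          rw [h0, map_zero, mul_zero] at this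
          have h2 := (mul_eq_zero.mp this.symm).resolve_left (by simpa using hg)
          rw [← h2]
          refine Finset.sum_congr rfl fun k _ => ?_
          simp; ring
      · rw [Fintype.card_option, Fintype.card_fin, Nat.lt_succ_iff]
        refine Polynomial.natDegree_sum_le_of_forall_le _ _ fun k hk => ?_
        refine (Polynomial.natDegree_C_mul_X_pow_le _ _).trans ?_
        simp only [hs, Finset.mem_map, Finset.mem_range, Function.Embedding.coeFn_mk] at hk
        obtain ⟨l, hl, rfl⟩ := hk
        rw [Nat.succPNat_coe]; omega
    have hz : ∀ k, ph g N (pderiv k f) = 0 := by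
      intro k
      by_cases hk : k ∈ s
      · have h1 : Q.coeff (k : ℕ) = C ((k : ℕ) : F) * ph g N (pderiv k f) := by
          simp only [Q, Polynomial.finset_sum_coeff, Polynomial.coeff_C_mul_X_pow]
          rw [Finset.sum_eq_single k]
          · rw [if_pos rfl]
          · intro j _ hj; rw [if_neg]; intro e; exact hj (PNat.coe_injective e.symm)
          · intro h; exact absurd hk h
        rw [hQ, Polynomial.coeff_zero] at h1
        refine (mul_eq_zero.mp h1.symm).resolve_left ?_
        simp
      · rw [hN k (hmem k hk), map_zero]
    have hz' : ∀ k, pderiv k f = 0 := by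
      intro k
      by_cases hk : n < k
      · exact hf.pderiv_zero hk
      · refine ih (n - k) (by have := k.pos; omega) _ (hf.pderiv k _ rfl) (fun j hj => ?_) (hz k)
        rw [pd_comm, hN j hj, map_zero]
    have := eq_C_of_pd hz'
    rw [this, ph_C] at h0
    rw [this, C_eq_zero.mp h0, C_0]

theorem ph_inj {g : F} (hg : g ≠ 0) {N : ℕ} {f : SymA} (hf : LE N f) (h : ph g N f = 0) : f = 0 :=
  ph_inj_aux hg N N f hf (fun _ hk => hf.pderiv_zero hk) h

theorem LE_zero (n : ℕ) : LE n 0 := fun m hm => absurd (coeff_zero m) hm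

theorem LE.sub {n : ℕ} {f g : SymA} (hf : LE n f) (hg : LE n g) : LE n (f - g) := by
  intro m hm
  rw [coeff_sub] at hm
  by_cases h : coeff m f = 0
  · rw [h, zero_sub] at hm; exact hg m (neg_ne_zero.mp hm)
  · exact hf m h

theorem ph_inj2 {g : F} (hg : g ≠ 0) {N : ℕ} {f f' : SymA} (hf : LE N f) (hf' : LE N f')
    (h : ph g N f = ph g N f') : f = f' := by
  rw [← sub_eq_zero]
  apply ph_inj hg (hf.sub hf')
  rw [map_sub, h, sub_self]

theorem eq_of_ph {f f' : SymA} (h : ∀ N, ph 1 N f = ph 1 N f') : f = f' := by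
  obtain ⟨n, hn⟩ := exists_LE f
  obtain ⟨m, hm⟩ := exists_LE f'
  exact ph_inj2 one_ne_zero (hn.mono (le_max_left n m)) (hm.mono (le_max_right n m)) (h _)

/-- linear version of `Bn` -/
def BnL (n : ℕ) (c : F) : SymA →ₗ[F] SymA :=
  dropY.toLinearMap ∘ₗ TL ∘ₗ (PL c ^ n) ∘ₗ (alpha⁻¹ • (ml (yv 0) ∘ₗ (rename Sum.inl).toLinearMap))

theorem BnL_apply (n : ℕ) (c : F) (f : SymA) : BnL n c f = Bn n c f := by
  rw [Bn_eq]; rfl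

theorem UN_Xpow {N : ℕ} (a g u : F) (i : Fin N) (k : ℕ) (f : MvPolynomial (Fin N) F) :
    UN a g u (X i ^ k * f) = (Xop a g u i ^ k) (UN a g u f) := by
  induction k with
  | zero => simp
  | succ k ih => rw [pow_succ', pow_succ', Module.End.mul_apply, mul_assoc, UN_X_mul, ih]

theorem ph_aBn (N : ℕ) (k : ℕ+) (u : F) (f : SymA) :
    ph 1 N (alpha • Bn k u f) = ∑ i, (Xop alpha 1 u i ^ (k : ℕ)) (ph 1 N f) := by
  rw [map_smul, ph_Bn N k k.pos, smul_eq_C_mul, ← mul_assoc, ← C_mul, mul_inv_cancel₀ alpha_ne, C_1,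
    one_mul]

theorem UN_X_ph (N : ℕ) (k : ℕ+) (u : F) (f : MvPolynomial (Fin N) F) :
    UN alpha 1 u (ph 1 N (X k) * f) = ∑ i, (Xop alpha 1 u i ^ (k : ℕ)) (UN alpha 1 u f) := by
  rw [ph_X, C_1, one_mul, Finset.sum_mul, map_sum]
  exact Finset.sum_congr rfl fun i _ => UN_Xpow _ _ _ _ _ _

/-- values of `U` on lists -/
def Ulist (u : F) : List ℕ+ → SymA
  | [] => 1
  | k :: L => alpha • Bn k u (Ulist u L)

theorem ph_Ulist (N : ℕ) (u : F) (L : List ℕ+) :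
    ph 1 N (Ulist u L) = UN alpha 1 u (ph 1 N (pPow (L : Multiset ℕ+))) := by
  induction L with
  | nil =>
    show ph 1 N 1 = UN alpha 1 u (ph 1 N (pPow 0))
    rw [pPow_zero, map_one]
    have := UN_C (N := N) alpha 1 u 1
    rw [C_1] at this; exact this.symm
  | cons k L ih =>
    show ph 1 N (alpha • Bn k u (Ulist u L)) = UN alpha 1 u (ph 1 N (pPow (k ::ₘ (L : Multiset ℕ+))))
    rw [ph_aBn, ih, pPow_cons, map_mul, UN_X_ph]

/-- the intertwiner -/
def U (u : F) : SymA →ₗ[F] SymA :=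
  (basisMonomials ℕ+ F).constr F (fun m => Ulist u (ex.symm m).toList)

theorem U_pPow (u : F) (l : JPartition) : U u (pPow l) = Ulist u l.toList := by
  have h : pPow l = basisMonomials ℕ+ F (toExp l) := by rw [pPow_eq]; rfl
  rw [h, U, Module.Basis.constr_basis, toExp_eq_ex, AddEquiv.symm_apply_apply]

theorem span_pPow_induction {p : SymA → Prop} (h0 : ∀ l, p (pPow l))
    (hadd : ∀ f g, p f → p g → p (f + g)) (hs : ∀ (c : F) f, p f → p (c • f)) (f : SymA) : p f := by
  induction f using MvPolynomial.induction_on' with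
  | add f g hf hg => exact hadd f g hf hg
  | monomial m a =>
    obtain ⟨l, rfl⟩ := toExp_surj m
    have : monomial (toExp l) a = a • pPow l := by
      rw [pPow_eq, smul_monomial, smul_eq_mul, mul_one]
    rw [this]
    exact hs a _ (h0 l)

theorem ph_U (N : ℕ) (u : F) (f : SymA) : ph 1 N (U u f) = UN alpha 1 u (ph 1 N f) := by
  induction f using span_pPow_induction with
  | h0 l => rw [U_pPow, ph_Ulist, Multiset.coe_toList]
  | hadd f g hf hg => simp only [map_add, hf, hg]
  | hs c f hf => simp only [map_smul, hf]

theorem U_X_mul (u : F) (k : ℕ+) (f : SymA) : U u (X k * f) = alpha • Bn k u (U u f) := by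
  apply eq_of_ph
  intro N
  rw [ph_U, map_mul, UN_X_ph, ph_aBn, ph_U]

theorem U_one (u : F) : U u 1 = 1 := by
  rw [← pPow_zero, U_pPow]; simp [Ulist, pPow_zero]

/-- graded y-linear elements -/
def VW (n : ℕ) : Submodule F PY := Submodule.span F {P | ∃ k j f, Hom j f ∧ k + j = n ∧ P = yf k f}

theorem yf_memVW {n k j : ℕ} {f : SymA} (hf : Hom j f) (h : k + j = n) : yf k f ∈ VW n :=
  Submodule.subset_span ⟨k, j, f, hf, h, rfl⟩

theorem Hom_X (k : ℕ+) : Hom k (X k) := isWeightedHomogeneous_X F w0 k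

theorem Hom_pn {k : ℕ} (hk : 0 < k) : Hom k (pn k) := by
  obtain ⟨k, rfl⟩ : ∃ k' : ℕ+, k = k' := ⟨⟨k, hk⟩, rfl⟩
  rw [pn_coe]; exact Hom_X k

theorem Hom.mul {a b : ℕ} {f g : SymA} (hf : Hom a f) (hg : Hom b g) : Hom (a + b) (f * g) :=
  IsWeightedHomogeneous.mul hf hg

theorem Hom_zero (n : ℕ) : Hom n (0 : SymA) := isWeightedHomogeneous_zero F w0 n

theorem Hom.add {a : ℕ} {f g : SymA} (hf : Hom a f) (hg : Hom a g) : Hom a (f + g) :=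
  IsWeightedHomogeneous.add hf hg

theorem Hom.smul {a : ℕ} {f : SymA} (hf : Hom a f) (c : F) : Hom a (c • f) :=
  Submodule.smul_mem (weightedHomogeneousSubmodule F w0 a) c hf

theorem Hom_sum {ι : Type} (s : Finset ι) {n : ℕ} (f : ι → SymA) (h : ∀ i ∈ s, Hom n (f i)) :
    Hom n (∑ i ∈ s, f i) :=
  Submodule.sum_mem (weightedHomogeneousSubmodule F w0 n) h

theorem Hom_pd {n : ℕ} {f : SymA} (h : Hom n f) {k : ℕ+} {m : ℕ} (hm : m + k = n) :
    Hom m (MvPolynomial.pderiv k f) := by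
  intro e he
  have := h.pderiv k e he
  rw [wt_eq]; omega

theorem Hom_pd_zero {n : ℕ} {f : SymA} (h : Hom n f) {k : ℕ+} (hk : n < k) :
    MvPolynomial.pderiv k f = 0 := h.LE.pderiv_zero hk

theorem Hom_zero_iff {f : SymA} (h : Hom 0 f) : f = C (coeff 0 f) :=
  eq_C_of_pd fun k => Hom_pd_zero h k.pos

theorem Hom_one : Hom 0 (1 : SymA) := isWeightedHomogeneous_one F w0

theorem YL_VW {n : ℕ} {P : PY} (hP : P ∈ VW n) : YL P ∈ VW (n + 1) := by
  induction hP using Submodule.span_induction with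
  | mem P h =>
    obtain ⟨k, j, f, hf, e, rfl⟩ := h
    rw [YL_yf]; exact yf_memVW hf (by omega)
  | zero => rw [map_zero]; exact Submodule.zero_mem _
  | add x y _ _ hx hy => rw [map_add]; exact Submodule.add_mem _ hx hy
  | smul c x _ hx => rw [map_smul]; exact Submodule.smul_mem _ _ hx

theorem GaL_VW {n : ℕ} {P : PY} (hP : P ∈ VW n) : GaL P ∈ VW (n + 1) := by
  induction hP using Submodule.span_induction with
  | mem P h =>
    obtain ⟨k, j, f, hf, e, rfl⟩ := h
    rw [GaL_yf]
    refine Submodule.add_mem _ (Submodule.add_mem _ 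
      (Submodule.smul_mem _ _ (Submodule.sum_mem _ fun i _ => Submodule.smul_mem _ _ ?_))
      (Submodule.sum_mem _ fun l hl => ?_)) (Submodule.smul_mem _ _ (Submodule.smul_mem _ _ ?_))
    · by_cases hi : j < i
      · rw [Hom_pd_zero hf hi, yf, map_zero, mul_zero]; exact Submodule.zero_mem _
      · exact yf_memVW (Hom_pd (m := j - i) hf (by omega)) (by omega)
    · have := Finset.mem_range.mp hl
      exact yf_memVW ((Hom_pn (by omega)).mul hf) (by omega)
    · exact yf_memVW hf (by omega)
  | zero => rw [map_zero]; exact Submodule.zero_mem _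
  | add x y _ _ hx hy => rw [map_add]; exact Submodule.add_mem _ hx hy
  | smul c x _ hx => rw [map_smul]; exact Submodule.smul_mem _ _ hx

theorem TL_yf0 (f : SymA) : TL (yf 0 f) = 0 := by
  rw [TL_apply, ThetaY]
  refine (finsum_congr fun j : ℕ+ => ?_).trans (finsum_zero (α := ℕ+))
  rw [pd_yf_inr, if_neg j.pos.ne', mul_zero]

theorem TL_VW {n : ℕ} {P : PY} (hP : P ∈ VW n) : Hom n (dropY (TL P)) := by
  induction hP using Submodule.span_induction with
  | mem P h =>
    obtain ⟨k, j, f, hf, e, rfl⟩ := h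
    rcases Nat.eq_zero_or_pos k with rfl | hk
    · rw [TL_yf0, map_zero]; exact Hom_zero n
    · rw [TL_yf k f hk, ← e]; exact (Hom_pn hk).mul hf
  | zero => rw [map_zero, map_zero]; exact Hom_zero n
  | add x y _ _ hx hy => rw [map_add, map_add]; exact hx.add hy
  | smul c x _ hx => rw [map_smul, map_smul]; exact hx.smul c

theorem wordOp_VW (w : List Bool) {n : ℕ} {P : PY} (hP : P ∈ VW n) :
    wordOp w P ∈ VW (n + w.length) := by
  induction w with
  | nil => exact hP
  | cons b w ih =>
    rw [wordOp, List.length_cons, ← add_assoc]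
    cases b
    · exact GaL_VW ih
    · exact YL_VW ih

theorem Hom_Bc {j : ℕ} (n l : ℕ) {f : SymA} (hf : Hom j f) : Hom (j + n) (Bc n l f) := by
  rw [Bc, ← TL_apply]
  apply TL_VW
  refine Submodule.sum_mem _ fun s _ => ?_
  have := wordOp_VW (List.ofFn s) (P := alpha⁻¹ • yf 0 f) (n := j)
    (Submodule.smul_mem _ _ (yf_memVW hf (by omega)))
  rwa [List.length_ofFn] at this

theorem Hom_Bn {j : ℕ} (n : ℕ) (c : F) {f : SymA} (hf : Hom j f) : Hom (j + n) (Bn n c f) :=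
  Hom_sum _ _ fun _ _ => (Hom_Bc n _ hf).smul _

theorem Hom_pPow (l : JPartition) : Hom (psize l) (pPow l) := by
  rw [pPow_eq]
  exact isWeightedHomogeneous_monomial w0 _ _ (by rw [wt_eq, wt_toExp])

theorem Hom_induction {n : ℕ} {p : SymA → Prop} (h0 : ∀ l, psize l = n → p (pPow l)) (hz : p 0)
    (hadd : ∀ f g, p f → p g → p (f + g)) (hs : ∀ (c : F) f, p f → p (c • f)) {f : SymA}
    (hf : Hom n f) : p f := by
  rw [f.as_sum]
  have : ∀ s : Finset Exp, s ⊆ f.support → p (∑ v ∈ s, monomial v (coeff v f)) := by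
    intro s
    induction s using Finset.induction_on with
    | empty => intro _; rw [Finset.sum_empty]; exact hz
    | insert a s ha ih =>
      intro h
      rw [Finset.sum_insert ha]
      refine hadd _ _ ?_ (ih ((Finset.subset_insert a s).trans h))
      obtain ⟨l, rfl⟩ := toExp_surj a
      have e : monomial (toExp l) (coeff (toExp l) f) = (coeff (toExp l) f) • pPow l := by
        rw [pPow_eq, smul_monomial, smul_eq_mul, mul_one]
      rw [e]
      apply hs; apply h0
      rw [← wt_toExp, ← wt_eq]
      exact hf (mem_support_iff.mp (h (Finset.mem_insert_self _ _)))
  exact this _ (Finset.Subset.refl _)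

theorem Hom_Ulist (u : F) (L : List ℕ+) : Hom (psize (L : Multiset ℕ+)) (Ulist u L) := by
  induction L with
  | nil => exact Hom_one
  | cons k L ih =>
    have : psize ((k :: L : List ℕ+) : Multiset ℕ+) = psize (L : Multiset ℕ+) + k := by
      rw [← Multiset.cons_coe, psize_cons, add_comm]
    rw [this]
    exact (Hom_Bn k u ih).smul alpha

theorem Hom_U (u : F) {n : ℕ} {f : SymA} (hf : Hom n f) : Hom n (U u f) := by
  refine Hom_induction (p := fun f => Hom n (U u f)) ?_ ?_ ?_ ?_ hf
  · intro l hl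
    rw [U_pPow, ← hl]
    have := Hom_Ulist u l.toList
    rwa [Multiset.coe_toList] at this
  · rw [map_zero]; exact Hom_zero n
  · intro f g hf hg
    rw [map_add]; exact hf.add hg
  · intro c f hf
    rw [map_smul]; exact hf.smul c

end Jk

namespace Jk
open MvPolynomial Dk

theorem hall_sum_supp (f g : SymA) (s : Finset Exp) (hs : f.support ⊆ s) :
    hall f g = ∑ m ∈ s, coeff m f * coeff m g * zalpha m := by
  rw [hall]
  refine Finset.sum_subset hs fun m _ hm => ?_
  rw [notMem_support_iff.mp hm]; ring

theorem hall_comm (f g : SymA) : hall f g = hall g f := by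
  rw [hall_sum_supp f g (f.support ∪ g.support) Finset.subset_union_left,
    hall_sum_supp g f (f.support ∪ g.support) Finset.subset_union_right]
  exact Finset.sum_congr rfl fun m _ => by ring

theorem hall_add_right (f g h : SymA) : hall f (g + h) = hall f g + hall f h := by
  rw [hall, hall, hall, ← Finset.sum_add_distrib]
  exact Finset.sum_congr rfl fun m _ => by rw [coeff_add]; ring

theorem hall_smul_right (c : F) (f g : SymA) : hall f (c • g) = c * hall f g := by
  rw [hall, hall, Finset.mul_sum]
  exact Finset.sum_congr rfl fun m _ => by rw [coeff_smul, smul_eq_mul]; ring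

theorem hall_add_left (f g h : SymA) : hall (f + g) h = hall f h + hall g h := by
  rw [hall_comm, hall_add_right, hall_comm h f, hall_comm h g]

theorem hall_smul_left (c : F) (f g : SymA) : hall (c • f) g = c * hall f g := by
  rw [hall_comm, hall_smul_right, hall_comm]

/-- linear functional -/
def hallL (f : SymA) : SymA →ₗ[F] F where
  toFun := hall f
  map_add' := hall_add_right f
  map_smul' c g := hall_smul_right c f g

theorem hallL_apply (f g : SymA) : hallL f g = hall f g := rfl

theorem hall_zero_right (f : SymA) : hall f 0 = 0 := map_zero (hallL f)
theorem hall_zero_left (f : SymA) : hall 0 f = 0 := by rw [hall_comm, hall_zero_right]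
theorem hall_sum_right {ι : Type} (s : Finset ι) (f : SymA) (g : ι → SymA) :
    hall f (∑ i ∈ s, g i) = ∑ i ∈ s, hall f (g i) := map_sum (hallL f) _ _
theorem hall_sum_left {ι : Type} (s : Finset ι) (f : SymA) (g : ι → SymA) :
    hall (∑ i ∈ s, g i) f = ∑ i ∈ s, hall (g i) f := by
  rw [hall_comm, hall_sum_right]; exact Finset.sum_congr rfl fun i _ => hall_comm _ _
theorem hall_sub_right (f g h : SymA) : hall f (g - h) = hall f g - hall f h := map_sub (hallL f) _ _
theorem hall_sub_left (f g h : SymA) : hall (f - g) h = hall f h - hall g h := by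
  rw [hall_comm, hall_sub_right, hall_comm h f, hall_comm h g]

theorem hall_monomial (m : Exp) (c : F) (g : SymA) :
    hall (monomial m c) g = c * coeff m g * zalpha m := by
  rw [hall_sum_supp _ g {m} support_monomial_subset, Finset.sum_singleton, coeff_monomial, if_pos rfl]

theorem hall_pPow (l : JPartition) (g : SymA) :
    hall (pPow l) g = coeff (toExp l) g * zalpha (toExp l) := by
  rw [pPow_eq, hall_monomial, one_mul]

theorem zalpha_add_single (m : Exp) (k : ℕ+) :
    zalpha (m + Finsupp.single k 1) = alpha * ((k : ℕ) : F) * ((m k + 1 : ℕ) : F) * zalpha m := by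
  have hm : m + Finsupp.single k 1 = (m.erase k) + Finsupp.single k (m k + 1) := by
    ext i
    by_cases h : k = i
    · subst h; simp
    · simp [h, Finsupp.erase_ne (Ne.symm h)]
  have hm' : m = (m.erase k) + Finsupp.single k (m k) := by
    ext i
    by_cases h : k = i
    · subst h; simp
    · simp [h, Finsupp.erase_ne (Ne.symm h)]
  have key : ∀ n : ℕ, zalpha (m.erase k + Finsupp.single k n) =
      zalpha (m.erase k) * ((Nat.factorial n : F) * ((k : ℕ) : F) ^ n * alpha ^ n) := by
    intro n
    have hd : Disjoint (m.erase k).support (Finsupp.single k n).support := by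
      rw [Finset.disjoint_left]
      intro i hi hi'
      have := Finsupp.support_single_subset hi'
      rw [Finset.mem_singleton] at this
      subst this
      simp at hi
    unfold zalpha
    rw [Finsupp.prod_add_index_of_disjoint hd, Finsupp.sum_add_index' (fun _ => rfl) (fun _ _ _ => rfl),
      Finsupp.prod_single_index (by simp), Finsupp.sum_single_index rfl, pow_add]
    simp only [map_mul, map_pow, map_natCast]
    ring
  rw [hm, key]
  conv_rhs => rw [hm', key]
  simp only [Finsupp.add_apply, Finsupp.erase_same, Finsupp.single_eq_same, zero_add]
  rw [Nat.factorial_succ]; push_cast; ring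

theorem hall_X_mul (k : ℕ+) (f g : SymA) :
    hall (X k * f) g = alpha * ((k : ℕ) : F) * hall f (pderiv k g) := by
  induction f using MvPolynomial.induction_on' with
  | add p q hp hq => rw [mul_add, hall_add_left, hall_add_left, hp, hq]; ring
  | monomial u a =>
    rw [X, monomial_mul, one_mul, hall_monomial, hall_monomial, coeff_pderiv', add_comm,
      zalpha_add_single]; ring

theorem exists_hom : ∃ s : F →+* ℝ, 0 < s alpha := by
  have ht := transcendental_liouvilleNumber (m := 2) (le_refl 2)
  have ht' : Transcendental ℚ (liouvilleNumber (2 : ℕ)) := by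
    intro h
    exact ht ((IsFractionRing.isAlgebraic_iff ℤ ℚ ℝ).mpr h)
  have hinj : Function.Injective
      ((Polynomial.aeval (liouvilleNumber (2 : ℕ)) : Polynomial ℚ →ₐ[ℚ] ℝ) : Polynomial ℚ →+* ℝ) :=
    transcendental_iff_injective.mp ht'
  refine ⟨IsFractionRing.lift (K := F) hinj, ?_⟩
  have : alpha = algebraMap (Polynomial ℚ) F Polynomial.X := by
    rw [alpha, RatFunc.algebraMap_X]
  rw [this, IsFractionRing.lift_algebraMap]
  show 0 < Polynomial.aeval (liouvilleNumber (2 : ℕ)) Polynomial.X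
  rw [Polynomial.aeval_X]
  have h2 : (1 : ℝ) < ((2 : ℕ) : ℝ) := by norm_num
  rw [← LiouvilleNumber.partialSum_add_remainder h2 0]
  exact add_pos_of_nonneg_of_pos (Finset.sum_nonneg fun i _ => by positivity)
    (LiouvilleNumber.remainder_pos h2 0)

theorem zalpha_pos (s : F →+* ℝ) (hs : 0 < s alpha) (m : Exp) : 0 < s (zalpha m) := by
  rw [zalpha, map_mul, map_pow, Finsupp.prod, map_prod, map_prod]
  refine mul_pos (Finset.prod_pos fun i _ => ?_) (pow_pos hs _)
  rw [map_mul, map_mul, map_pow, map_pow, map_natCast, map_natCast, map_natCast, map_natCast]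
  have := i.pos
  positivity

theorem zalpha_ne (m : Exp) : zalpha m ≠ 0 := by
  obtain ⟨s, hs⟩ := exists_hom
  intro h
  have := zalpha_pos s hs m
  rw [h, map_zero] at this
  exact lt_irrefl _ this

theorem hall_anis {f : SymA} (h : hall f f = 0) : f = 0 := by
  obtain ⟨s, hs⟩ := exists_hom
  have h1 := congrArg s h
  rw [hall, map_sum, map_zero, Finset.sum_eq_zero_iff_of_nonneg] at h1
  · by_contra hf
    obtain ⟨m, hm⟩ := support_nonempty.mpr hf
    have := h1 m hm
    rw [map_mul, map_mul] at this
    have h2 : s (coeff m f) ≠ 0 := (map_ne_zero s).mpr (mem_support_iff.mp hm)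
    exact mul_ne_zero (mul_ne_zero h2 h2) (zalpha_pos s hs m).ne' this
  · intro m _
    rw [map_mul, map_mul]
    exact mul_nonneg (mul_self_nonneg _) (zalpha_pos s hs m).le

theorem hall_nondeg {f : SymA} (h : ∀ g, hall g f = 0) : f = 0 := hall_anis (h f)

theorem hall_ext {f f' : SymA} (h : ∀ g, hall g f = hall g f') : f = f' := by
  rw [← sub_eq_zero]; apply hall_nondeg; intro g; rw [hall_sub_right, h, sub_self]

theorem hall_Hom_ne {m n : ℕ} {f g : SymA} (hf : Hom m f) (hg : Hom n g) (h : m ≠ n) :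
    hall f g = 0 := by
  rw [hall]
  refine Finset.sum_eq_zero fun e he => ?_
  by_cases h0 : coeff e g = 0
  · rw [h0]; ring
  · exact absurd ((hf (mem_support_iff.mp he)).symm.trans (hg h0)) h

end Jk

namespace Jk
open MvPolynomial Dk

/-- dual complete functions -/
def gg : ℕ → SymA
  | 0 => 1
  | (n + 1) => C ((n + 1 : ℕ) : F)⁻¹ * ∑ i : Fin (n + 1), C alpha⁻¹ * (pn ((i : ℕ) + 1) * gg (n - i))
  decreasing_by omega

theorem gg_zero : gg 0 = 1 := by rw [gg]

theorem gg_succ (n : ℕ) : C ((n + 1 : ℕ) : F) * gg (n + 1) =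
    ∑ i ∈ Finset.range (n + 1), C alpha⁻¹ * (pn (i + 1) * gg (n - i)) := by
  rw [gg, ← mul_assoc, ← C_mul, mul_inv_cancel₀ (Nat.cast_ne_zero.mpr n.succ_ne_zero), C_1, one_mul,
    Finset.sum_range]

theorem gg_rec (n : ℕ) : C (n : F) * gg n =
    ∑ i ∈ Finset.range n, C alpha⁻¹ * (pn (i + 1) * gg (n - (i + 1))) := by
  cases n with
  | zero => simp
  | succ n =>
    rw [gg_succ]
    exact Finset.sum_congr rfl fun i _ => by rw [Nat.succ_sub_succ]

/-- shifted -/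
def gs (n k : ℕ) : SymA := if k ≤ n then gg (n - k) else 0

theorem pd_pn (k : ℕ+) (n : ℕ) : pderiv k (pn n) = if (k : ℕ) = n then 1 else 0 := by
  rw [pn]
  split_ifs with h1 h2 h2
  · obtain ⟨n', rfl⟩ : ∃ n' : ℕ+, n = n' := ⟨⟨n, h1⟩, rfl⟩
    have : k = n' := PNat.coe_injective h2
    subst this
    rw [PNat.coe_toPNat', pderiv_X_self]
  · obtain ⟨n', rfl⟩ : ∃ n' : ℕ+, n = n' := ⟨⟨n, h1⟩, rfl⟩
    rw [PNat.coe_toPNat', pderiv_X_of_ne]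
    rintro rfl; exact h2 rfl
  · exact absurd (h2 ▸ k.pos) h1
  · exact map_zero _

theorem pd_C_mul (k : ℕ+) (c : F) (f : SymA) : pderiv k (C c * f) = C c * pderiv k f := by
  rw [C_mul', C_mul', Derivation.map_smul]

theorem pd_gg (k : ℕ+) (n : ℕ) : C (alpha * ((k : ℕ) : F)) * pderiv k (gg n) = gs n k := by
  induction n using Nat.strong_induction_on with
  | _ n ih =>
    rcases Nat.eq_zero_or_pos n with rfl | hn
    · rw [gg_zero, pderiv_one, mul_zero, gs, if_neg (by have := k.pos; omega)]
    have hn0 : C (n : F) ≠ (0 : SymA) := by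
      rw [Ne, C_eq_zero]; exact Nat.cast_ne_zero.mpr hn.ne'
    apply mul_left_cancel₀ hn0
    have h1 := congrArg (pderiv k) (gg_rec n)
    rw [pd_C_mul, map_sum] at h1
    have e : C (n : F) * (C (alpha * ((k : ℕ) : F)) * pderiv k (gg n)) =
      C (alpha * ((k : ℕ) : F)) * (C (n : F) * pderiv k (gg n)) := by ring
    rw [e, h1, Finset.mul_sum]
    have h2 : ∀ i ∈ Finset.range n, C (alpha * ((k : ℕ) : F)) *
        pderiv k (C alpha⁻¹ * (pn (i + 1) * gg (n - (i + 1)))) =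
        C alpha⁻¹ * (pn (i + 1) * gs (n - (i + 1)) k) +
          if (k : ℕ) = i + 1 then C ((k : ℕ) : F) * gg (n - k) else 0 := by
      intro i hi
      rw [pd_C_mul, Derivation.leibniz, pd_pn, ← ih (n - (i + 1)) (by omega), smul_eq_mul, smul_eq_mul]
      have ha : (C alpha : SymA) * C alpha⁻¹ = 1 := by rw [← C_mul, mul_inv_cancel₀ alpha_ne, C_1]
      split_ifs with h
      · rw [← h, C_mul]
        linear_combination C ((k : ℕ) : F) * gg (n - k) * ha
      · ring
    rw [Finset.sum_congr rfl h2, Finset.sum_add_distrib]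
    obtain ⟨k', hk'⟩ : ∃ k', (k : ℕ) = k' + 1 := ⟨k - 1, by have := k.pos; omega⟩
    by_cases hkn : (k : ℕ) ≤ n
    · have h3 : ∑ i ∈ Finset.range n, C alpha⁻¹ * (pn (i + 1) * gs (n - (i + 1)) k) =
          C ((n - k : ℕ) : F) * gg (n - k) := by
        rw [gg_rec, ← Finset.sum_subset (Finset.range_subset_range.mpr (Nat.sub_le n k))]
        · refine Finset.sum_congr rfl fun i hi => ?_
          have := Finset.mem_range.mp hi
          rw [gs, if_pos (by omega)]
          rw [show n - (i + 1) - k = n - k - (i + 1) by omega]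
        · intro i hi hi'
          rw [Finset.mem_range] at hi hi'
          rw [gs, if_neg (by omega), mul_zero, mul_zero]
      have h4 : (∑ i ∈ Finset.range n, if (k : ℕ) = i + 1 then C ((k : ℕ) : F) * gg (n - k) else 0) =
          C ((k : ℕ) : F) * gg (n - k) := by
        rw [Finset.sum_eq_single k']
        · rw [if_pos hk']
        · intro b _ hb; rw [if_neg (by omega)]
        · intro h; exact absurd (Finset.mem_range.mpr (by omega)) h
      rw [h3, h4, gs, if_pos hkn, ← add_mul, ← C_add, ← Nat.cast_add, Nat.sub_add_cancel hkn]
    · rw [gs, if_neg hkn, mul_zero, Finset.sum_eq_zero, Finset.sum_eq_zero, add_zero]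
      · intro i hi
        have := Finset.mem_range.mp hi
        rw [if_neg (by omega)]
      · intro i hi
        have := Finset.mem_range.mp hi
        rw [gs, if_neg (by omega), mul_zero, mul_zero]

theorem Hom_C (c : F) : Hom 0 (C c : SymA) := by
  have := Hom_one.smul c
  rwa [smul_eq_C_mul, mul_one] at this

theorem Hom_gg (n : ℕ) : Hom n (gg n) := by
  induction n using Nat.strong_induction_on with
  | _ n ih =>
    cases n with
    | zero => rw [gg_zero]; exact Hom_one
    | succ n =>
      rw [gg]
      have : Hom (0 + (n + 1)) (C ((n + 1 : ℕ) : F)⁻¹ *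
        ∑ i : Fin (n + 1), C alpha⁻¹ * (pn ((i : ℕ) + 1) * gg (n - i))) := by
        refine (Hom_C _).mul (Hom_sum _ _ fun i _ => ?_)
        have h := (Hom_C alpha⁻¹).mul ((Hom_pn (k := (i : ℕ) + 1) (by omega)).mul (ih (n - i) (by omega)))
        have e : 0 + ((i : ℕ) + 1 + (n - i)) = n + 1 := by have := i.2; omega
        rwa [e] at h
      rwa [zero_add] at this

/-- product over an exponent vector -/
def Gf {N : ℕ} (e : Fin N → ℕ) : SymA := ∏ i, gg (e i)

theorem Hom_prod {ι : Type} (s : Finset ι) (d : ι → ℕ) (f : ι → SymA) (h : ∀ i ∈ s, Hom (d i) (f i)) :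
    Hom (∑ i ∈ s, d i) (∏ i ∈ s, f i) := IsWeightedHomogeneous.prod s f d h

theorem hall_one (f : SymA) : hall f 1 = coeff 0 f := by
  rw [hall_comm, ← pPow_zero, hall_pPow, toExp_zero]; simp [zalpha]

theorem der_prod {ι : Type} [DecidableEq ι] (D : Derivation F SymA SymA) (s : Finset ι) (f : ι → SymA) :
    D (∏ i ∈ s, f i) = ∑ i ∈ s, (∏ j ∈ s.erase i, f j) • D (f i) := by
  induction s using Finset.induction_on with
  | empty => simp
  | insert a s ha ih =>
    rw [Finset.prod_insert ha, Derivation.leibniz, ih, Finset.sum_insert ha, Finset.erase_insert ha,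
      Finset.smul_sum, add_comm]
    congr 1
    refine Finset.sum_congr rfl fun i hi => ?_
    have : a ≠ i := fun h => ha (h ▸ hi)
    rw [Finset.erase_insert_of_ne this, Finset.prod_insert (fun h => ha (Finset.mem_of_mem_erase h)), mul_smul, smul_eq_mul,
      smul_eq_mul]

theorem pd_Gf {N : ℕ} (e : Fin N → ℕ) (k : ℕ+) :
    C (alpha * ((k : ℕ) : F)) * pderiv k (Gf e) =
      ∑ i, if (k : ℕ) ≤ e i then Gf (Function.update e i (e i - k)) else 0 := by
  rw [Gf, der_prod, Finset.mul_sum]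
  refine Finset.sum_congr rfl fun i _ => ?_
  have h := pd_gg k (e i)
  rw [smul_eq_mul, mul_left_comm, h, gs]
  split_ifs with hk
  · rw [Gf, ← Finset.mul_prod_erase Finset.univ _ (Finset.mem_univ i), Function.update_self, mul_comm]
    congr 1
    refine Finset.prod_congr rfl fun j hj => ?_
    rw [Function.update_of_ne (Finset.ne_of_mem_erase hj)]
  · rw [mul_zero]

theorem coeff_evalN {N : ℕ} (f : SymA) (e : Fin N →₀ ℕ) :
    coeff e (ph 1 N f) = hall (Gf e) f := by
  induction f using span_pPow_induction generalizing e with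
  | hadd f g hf hg => rw [map_add, coeff_add, hf, hg, hall_add_right]
  | hs c f hf => rw [map_smul, coeff_smul, hf, hall_smul_right, smul_eq_mul]
  | h0 l =>
    induction l using Multiset.induction_on generalizing e with
    | empty =>
      rw [pPow_zero, map_one, hall_one, coeff_one]
      have hh : Hom (∑ i, e i) (Gf e) := Hom_prod _ _ _ fun i _ => Hom_gg _
      split_ifs with h
      · subst h
        simp [Gf, gg_zero]
      · by_contra hc
        have := hh (Ne.symm hc)
        rw [map_zero] at this
        apply h
        ext i
        have := (Finset.sum_eq_zero_iff.mp this.symm) i (Finset.mem_univ _)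
        simp [this]
    | cons k l ih =>
      rw [pPow_cons, hall_comm, hall_X_mul, hall_comm, map_mul, ph_X, C_1, one_mul, Finset.sum_mul, coeff_sum]
      have : alpha * ((k : ℕ) : F) * hall (pderiv k (Gf e)) (pPow l) =
          hall (C (alpha * ((k : ℕ) : F)) * pderiv k (Gf e)) (pPow l) := by
        rw [C_mul', hall_smul_left]
      rw [this, pd_Gf, hall_sum_left]
      refine Finset.sum_congr rfl fun i _ => ?_
      have hx : (X i ^ (k : ℕ) : MvPolynomial (Fin N) F) = monomial (Finsupp.single i (k : ℕ)) 1 := by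
        rw [X_pow_eq_monomial]
      rw [hx, coeff_monomial_mul', one_mul]
      by_cases hk : (k : ℕ) ≤ e i
      · rw [if_pos hk, if_pos (Finsupp.single_le_iff.mpr hk), ih]
        congr 2
        ext j
        by_cases hj : j = i
        · subst hj; simp
        · rw [Function.update_of_ne hj]
          simp [Ne.symm hj]
      · rw [if_neg hk, if_neg (fun h => hk (Finsupp.single_le_iff.mp h)), hall_zero_left]

end Jk

namespace Jk
open MvPolynomial Dk

/-- parts as a function -/
def pt (l : JPartition) (i : ℕ) : ℕ := (sortedParts l).getD i 0

theorem do_eq (l : JPartition) : (Multiset.map (fun i : ℕ => i) (l >>= fun a : ℕ+ => pure (a : ℕ))) =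
    l.map (fun i : ℕ+ => (i : ℕ)) := by
  rw [Multiset.map_id']
  simp only [Multiset.bind_def, Multiset.pure_def, Multiset.bind_singleton]

theorem psize_eq' (l : JPartition) : psize l = (l.map fun i : ℕ+ => (i : ℕ)).sum := by
  rw [← do_eq]; rfl

theorem sp_coe (l : JPartition) : (sortedParts l : Multiset ℕ) = l.map fun i : ℕ+ => (i : ℕ) := by
  rw [sortedParts, Multiset.coe_reverse, Multiset.sort_eq]
  exact do_eq l

theorem sp_sorted (l : JPartition) : (sortedParts l).Pairwise (· ≥ ·) := by
  rw [sortedParts, List.pairwise_reverse]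
  exact Multiset.pairwise_sort _ _

theorem sp_len (l : JPartition) : (sortedParts l).length = plen l := by
  rw [plen, ← Multiset.coe_card, sp_coe, Multiset.card_map]

theorem sp_pos (l : JPartition) : ∀ x ∈ sortedParts l, 0 < x := by
  intro x hx
  have : x ∈ (sortedParts l : Multiset ℕ) := hx
  rw [sp_coe, Multiset.mem_map] at this
  obtain ⟨i, _, rfl⟩ := this
  exact i.pos

theorem take_sum (L : List ℕ) (k : ℕ) : (L.take k).sum = ∑ i ∈ Finset.range k, L.getD i 0 := by
  induction k generalizing L with
  | zero => simp
  | succ k ih =>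
    cases L with
    | nil => simp
    | cons a L =>
      rw [List.take_succ_cons, List.sum_cons, ih, Finset.sum_range_succ']
      simp [add_comm]

theorem topSum_eq (l : JPartition) (k : ℕ) : topSum l k = ∑ i ∈ Finset.range k, pt l i := take_sum _ _

theorem pt_zero (l : JPartition) {i : ℕ} (h : plen l ≤ i) : pt l i = 0 :=
  List.getD_eq_default _ _ (by rwa [sp_len])

theorem getD_anti (L : List ℕ) (h : L.Pairwise (· ≥ ·)) : Antitone fun i => L.getD i 0 := by
  apply antitone_nat_of_succ_le
  intro n
  induction L generalizing n with
  | nil => simp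
  | cons a L ih =>
    cases n with
    | zero =>
      cases L with
      | nil => simp
      | cons b L => simpa using (List.pairwise_cons.mp h).1 b (by simp)
    | succ n => simpa using ih (List.pairwise_cons.mp h).2 n

theorem pt_anti (l : JPartition) : Antitone (pt l) := getD_anti _ (sp_sorted l)

theorem sp_inj {l m : JPartition} (h : sortedParts l = sortedParts m) : l = m := by
  have := congrArg (fun L : List ℕ => (L : Multiset ℕ)) h
  simp only [sp_coe] at this
  exact Multiset.map_injective PNat.coe_injective this

theorem getD_inj (L M : List ℕ) (hL : ∀ x ∈ L, 0 < x) (hM : ∀ x ∈ M, 0 < x)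
    (h : ∀ i, L.getD i 0 = M.getD i 0) : L = M := by
  induction L generalizing M with
  | nil =>
    cases M with
    | nil => rfl
    | cons b M =>
      have := h 0
      simp only [List.getD_nil, List.getD_cons_zero] at this
      exact absurd (hM b (by simp)) (by omega)
  | cons a L ih =>
    cases M with
    | nil =>
      have := h 0
      simp only [List.getD_nil, List.getD_cons_zero] at this
      exact absurd (hL a (by simp)) (by omega)
    | cons b M =>
      have h0 := h 0
      simp only [List.getD_cons_zero] at h0
      rw [h0, ih M (fun x hx => hL x (by simp [hx])) (fun x hx => hM x (by simp [hx]))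
        (fun i => by simpa using h (i + 1))]

theorem pt_inj {l m : JPartition} (h : ∀ i, pt l i = pt m i) : l = m :=
  sp_inj (getD_inj _ _ (sp_pos l) (sp_pos m) h)

theorem psize_pt (l : JPartition) {N : ℕ} (h : plen l ≤ N) : psize l = ∑ i ∈ Finset.range N, pt l i := by
  have := take_sum (sortedParts l) N
  rw [List.take_of_length_le (by rwa [sp_len])] at this
  rw [psize_eq', ← sp_coe, Multiset.sum_coe, this]; rfl

theorem abel (w c : ℕ → ℤ) (hw : Antitone w) (hc : ∀ k, 0 ≤ ∑ i ∈ Finset.range k, c i) (n : ℕ) :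
    w n * ∑ i ∈ Finset.range (n + 1), c i ≤ ∑ i ∈ Finset.range (n + 1), w i * c i := by
  induction n with
  | zero => simp
  | succ n ih =>
    rw [Finset.sum_range_succ _ (n + 1), Finset.sum_range_succ _ (n + 1), mul_add]
    have := mul_le_mul_of_nonneg_right (hw (Nat.le_succ n)) (hc (n + 1))
    have := this.trans ih
    simp only [Nat.succ_eq_add_one] at this
    linarith

theorem abel' (w a b : ℕ → ℕ) (hw : Antitone w)
    (hc : ∀ k, ∑ i ∈ Finset.range k, a i ≤ ∑ i ∈ Finset.range k, b i) (n : ℕ) :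
    ∑ i ∈ Finset.range n, (w i : ℤ) * a i ≤ ∑ i ∈ Finset.range n, (w i : ℤ) * b i := by
  have hk : ∀ k, 0 ≤ ∑ i ∈ Finset.range k, ((b i : ℤ) - a i) := by
    intro k
    have := hc k
    rw [Finset.sum_sub_distrib, sub_nonneg]
    exact_mod_cast this
  cases n with
  | zero => simp
  | succ n =>
    have := abel (fun i => w i) (fun i => (b i : ℤ) - a i) (fun i j h => Int.ofNat_le.mpr (hw h)) hk n
    have h2 := mul_nonneg (Int.natCast_nonneg (w n)) (hk (n + 1))
    have h3 := h2.trans this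
    simp only [mul_sub] at h3
    rw [Finset.sum_sub_distrib] at h3
    linarith

/-- strictness of the sum of squares -/
theorem dom_strict {l m : JPartition} (h : dominates l m) {N : ℕ} (hl : plen l ≤ N) (hm : plen m ≤ N)
    (he : ∑ i ∈ Finset.range N, (pt l i) ^ 2 = ∑ i ∈ Finset.range N, (pt m i) ^ 2) : l = m := by
  have hd : ∀ k, ∑ i ∈ Finset.range k, pt l i ≤ ∑ i ∈ Finset.range k, pt m i := by
    intro k; rw [← topSum_eq, ← topSum_eq]; exact h.2 k
  have h1 := abel' (pt l) _ _ (pt_anti l) hd N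
  have h2 := abel' (pt m) _ _ (pt_anti m) hd N
  have he' : ∑ i ∈ Finset.range N, (pt l i : ℤ) ^ 2 = ∑ i ∈ Finset.range N, (pt m i : ℤ) ^ 2 := by
    exact_mod_cast he
  have h3 : ∑ i ∈ Finset.range N, ((pt l i : ℤ) - pt m i) ^ 2 ≤ 0 := by
    have e1 : ∑ i ∈ Finset.range N, ((pt l i : ℤ) - pt m i) ^ 2 =
      ∑ i ∈ Finset.range N, (pt l i : ℤ) ^ 2 + ∑ i ∈ Finset.range N, (pt m i : ℤ) ^ 2 -
        2 * ∑ i ∈ Finset.range N, (pt l i : ℤ) * pt m i := by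
      rw [Finset.mul_sum, ← Finset.sum_add_distrib, ← Finset.sum_sub_distrib]
      exact Finset.sum_congr rfl fun i _ => by ring
    have e2 : ∑ i ∈ Finset.range N, (pt m i : ℤ) * pt l i = ∑ i ∈ Finset.range N, (pt l i : ℤ) * pt m i :=
      Finset.sum_congr rfl fun i _ => by ring
    simp only [pow_two] at he' e1
    simp only [pow_two]
    linarith
  apply pt_inj
  intro i
  by_cases hi : i < N
  · have := (Finset.sum_eq_zero_iff_of_nonneg (fun i _ => sq_nonneg _)).mp
      (le_antisymm h3 (Finset.sum_nonneg fun i _ => sq_nonneg _)) i (Finset.mem_range.mpr hi)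
    have := pow_eq_zero_iff (two_ne_zero) |>.mp this
    omega
  · rw [pt_zero l (by omega), pt_zero m (by omega)]

theorem dom_refl (l : JPartition) : dominates l l := ⟨rfl, fun _ => le_rfl⟩
theorem dom_trans {l m n : JPartition} (h : dominates l m) (h' : dominates m n) : dominates l n :=
  ⟨h.1.trans h'.1, fun k => (h.2 k).trans (h'.2 k)⟩
theorem dom_antisymm {l m : JPartition} (h : dominates l m) (h' : dominates m l) : l = m := by
  apply pt_inj
  intro i
  have h1 := le_antisymm (h.2 i) (h'.2 i)
  have h2 := le_antisymm (h.2 (i + 1)) (h'.2 (i + 1))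
  rw [topSum_eq, topSum_eq] at h1 h2
  rw [Finset.sum_range_succ, Finset.sum_range_succ] at h2
  omega

/-- partition of an exponent vector -/
def part {N : ℕ} (e : Fin N → ℕ) : JPartition :=
  ((Finset.univ.val.map e).filter (fun x => 0 < x)).map Nat.toPNat'

theorem part_coe {N : ℕ} (e : Fin N → ℕ) :
    (part e).map (fun i : ℕ+ => (i : ℕ)) = (Finset.univ.val.map e).filter (fun x => 0 < x) := by
  rw [part, Multiset.map_map]
  conv_rhs => rw [← Multiset.map_id ((Finset.univ.val.map e).filter (fun x => 0 < x))]
  apply Multiset.map_congr rfl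
  intro x hx
  have := (Multiset.mem_filter.mp hx).2
  simp only [Function.comp_apply, id, Nat.toPNat'_coe, this, if_true]

theorem part_perm {N : ℕ} (e : Fin N → ℕ) (s : Equiv.Perm (Fin N)) : part (e ∘ s) = part e := by
  have : Finset.univ.val.map (e ∘ s) = Finset.univ.val.map e := by
    rw [← Multiset.map_map]
    congr 1
    exact congrArg Finset.val (Finset.map_univ_equiv s)
  rw [part, this, part]

theorem filter_getD (L : List ℕ) (h : L.Pairwise (· ≥ ·)) (i : ℕ) :
    (L.filter (fun x => 0 < x)).getD i 0 = L.getD i 0 := by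
  induction L generalizing i with
  | nil => simp
  | cons a L ih =>
    have h2 := List.pairwise_cons.mp h
    rcases Nat.eq_zero_or_pos a with rfl | ha
    · have h0 : ∀ x ∈ L, x = 0 := fun x hx => by have := h2.1 x hx; omega
      have : (0 :: L).filter (fun x => 0 < x) = [] := by
        rw [List.filter_eq_nil_iff]
        intro x hx
        rcases List.mem_cons.mp hx with rfl | hx
        · simp
        · simp [h0 x hx]
      rw [this]
      cases i with
      | zero => simp
      | succ i =>
        rw [List.getD_cons_succ, ← ih h2.2]
        have : L.filter (fun x => 0 < x) = [] := by
          rw [List.filter_eq_nil_iff]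
          intro x hx
          simp [h0 x hx]
        rw [this]; simp
    · rw [List.filter_cons_of_pos (by simpa using ha)]
      cases i with
      | zero => simp
      | succ i => simpa using ih h2.2 i

theorem sp_part {N : ℕ} (e : Fin N → ℕ) (he : Antitone e) :
    sortedParts (part e) = (List.ofFn e).filter (fun x => 0 < x) := by
  have hs : (List.ofFn e).Pairwise (· ≥ ·) := by
    rw [List.pairwise_ofFn]
    intro i j h
    exact he h.le
  refine List.Perm.eq_of_pairwise (le := (· ≥ ·)) (fun a b _ _ h1 h2 => le_antisymm h2 h1) (sp_sorted _) (hs.filter _) ?_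
  rw [← Multiset.coe_eq_coe, sp_coe, part_coe, ← Multiset.filter_coe]
  congr 1
  rw [List.ofFn_eq_map, ← Multiset.map_coe]
  rfl

theorem pt_part {N : ℕ} (e : Fin N → ℕ) (he : Antitone e) (i : ℕ) :
    pt (part e) i = if h : i < N then e ⟨i, h⟩ else 0 := by
  have hs : (List.ofFn e).Pairwise (· ≥ ·) := by
    rw [List.pairwise_ofFn]
    intro i j h
    exact he h.le
  rw [pt, sp_part e he, filter_getD _ hs]
  split_ifs with h
  · rw [List.getD_eq_getElem _ _ (by simpa using h)]; simp
  · rw [List.getD_eq_default]; simpa using h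

theorem xexp_apply (l : JPartition) (N : ℕ) (j : Fin N) : xexp l N j = pt l j := rfl

theorem part_xexp (l : JPartition) {N : ℕ} (h : plen l ≤ N) : part (xexp l N) = l := by
  apply pt_inj
  intro i
  rw [pt_part (xexp l N) (fun i j hij => pt_anti l hij)]
  split_ifs with hi
  · rfl
  · rw [pt_zero l (by omega)]

theorem plen_part {N : ℕ} (e : Fin N → ℕ) : plen (part e) ≤ N := by
  rw [plen, ← Multiset.card_map (fun i : ℕ+ => (i : ℕ)), part_coe]
  refine (Multiset.card_le_card (Multiset.filter_le _ _)).trans ?_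
  simp

theorem exists_perm {N : ℕ} (e : Fin N → ℕ) : ∃ s : Equiv.Perm (Fin N), Antitone (e ∘ s) := by
  refine ⟨Tuple.sort (fun i => OrderDual.toDual (e i)), ?_⟩
  have := Tuple.monotone_sort (fun i => OrderDual.toDual (e i))
  intro i j h
  exact this h

theorem xexp_part {N : ℕ} (e : Fin N → ℕ) : ∃ s : Equiv.Perm (Fin N), ∀ j, xexp (part e) N j = e (s j) := by
  obtain ⟨s, hs⟩ := exists_perm e
  refine ⟨s, fun j => ?_⟩
  rw [xexp_apply, ← part_perm e s, pt_part _ hs, dif_pos j.2]; rfl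

theorem psize_part {N : ℕ} (e : Fin N → ℕ) : psize (part e) = ∑ i, e i := by
  rw [psize_eq', part_coe, Finset.sum]
  induction (Finset.univ.val.map e) using Multiset.induction_on with
  | empty => simp
  | cons a s ih =>
    rw [Multiset.sum_cons, ← ih]
    by_cases h : 0 < a
    · rw [Multiset.filter_cons_of_pos _ h, Multiset.sum_cons]
    · rw [Multiset.filter_cons_of_neg _ h, show a = 0 by omega, zero_add]

theorem sum_anti (a : ℕ → ℕ) (ha : Antitone a) (S : Finset ℕ) :
    ∑ i ∈ S, a i ≤ ∑ i ∈ Finset.range S.card, a i := by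
  induction S using Finset.induction_on_max with
  | empty => simp
  | insert m S hm ih =>
    have hn : m ∉ S := fun h => lt_irrefl _ (hm m h)
    rw [Finset.sum_insert hn, Finset.card_insert_of_notMem hn, Finset.sum_range_succ, add_comm]
    refine add_le_add ih (ha ?_)
    have : S ⊆ Finset.range m := fun x hx => Finset.mem_range.mpr (hm x hx)
    simpa using Finset.card_le_card this

theorem sum_anti' {N : ℕ} (l : JPartition) (S : Finset (Fin N)) :
    ∑ i ∈ S, xexp l N i ≤ ∑ i ∈ Finset.range S.card, pt l i := by
  have := sum_anti (pt l) (pt_anti l) (S.map Fin.valEmbedding)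
  rw [Finset.sum_map, Finset.card_map] at this
  exact this

theorem sum_xexp {N k : ℕ} (l : JPartition) (hk : k ≤ N) :
    ∑ i ∈ (Finset.univ.filter fun i : Fin N => (i : ℕ) < k), xexp l N i = ∑ i ∈ Finset.range k, pt l i := by
  refine (Finset.sum_map (Finset.univ.filter fun i : Fin N => (i : ℕ) < k) Fin.valEmbedding (pt l)).symm.trans ?_
  congr 1
  ext i
  simp only [Finset.mem_map, Finset.mem_filter, Finset.mem_univ, true_and, Finset.mem_range]
  constructor
  · rintro ⟨a, h, rfl⟩; exact h
  · intro h; exact ⟨⟨i, by omega⟩, h, rfl⟩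

theorem card_first {N k : ℕ} (hk : k ≤ N) : (Finset.univ.filter fun i : Fin N => (i : ℕ) < k).card = k := by
  rw [← Finset.card_map Fin.valEmbedding]
  conv_rhs => rw [← Finset.card_range k]
  congr 1
  ext i
  simp only [Finset.mem_map, Finset.mem_filter, Finset.mem_univ, true_and, Finset.mem_range]
  constructor
  · rintro ⟨a, h, rfl⟩; exact h
  · intro h; exact ⟨⟨i, by omega⟩, h, rfl⟩

theorem sum_xexp_univ {N : ℕ} (l : JPartition) (h : plen l ≤ N) : ∑ i, xexp l N i = psize l := by
  rw [psize_pt l h, Finset.sum_range]; rfl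

theorem Dm_xexp {N : ℕ} {l m : JPartition} (hl : plen l ≤ N) (hm : plen m ≤ N) :
    Dm (xexp l N) (xexp m N) ↔ dominates l m := by
  constructor
  · rintro ⟨h1, h2⟩
    rw [sum_xexp_univ l hl, sum_xexp_univ m hm] at h1
    refine ⟨h1, fun k => ?_⟩
    rw [topSum_eq, topSum_eq]
    by_cases hk : k ≤ N
    · obtain ⟨S', hS, h3⟩ := h2 (Finset.univ.filter fun i : Fin N => (i : ℕ) < k)
      rw [sum_xexp l hk] at h3
      rw [card_first hk] at hS
      refine h3.trans ((sum_anti' m S').trans ?_)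
      exact Finset.sum_le_sum_of_subset (Finset.range_subset_range.mpr hS)
    · rw [← psize_pt l (by omega), ← psize_pt m (by omega), h1]
  · intro h
    refine ⟨by rw [sum_xexp_univ l hl, sum_xexp_univ m hm, h.1], fun S => ?_⟩
    have hS : S.card ≤ N := by simpa using Finset.card_le_univ S
    refine ⟨(Finset.univ.filter fun i : Fin N => (i : ℕ) < S.card), (card_first hS).le, ?_⟩
    rw [sum_xexp m hS]
    refine (sum_anti' l S).trans ?_
    rw [← topSum_eq, ← topSum_eq]; exact h.2 _

theorem Dm_part {N : ℕ} (e : Fin N →₀ ℕ) : Dm e (xexp (part e) N) ∧ Dm (xexp (part e) N) e := by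
  obtain ⟨s, hs⟩ := xexp_part (e : Fin N → ℕ)
  have h1 : (xexp (part e) N).mapDomain s = e := by
    ext i
    obtain ⟨j, rfl⟩ := s.surjective i
    rw [Finsupp.mapDomain_apply s.injective, hs]
  have h2 : e.mapDomain s.symm = xexp (part e) N := by
    ext i
    obtain ⟨j, rfl⟩ := s.symm.surjective i
    rw [Finsupp.mapDomain_apply s.symm.injective, hs, Equiv.apply_symm_apply]
  constructor
  · conv_lhs => rw [← h1]
    exact Dm_perm s _
  · conv_lhs => rw [← h2]
    exact Dm_perm _ _

theorem Dm_iff {N : ℕ} (e e' : Fin N →₀ ℕ) : Dm e e' ↔ dominates (part e) (part e') := by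
  rw [← Dm_xexp (plen_part e) (plen_part e')]
  exact ⟨fun h => ((Dm_part e).2.trans h).trans (Dm_part e').1,
    fun h => ((Dm_part e).1.trans h).trans (Dm_part e').2⟩

theorem plen_le_psize (l : JPartition) : plen l ≤ psize l := by
  induction l using Multiset.induction_on with
  | empty => simp [plen]
  | cons a s ih => rw [psize_cons, plen, Multiset.card_cons]; have := a.pos; rw [plen] at ih; omega

/-- product of `gg` over a partition -/
def G (l : JPartition) : SymA := (l.map fun i : ℕ+ => gg (i : ℕ)).prod

theorem G_part {N : ℕ} (e : Fin N → ℕ) : G (part e) = Gf e := by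
  have : G (part e) = (((part e).map (fun i : ℕ+ => (i : ℕ))).map gg).prod := by
    rw [Multiset.map_map]; rfl
  rw [this, part_coe, Gf, Finset.prod]
  have h2 : Finset.univ.val.map (fun i => gg (e i)) = (Finset.univ.val.map e).map gg := by
    rw [Multiset.map_map]; rfl
  rw [h2]
  induction (Finset.univ.val.map e) using Multiset.induction_on with
  | empty => simp
  | cons a s ih =>
    rw [Multiset.map_cons, Multiset.prod_cons, ← ih]
    by_cases h : 0 < a
    · rw [Multiset.filter_cons_of_pos _ h, Multiset.map_cons, Multiset.prod_cons]
    · rw [Multiset.filter_cons_of_neg _ h, show a = 0 by omega, gg_zero, one_mul]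

theorem coeff_ph {N : ℕ} (f : SymA) (e : Fin N →₀ ℕ) : coeff e (ph 1 N f) = hall (G (part e)) f := by
  rw [coeff_evalN, G_part]

theorem G_cons (k : ℕ+) (l : JPartition) : G (k ::ₘ l) = gg k * G l := by
  rw [G, Multiset.map_cons, Multiset.prod_cons]; rfl

theorem Hom_G (l : JPartition) : Hom (psize l) (G l) := by
  induction l using Multiset.induction_on with
  | empty => exact Hom_one
  | cons k l ih => rw [G_cons, psize_cons]; exact (Hom_gg k).mul ih

end Jk

namespace Jk
open MvPolynomial Dk

theorem tri {J : JPartition → SymA} (hJ : IsJackFamily J) {l m : JPartition} (h : ¬ dominates m l) :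
    hall (G m) (J l) = 0 := by
  have := hJ.triangular l m h
  rw [← ph_one, coeff_ph, part_xexp m (by omega)] at this
  exact this

theorem G_nondeg {f : SymA} (h : ∀ m, hall (G m) f = 0) : f = 0 := by
  obtain ⟨N, hN⟩ := exists_LE f
  refine ph_inj one_ne_zero hN ?_
  ext e
  rw [coeff_ph, h, coeff_zero]

theorem hall_comp {n : ℕ} {g : SymA} (hg : Hom n g) (f : SymA) :
    hall g (weightedHomogeneousComponent w0 n f) = hall g f := by
  rw [hall, hall]
  refine Finset.sum_congr rfl fun m hm => ?_
  rw [coeff_weightedHomogeneousComponent, if_pos (hg (mem_support_iff.mp hm))]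

theorem Hom_J {J : JPartition → SymA} (hJ : IsJackFamily J) (l : JPartition) : Hom (psize l) (J l) := by
  have hc : Hom (psize l) (weightedHomogeneousComponent w0 (psize l) (J l)) := by
    intro m hm
    rw [coeff_weightedHomogeneousComponent] at hm
    by_contra h
    exact hm (if_neg h)
  have : J l - weightedHomogeneousComponent w0 (psize l) (J l) = 0 := by
    apply G_nondeg
    intro m
    rw [hall_sub_right]
    by_cases h : psize m = psize l
    · rw [hall_comp (h ▸ Hom_G m), sub_self]
    · rw [tri hJ (fun hd => h hd.1), hall_Hom_ne (Hom_G m) hc h, sub_self]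
  rw [sub_eq_zero.mp this]; exact hc

theorem J_ne {J : JPartition → SymA} (hJ : IsJackFamily J) (l : JPartition) : J l ≠ 0 := by
  intro h
  have := hJ.normalized l
  rw [h, coeff_zero] at this
  exact zero_ne_one this

theorem J_norm {J : JPartition → SymA} (hJ : IsJackFamily J) (l : JPartition) : hall (J l) (J l) ≠ 0 :=
  fun h => J_ne hJ l (hall_anis h)

theorem pt_le (l : JPartition) (i : ℕ) : pt l i ≤ psize l := by
  rw [psize_pt l (N := plen l + i + 1) (by omega)]
  exact Finset.single_le_sum (f := pt l) (fun _ _ => Nat.zero_le _) (Finset.mem_range.mpr (by omega))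


theorem P_finite (n : ℕ) : {l : JPartition | psize l = n}.Finite := by
  refine Set.Finite.of_finite_image (f := fun l => (fun i : Fin n => pt l i)) ?_ ?_
  · refine (Set.Finite.pi (fun _ : Fin n => Set.finite_Iic n)).subset ?_
    rintro _ ⟨l, hl, rfl⟩ i _
    have := pt_le l i
    rw [show psize l = n from hl] at this
    exact this
  · intro l hl m hm h
    apply pt_inj
    intro i
    by_cases hi : i < n
    · exact congrFun h ⟨i, hi⟩
    · have h1 := plen_le_psize l
      have h2 := plen_le_psize m
      rw [show psize l = n from hl] at h1
      rw [show psize m = n from hm] at h2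
      rw [pt_zero l (by omega), pt_zero m (by omega)]

/-- partitions of size `n` -/
def P (n : ℕ) : Finset JPartition := (P_finite n).toFinset

theorem mem_P {n : ℕ} {l : JPartition} : l ∈ P n ↔ psize l = n := by simp [P]

/-- linear combination -/
def lc (J : JPartition → SymA) (n : ℕ) : (P n → F) →ₗ[F] SymA :=
  ∑ l : P n, (LinearMap.proj l).smulRight (J l)

theorem lc_apply (J : JPartition → SymA) (n : ℕ) (c : P n → F) : lc J n c = ∑ l : P n, c l • J l := by
  simp [lc]

theorem Hom_lc {J : JPartition → SymA} (hJ : IsJackFamily J) (n : ℕ) (c : P n → F) : Hom n (lc J n c) := by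
  rw [lc_apply]
  refine Hom_sum _ _ fun l _ => ?_
  have := Hom_J hJ l
  rw [mem_P.mp l.2] at this
  exact this.smul _

theorem hall_lc {J : JPartition → SymA} (hJ : IsJackFamily J) (n : ℕ) (c : P n → F) (l : P n) :
    hall (J l) (lc J n c) = c l * hall (J l) (J l) := by
  rw [lc_apply, hall_sum_right, Finset.sum_eq_single l]
  · rw [hall_smul_right]
  · intro m _ hm
    rw [hall_smul_right, hJ.orthogonal l m (fun h => hm (Subtype.ext h.symm)), mul_zero]
  · intro h; exact absurd (Finset.mem_univ l) h

theorem lc_inj {J : JPartition → SymA} (hJ : IsJackFamily J) (n : ℕ) {c : P n → F} (h : lc J n c = 0) : c = 0 := by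
  ext l
  have := hall_lc hJ n c l
  rw [h, hall_zero_right] at this
  exact (mul_eq_zero.mp this.symm).resolve_right (J_norm hJ l)

theorem pair_surj {J : JPartition → SymA} (hJ : IsJackFamily J) (n : ℕ) (H : JPartition → SymA)
    (hH : ∀ f, Hom n f → (∀ m, psize m = n → hall (H m) f = 0) → f = 0) (d : P n → F) :
    ∃ c, ∀ m : P n, hall (H m) (lc J n c) = d m := by
  let A : (P n → F) →ₗ[F] (P n → F) := LinearMap.pi fun m => (hallL (H m)).comp (lc J n)
  have hA : Function.Injective A := by
    rw [injective_iff_map_eq_zero]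
    intro c hc
    apply lc_inj hJ
    apply hH _ (Hom_lc hJ n c)
    intro m hm
    exact congrFun hc ⟨m, mem_P.mpr hm⟩
  obtain ⟨c, hc⟩ := LinearMap.injective_iff_surjective.mp hA d
  exact ⟨c, fun m => congrFun hc m⟩

theorem Hom_coeff_ext {n : ℕ} {f : SymA} (hf : Hom n f) (h : ∀ m, psize m = n → hall (pPow m) f = 0) : f = 0 := by
  ext e
  obtain ⟨l, rfl⟩ := toExp_surj e
  rw [coeff_zero]
  by_contra hc
  have h1 := hf hc
  rw [wt_eq, wt_toExp] at h1
  have := h l h1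
  rw [hall_pPow] at this
  exact (mul_ne_zero hc (zalpha_ne _)) this

theorem Hom.sub {a : ℕ} {f g : SymA} (hf : Hom a f) (hg : Hom a g) : Hom a (f - g) := by
  rw [sub_eq_add_neg, ← neg_one_smul F g]; exact Hom.add hf (Hom.smul hg _)

theorem J_expand {J : JPartition → SymA} (hJ : IsJackFamily J) {n : ℕ} {f : SymA} (hf : Hom n f) :
    f = ∑ l ∈ P n, (hall (J l) f / hall (J l) (J l)) • J l := by
  obtain ⟨c, hc⟩ := pair_surj hJ n pPow (fun f hf h => Hom_coeff_ext hf h) (fun m => hall (pPow m) f)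
  have h1 : f = lc J n c := by
    rw [← sub_eq_zero]
    refine Hom_coeff_ext (hf.sub (Hom_lc hJ n c)) fun m hm => ?_
    rw [hall_sub_right, hc ⟨m, mem_P.mpr hm⟩, sub_self]
  conv_lhs => rw [h1, lc_apply]
  rw [← Finset.sum_coe_sort (P n)]
  refine Finset.sum_congr rfl fun l _ => ?_
  rw [h1, hall_lc hJ, mul_div_cancel_right₀ _ (J_norm hJ l)]

theorem J_ext {J : JPartition → SymA} (hJ : IsJackFamily J) {n : ℕ} {f g : SymA} (hf : Hom n f) (hg : Hom n g)
    (h : ∀ l, psize l = n → hall (J l) f = hall (J l) g) : f = g := by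
  rw [J_expand hJ hf, J_expand hJ hg]
  exact Finset.sum_congr rfl fun l hl => by rw [h l (mem_P.mp hl)]

/-- eigen-type statement -/
theorem J_eig {J : JPartition → SymA} (hJ : IsJackFamily J) {l : JPartition} {f : SymA} (hf : Hom (psize l) f)
    (h : ∀ s, s ≠ l → psize s = psize l → hall (J s) f = 0) : f = (hall (J l) f / hall (J l) (J l)) • J l := by
  apply J_ext hJ hf ((Hom_J hJ l).smul _)
  intro s hs
  rw [hall_smul_right]
  by_cases e : s = l
  · subst e; rw [div_mul_cancel₀ _ (J_norm hJ s)]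
  · rw [h s e hs, hJ.orthogonal s l e, mul_zero]

theorem mm_exists {J : JPartition → SymA} (hJ : IsJackFamily J) (l : JPartition) :
    ∃ f, Hom (psize l) f ∧ ∀ m, hall (G m) f = if m = l then 1 else 0 := by
  obtain ⟨c, hc⟩ := pair_surj hJ (psize l) G (fun f hf h => G_nondeg fun m => by
    by_cases e : psize m = psize l
    · exact h m e
    · exact hall_Hom_ne (Hom_G m) hf e) (fun m => if (m : JPartition) = l then 1 else 0)
  refine ⟨lc J (psize l) c, Hom_lc hJ _ c, fun m => ?_⟩
  by_cases e : psize m = psize l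
  · exact hc ⟨m, mem_P.mpr e⟩
  · rw [hall_Hom_ne (Hom_G m) (Hom_lc hJ _ c) e, if_neg (fun h => e (by rw [h]))]

/-- span of `G` strictly above -/
def SpG (l : JPartition) : Submodule F SymA := Submodule.span F {g | ∃ r, dominates l r ∧ r ≠ l ∧ g = G r}

theorem SpG_mono {l m : JPartition} (h : dominates l m) : SpG m ≤ SpG l := by
  apply Submodule.span_mono
  rintro _ ⟨r, h1, h2, rfl⟩
  exact ⟨r, dom_trans h h1, fun e => h2 (by subst e; exact dom_antisymm h h1), rfl⟩

theorem G_mem_SpG {l r : JPartition} (h : dominates l r) (hne : r ≠ l) : G r ∈ SpG l :=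
  Submodule.subset_span ⟨r, h, hne, rfl⟩

theorem G_expand {J : JPartition → SymA} (hJ : IsJackFamily J) (l : JPartition) :
    ∃ g ∈ Submodule.span F {f | ∃ s, dominates l s ∧ s ≠ l ∧ f = J s},
      G l = (hall (G l) (J l) / hall (J l) (J l)) • J l + g := by
  have h := J_expand hJ (Hom_G l)
  refine ⟨_, ?_, h.trans ((Finset.add_sum_erase (P (psize l)) (fun s => (hall (J s) (G l) / hall (J s) (J s)) • J s)
    (mem_P.mpr rfl)).symm.trans (by rw [hall_comm (G l)]))⟩
  apply Submodule.sum_mem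
  intro s hs
  by_cases hd : dominates l s
  · exact Submodule.smul_mem _ _ (Submodule.subset_span ⟨s, hd, (Finset.mem_erase.mp hs).1, rfl⟩)
  · rw [hall_comm, tri hJ hd, zero_div, zero_smul]; exact Submodule.zero_mem _

theorem J_G {J : JPartition → SymA} (hJ : IsJackFamily J) (l : JPartition) :
    hall (G l) (J l) ≠ 0 ∧ ∃ c : F, c ≠ 0 ∧ J l - c • G l ∈ SpG l := by
  induction hk : ((P (psize l)).filter fun s => dominates l s ∧ s ≠ l).card using Nat.strong_induction_on
    generalizing l with
  | _ k ih =>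
    have hup : ∀ s, dominates l s → s ≠ l → J s ∈ SpG l := by
      intro s hs hne
      obtain ⟨_, c, _, hc⟩ := ih _ (by
        rw [← hk]
        apply Finset.card_lt_card
        rw [Finset.ssubset_iff_of_subset]
        · refine ⟨s, ?_, ?_⟩
          · rw [Finset.mem_filter, mem_P]; exact ⟨hs.1.symm, hs, hne⟩
          · rw [Finset.mem_filter]; exact fun h => h.2.2 rfl
        · intro r hr
          rw [Finset.mem_filter, mem_P] at hr ⊢
          exact ⟨hr.1.trans hs.1.symm, dom_trans hs hr.2.1, fun e => hne (by
            have := hr.2.1; rw [e] at this; exact dom_antisymm this hs)⟩) s rfl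
      have := Submodule.add_mem _ (SpG_mono hs hc) (Submodule.smul_mem _ c (G_mem_SpG hs hne))
      rwa [sub_add_cancel] at this
    obtain ⟨g, hg, hG⟩ := G_expand hJ l
    have hg' : g ∈ SpG l := by
      refine (Submodule.span_le.mpr ?_ : _ ≤ SpG l) hg
      rintro _ ⟨s, h1, h2, rfl⟩
      exact hup s h1 h2
    have ha : hall (G l) (J l) ≠ 0 := by
      intro h0
      rw [h0, zero_div, zero_smul, zero_add] at hG
      obtain ⟨f, _, hf⟩ := mm_exists hJ l
      have hz : ∀ g ∈ SpG l, hall g f = 0 := by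
        intro g hg
        induction hg using Submodule.span_induction with
        | mem x hx => obtain ⟨r, _, h2, rfl⟩ := hx; rw [hf, if_neg h2]
        | zero => exact hall_zero_left f
        | add x y _ _ hx hy => rw [hall_add_left, hx, hy, add_zero]
        | smul c x _ hx => rw [hall_smul_left, hx, mul_zero]
      have h1 := hf l
      rw [if_pos rfl, hG, hz g hg'] at h1
      exact zero_ne_one h1
    refine ⟨ha, (hall (G l) (J l) / hall (J l) (J l))⁻¹, inv_ne_zero (div_ne_zero ha (J_norm hJ l)), ?_⟩
    have hd := div_ne_zero ha (J_norm hJ l)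
    generalize hall (G l) (J l) / hall (J l) (J l) = d at hG hd ⊢
    have : J l - d⁻¹ • G l = -(d⁻¹ • g) := by
      rw [hG, smul_add, inv_smul_smul₀ hd]
      abel
    rw [this]
    exact Submodule.neg_mem _ (Submodule.smul_mem _ _ hg')

theorem tri' {J : JPartition → SymA} (hJ : IsJackFamily J) {l : JPartition} {f : SymA}
    (h : ∀ m, hall (G m) f ≠ 0 → dominates m l) (s : JPartition) (hs : hall (J s) f ≠ 0) : dominates s l := by
  by_contra hd
  have h1 : ∀ r, dominates s r → hall (G r) f = 0 := fun r hr => by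
    by_contra h2
    exact hd (dom_trans hr (h r h2))
  have hz : ∀ g ∈ SpG s, hall g f = 0 := by
    intro g hg
    induction hg using Submodule.span_induction with
    | mem x hx => obtain ⟨r, h2, _, rfl⟩ := hx; exact h1 r h2
    | zero => exact hall_zero_left f
    | add x y _ _ hx hy => rw [hall_add_left, hx, hy, add_zero]
    | smul c x _ hx => rw [hall_smul_left, hx, mul_zero]
  obtain ⟨_, c, _, hc⟩ := J_G hJ s
  have := hz _ hc
  rw [hall_sub_left, hall_smul_left, h1 s (dom_refl s), mul_zero, sub_zero] at this
  exact hs this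

theorem J_mem_W {J : JPartition → SymA} (hJ : IsJackFamily J) (l : JPartition) {N : ℕ} (hN : plen l ≤ N) :
    ph 1 N (J l) ∈ W F (xexp l N) := by
  intro e he
  rw [coeff_ph] at he
  rw [Dm_iff, part_xexp l hN]
  by_contra h
  exact he (tri hJ h)

theorem tri_W {J : JPartition → SymA} (hJ : IsJackFamily J) {l : JPartition} {f : SymA}
    (h : ∀ N, psize l ≤ N → ph 1 N f ∈ W F (xexp l N)) (s : JPartition) (hs : hall (J s) f ≠ 0) : dominates s l := by
  refine tri' hJ (fun m hm => ?_) s hs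
  have := h (psize l + plen m) (by omega) (xexp m _) (by
    rw [coeff_ph, part_xexp m (by omega)]; exact hm)
  rwa [Dm_xexp (by omega) (by have := plen_le_psize l; omega)] at this

end Jk

namespace Jk
open MvPolynomial Dk

/-- derivative with natural index -/
def pdn (k : ℕ) : SymA →ₗ[F] SymA := if 0 < k then (pderiv k.toPNat' : Derivation F SymA SymA).toLinearMap else 0

theorem pdn_zero (f : SymA) : pdn 0 f = 0 := by simp [pdn]

theorem pdn_coe (k : ℕ+) (f : SymA) : pdn k f = pderiv k f := by
  rw [pdn, if_pos k.pos, PNat.coe_toPNat']; rfl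

theorem pn_zero : pn 0 = 0 := by simp [pn]

theorem nat_cases (k : ℕ) : k = 0 ∨ ∃ k' : ℕ+, k = k' := by
  rcases Nat.eq_zero_or_pos k with h | h
  · exact Or.inl h
  · exact Or.inr ⟨⟨k, h⟩, rfl⟩

theorem hall_pn_mul (k : ℕ) (f g : SymA) : hall (pn k * f) g = alpha * (k : F) * hall f (pdn k g) := by
  rcases nat_cases k with rfl | ⟨k, rfl⟩
  · rw [pn_zero, zero_mul, hall_zero_left, Nat.cast_zero, mul_zero, zero_mul]
  · rw [pn_coe, pdn_coe, hall_X_mul]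

theorem LE_pdn {M : ℕ} {f : SymA} (hf : LE M f) (k : ℕ) : LE M (pdn k f) := by
  rcases nat_cases k with rfl | ⟨k, rfl⟩
  · rw [pdn_zero]; exact LE_zero M
  · rw [pdn_coe]; exact (hf.pderiv k _ rfl).mono (Nat.sub_le _ _)

theorem LE_pdn_zero {M : ℕ} {f : SymA} (hf : LE M f) {k : ℕ} (h : M < k) : pdn k f = 0 := by
  rcases nat_cases k with rfl | ⟨k, rfl⟩
  · exact pdn_zero f
  · rw [pdn_coe]; exact hf.pderiv_zero h

theorem Hom_pdn {n : ℕ} {f : SymA} (hf : Hom n f) {k m : ℕ} (h : m + k = n) : Hom m (pdn k f) := by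
  rcases nat_cases k with rfl | ⟨k, rfl⟩
  · rw [pdn_zero]; exact Hom_zero m
  · rw [pdn_coe]; exact Hom_pd hf h

theorem Hom_pn_mul {n k m : ℕ} {f : SymA} (hf : Hom m f) (h : k + m = n) : Hom n (pn k * f) := by
  rcases nat_cases k with rfl | ⟨k, rfl⟩
  · rw [pn_zero, zero_mul]; exact Hom_zero n
  · rw [← h]; exact (Hom_pn k.pos).mul hf

theorem pdn_comm (j k : ℕ) (f : SymA) : pdn j (pdn k f) = pdn k (pdn j f) := by
  rcases nat_cases k with rfl | ⟨k, rfl⟩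
  · rw [pdn_zero, pdn_zero, map_zero]
  · rcases nat_cases j with rfl | ⟨j, rfl⟩
    · rw [pdn_zero, pdn_zero, map_zero]
    · rw [pdn_coe, pdn_coe, pdn_coe, pdn_coe, pd_comm]

theorem laxn {a g : F} (hag : Good a g) (N : ℕ) (i : Fin N) (k : ℕ) {M : ℕ} {f : SymA} (hf : LE M f) :
    Lam a g i (X i ^ k * ph g N f) =
      C alpha * ∑ j ∈ Finset.range (M + 1), C (j : F) * (X i ^ (k + j) * ph g N (pdn j f)) +
      ∑ l ∈ Finset.range k, X i ^ l * ph g N (pn (k - l) * f) +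
      C (alpha - 1) * (C (k : F) * (X i ^ k * ph g N f)) := by
  rw [lax hag N i k f ((Finset.range M).map ⟨Nat.succPNat, Nat.succPNat_injective⟩)]
  · rw [Finset.sum_map, Finset.sum_range_succ' _ M]
    simp only [Function.Embedding.coeFn_mk, Nat.cast_zero, C_0, zero_mul, add_zero, ← pdn_coe,
      Nat.succPNat_coe, Nat.succ_eq_add_one]
  · intro j hj
    apply hf.pderiv_zero
    by_contra h
    apply hj
    rw [Finset.mem_map]
    refine ⟨(j : ℕ) - 1, Finset.mem_range.mpr (by have := j.pos; omega), ?_⟩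
    apply PNat.coe_injective
    have := j.pos
    simp only [Function.Embedding.coeFn_mk, Nat.succPNat_coe]; omega

/-- Laplace-Beltrami operator -/
def Dd (M : ℕ) (f : SymA) : SymA := ∑ j ∈ Finset.range (M + 1), (alpha * (j : F)) •
  (alpha • ∑ l ∈ Finset.range (M + 1), (l : F) • (pn (j + l) * pdn l (pdn j f)) +
   ∑ l ∈ Finset.range j, pn l * (pn (j - l) * pdn j f) + ((alpha - 1) * (j : F)) • (pn j * pdn j f))

def Eu (M : ℕ) (f : SymA) : SymA := ∑ j ∈ Finset.range (M + 1), (j : F) • (pn j * pdn j f)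

theorem ph_smul (g : F) (N : ℕ) (c : F) (f : SymA) : ph g N (c • f) = C c * ph g N f := by
  rw [map_smul, C_mul']

theorem psum (g : F) (N : ℕ) (k : ℕ) (h : SymA) : ∑ i : Fin N, C g * (X i ^ k * ph g N h) =
    ph g N (pn k * h) + if k = 0 then C (g * N) * ph g N h else 0 := by
  rcases Nat.eq_zero_or_pos k with rfl | hk
  · rw [pn_zero, zero_mul, map_zero, if_pos rfl]
    simp only [pow_zero, one_mul, Finset.sum_const, Finset.card_univ, Fintype.card_fin, nsmul_eq_mul,
      map_mul, map_natCast]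
    ring
  · rw [if_neg (by omega), add_zero, map_mul, ph_pn g N hk, ← Finset.mul_sum, ← Finset.sum_mul, mul_assoc]

theorem ph_Dd {a g : F} (hag : Good a g) (N : ℕ) {M : ℕ} {f : SymA} (hf : LE M f) :
    C g * ∑ i : Fin N, Lam a g i (Lam a g i (ph g N f)) =
      ph g N (Dd M f) + C (g * N) * (C alpha * ph g N (Eu M f)) := by
  have h1 : ∀ i : Fin N, Lam a g i (ph g N f) =
      ∑ j ∈ Finset.range (M + 1), C (alpha * (j : F)) * (X i ^ j * ph g N (pdn j f)) := by
    intro i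
    have := laxn hag N i 0 hf
    simp only [pow_zero, one_mul, Finset.range_zero, Finset.sum_empty, Nat.cast_zero, C_0, zero_mul, mul_zero,
      add_zero, zero_add] at this
    rw [this, Finset.mul_sum]
    exact Finset.sum_congr rfl fun j _ => by rw [C_mul, mul_assoc]
  have h2 : ∀ j ∈ Finset.range (M + 1), ∑ i : Fin N, C g * Lam a g i (X i ^ j * ph g N (pdn j f)) =
      ph g N (alpha • ∑ l ∈ Finset.range (M + 1), (l : F) • (pn (j + l) * pdn l (pdn j f)) +
        ∑ l ∈ Finset.range j, pn l * (pn (j - l) * pdn j f) + ((alpha - 1) * (j : F)) • (pn j * pdn j f)) +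
      C (g * N) * ph g N (pn j * pdn j f) := by
    intro j _
    have e1 : ∀ i : Fin N, C g * Lam a g i (X i ^ j * ph g N (pdn j f)) =
      C alpha * ∑ l ∈ Finset.range (M + 1), C (l : F) * (C g * (X i ^ (j + l) * ph g N (pdn l (pdn j f)))) +
      ∑ l ∈ Finset.range j, C g * (X i ^ l * ph g N (pn (j - l) * pdn j f)) +
      C (alpha - 1) * (C (j : F) * (C g * (X i ^ j * ph g N (pdn j f)))) := by
      intro i
      rw [laxn hag N i j (LE_pdn hf j)]
      simp only [Finset.mul_sum, mul_add]
      refine congrArg₂ (· + ·) (congrArg₂ (· + ·) ?_ rfl) (by ring)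
      exact Finset.sum_congr rfl fun l _ => by ring
    rw [Finset.sum_congr rfl fun i _ => e1 i, Finset.sum_add_distrib, Finset.sum_add_distrib,
      ← Finset.mul_sum, ← Finset.mul_sum, ← Finset.mul_sum, Finset.sum_comm, Finset.sum_comm (s := Finset.univ)]
    simp only [← Finset.mul_sum (Finset.univ : Finset (Fin N)) _ (C _)]
    simp only [Finset.mul_sum _ _ (C g), psum]
    rcases Nat.eq_zero_or_pos j with rfl | hj
    · simp [pdn_zero]
    · have e2 : ∀ l, j + l ≠ 0 := fun l => by omega
      simp only [e2, if_false, add_zero, show j ≠ 0 by omega]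
      rw [Finset.sum_add_distrib, Finset.sum_ite_eq' (Finset.range j) 0, if_pos (Finset.mem_range.mpr hj), Nat.sub_zero]
      simp only [map_add, map_sum, ph_smul, C_mul]
      ring
  simp only [h1, map_sum, Lam_C_mul]
  rw [Finset.sum_comm, Finset.mul_sum]
  have h3 : ∀ j ∈ Finset.range (M + 1), C g * ∑ i : Fin N, C (alpha * (j : F)) * Lam a g i (X i ^ j * ph g N (pdn j f)) =
      C (alpha * (j : F)) * ∑ i : Fin N, C g * Lam a g i (X i ^ j * ph g N (pdn j f)) := by
    intro j _
    rw [← Finset.mul_sum, ← Finset.mul_sum]; ring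
  rw [Finset.sum_congr rfl h3, Finset.sum_congr rfl fun j hj => by rw [h2 j hj]]
  rw [Dd, Eu, map_sum, map_sum, Finset.mul_sum, Finset.mul_sum, ← Finset.sum_add_distrib]
  refine Finset.sum_congr rfl fun j _ => ?_
  rw [ph_smul, ph_smul, C_mul]
  ring

theorem hall_T {M : ℕ} {f g : SymA} (hg : LE M g) :
    ∑ j ∈ Finset.range (M + 1), ∑ l ∈ Finset.range (M + 1),
      ((j : F) * l * (j + l : ℕ)) * hall (pdn l (pdn j f)) (pdn (j + l) g) =
    ∑ j ∈ Finset.range (M + 1), ∑ l ∈ Finset.range j,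
      ((j : F) * l * (j - l : ℕ)) * hall (pdn j g) (pdn (j - l) (pdn l f)) := by
  rw [← Finset.sum_product']
  have h1 : ∑ x ∈ Finset.range (M + 1) ×ˢ Finset.range (M + 1),
      ((x.1 : F) * x.2 * (x.1 + x.2 : ℕ)) * hall (pdn x.2 (pdn x.1 f)) (pdn (x.1 + x.2) g) =
    ∑ x ∈ (Finset.range (M + 1) ×ˢ Finset.range (M + 1)).filter (fun x => x.1 + x.2 ≤ M ∧ x.1 ≠ 0),
      ((x.1 : F) * x.2 * (x.1 + x.2 : ℕ)) * hall (pdn x.2 (pdn x.1 f)) (pdn (x.1 + x.2) g) := by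
    symm
    apply Finset.sum_subset (Finset.filter_subset _ _)
    intro x hx hn
    rw [Finset.mem_filter, not_and, not_and_or] at hn
    rcases hn hx with h | h
    · rw [LE_pdn_zero hg (by omega), hall_zero_right, mul_zero]
    · rw [not_not.mp h, pdn_zero, map_zero, hall_zero_left, mul_zero]
  rw [h1, Finset.sum_sigma']
  refine Finset.sum_bij' (fun x _ => ⟨x.1 + x.2, x.2⟩) (fun y _ => (y.1 - y.2, y.2)) ?_ ?_ ?_ ?_ ?_
  · intro x hx
    simp only [Finset.mem_filter, Finset.mem_product, Finset.mem_range, Finset.mem_sigma] at hx ⊢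
    omega
  · intro y hy
    simp only [Finset.mem_filter, Finset.mem_product, Finset.mem_range, Finset.mem_sigma] at hy ⊢
    omega
  · intro x hx
    simp
  · intro y hy
    simp only [Finset.mem_range, Finset.mem_sigma] at hy
    ext
    · simp only; omega
    · simp
  · intro x hx
    simp only [Nat.add_sub_cancel]
    rw [hall_comm, pdn_comm]
    push_cast
    ring

theorem hall_Dd {M : ℕ} (f g : SymA) :
    hall (Dd M f) g = alpha ^ 3 * (∑ j ∈ Finset.range (M + 1), ∑ l ∈ Finset.range (M + 1),
      ((j : F) * l * (j + l : ℕ)) * hall (pdn l (pdn j f)) (pdn (j + l) g) +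
      ∑ j ∈ Finset.range (M + 1), ∑ l ∈ Finset.range j,
      ((j : F) * l * (j - l : ℕ)) * hall (pdn j f) (pdn (j - l) (pdn l g))) +
      alpha ^ 2 * (alpha - 1) * ∑ j ∈ Finset.range (M + 1), (j : F) ^ 3 * hall (pdn j f) (pdn j g) := by
  rw [Dd, hall_sum_left, ← Finset.sum_add_distrib, Finset.mul_sum, Finset.mul_sum, ← Finset.sum_add_distrib]
  refine Finset.sum_congr rfl fun j _ => ?_
  simp only [hall_smul_left, hall_add_left, hall_sum_left, hall_pn_mul, Finset.mul_sum, mul_add]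
  refine congrArg₂ (· + ·) (congrArg₂ (· + ·) ?_ ?_) (by ring)
  · exact Finset.sum_congr rfl fun l _ => by ring
  · exact Finset.sum_congr rfl fun l _ => by ring

theorem Dd_self {M : ℕ} {f g : SymA} (hf : LE M f) (hg : LE M g) : hall (Dd M f) g = hall f (Dd M g) := by
  rw [hall_comm f, hall_Dd, hall_Dd, hall_T hg, hall_T hf, add_comm (∑ j ∈ Finset.range (M + 1), _)]
  congr 2
  exact Finset.sum_congr rfl fun j _ => by rw [hall_comm]

theorem Hom_Dd (M : ℕ) {n : ℕ} {f : SymA} (hf : Hom n f) : Hom n (Dd M f) := by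
  refine Hom_sum _ _ fun j _ => Hom.smul ?_ _
  by_cases hj : j ≤ n
  · have hp : Hom (n - j) (pdn j f) := Hom_pdn hf (by omega)
    refine Hom.add (Hom.add (Hom.smul (Hom_sum _ _ fun l _ => Hom.smul ?_ _) _) (Hom_sum _ _ fun l hl => ?_))
      (Hom.smul (Hom_pn_mul hp (by omega)) _)
    · by_cases hl : l ≤ n - j
      · exact Hom_pn_mul (Hom_pdn hp (m := n - j - l) (by omega)) (by omega)
      · rw [LE_pdn_zero hp.LE (by omega), mul_zero]; exact Hom_zero n
    · have := Finset.mem_range.mp hl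
      exact Hom_pn_mul (Hom_pn_mul hp (n := n - l) (by omega)) (by omega)
  · have h0 : pdn j f = 0 := LE_pdn_zero hf.LE (by omega)
    simp only [h0, map_zero, mul_zero, smul_zero, Finset.sum_const_zero, add_zero]
    exact Hom_zero n

theorem Eu_add (M : ℕ) (f g : SymA) : Eu M (f + g) = Eu M f + Eu M g := by
  simp only [Eu, map_add, mul_add, smul_add, Finset.sum_add_distrib]

theorem Eu_smul (M : ℕ) (c : F) (f : SymA) : Eu M (c • f) = c • Eu M f := by
  simp only [Eu, map_smul, mul_smul_comm, smul_comm _ c, ← Finset.smul_sum]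

theorem pdn_pPow_cons (k : ℕ+) (j : ℕ) (f : SymA) :
    pdn j (X k * f) = X k * pdn j f + if j = k then f else 0 := by
  rcases nat_cases j with rfl | ⟨j, rfl⟩
  · rw [pdn_zero, pdn_zero, if_neg (by have := k.pos; omega)]; simp
  · rw [pdn_coe, pdn_coe, Derivation.leibniz, pderiv_X, smul_eq_mul, smul_eq_mul, Pi.single_apply]
    by_cases h : j = k
    · subst h; simp
    · rw [if_neg (fun e => h e.symm), if_neg (fun e => h (PNat.coe_injective e)), mul_zero]

theorem Eu_pPow {M : ℕ} (l : JPartition) (h : psize l ≤ M) : Eu M (pPow l) = (psize l : F) • pPow l := by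
  induction l using Multiset.induction_on with
  | empty =>
    rw [psize_zero, Nat.cast_zero, zero_smul, pPow_zero, Eu]
    refine Finset.sum_eq_zero fun j _ => ?_
    have : pdn j 1 = 0 := by
      rcases nat_cases j with rfl | ⟨j, rfl⟩
      · exact pdn_zero 1
      · rw [pdn_coe, pderiv_one]
    rw [this, mul_zero, smul_zero]
  | cons k l ih =>
    rw [psize_cons] at h ⊢
    have := ih (by omega)
    rw [pPow_cons]
    rw [Eu] at this ⊢
    simp only [pdn_pPow_cons, mul_add, smul_add, Finset.sum_add_distrib, mul_ite, mul_zero, smul_ite, smul_zero]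
    rw [Finset.sum_ite_eq' (Finset.range (M + 1)) (k : ℕ), if_pos (Finset.mem_range.mpr (by omega)), pn_coe]
    have e : ∑ j ∈ Finset.range (M + 1), (j : F) • (pn j * (X k * pdn j (pPow l))) =
        X k * ∑ j ∈ Finset.range (M + 1), (j : F) • (pn j * pdn j (pPow l)) := by
      rw [Finset.mul_sum]
      exact Finset.sum_congr rfl fun j _ => by rw [mul_smul_comm, mul_left_comm]
    rw [e, this, mul_smul_comm, ← add_smul, Nat.cast_add, add_comm]

theorem Eu_Hom {M n : ℕ} {f : SymA} (hf : Hom n f) (h : n ≤ M) : Eu M f = (n : F) • f := by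
  refine Hom_induction (p := fun f => Eu M f = (n : F) • f) ?_ ?_ ?_ ?_ hf
  · rintro l rfl; exact Eu_pPow l h
  · simp [Eu]
  · intro f g hf hg; rw [Eu_add, hf, hg, smul_add]
  · intro c f hf; rw [Eu_smul, hf, smul_comm]

theorem ph_Dd' {a g : F} (hag : Good a g) (N : ℕ) {n : ℕ} {f : SymA} (hf : Hom n f) :
    ph g N (Dd n f) = C g * ∑ i : Fin N, Lam a g i (Lam a g i (ph g N f)) - C (g * N * alpha * n) * ph g N f := by
  rw [ph_Dd hag N hf.LE, Eu_Hom hf le_rfl, ph_smul]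
  simp only [C_mul]; ring

end Jk

namespace Jk
open MvPolynomial Dk

theorem W_Dd {n N : ℕ} {f : SymA} (hf : Hom n f) {h : Fin N →₀ ℕ} (hW : ph 1 N f ∈ W F h) :
    ph 1 N (Dd n f) ∈ W F h := by
  rw [ph_Dd' good_one N hf]
  refine Submodule.sub_mem _ (C_mul_mem_W _ (Submodule.sum_mem _ fun i _ => ?_)) (C_mul_mem_W _ hW)
  exact W_Lam _ _ i (W_Lam _ _ i hW)

/-- eigenvalue -/
def ev (J : JPartition → SymA) (l : JPartition) : F := hall (J l) (Dd (psize l) (J l)) / hall (J l) (J l)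

theorem Dd_J {J : JPartition → SymA} (hJ : IsJackFamily J) (l : JPartition) :
    Dd (psize l) (J l) = ev J l • J l := by
  have key : ∀ l s, psize s = psize l → hall (J s) (Dd (psize l) (J l)) ≠ 0 → dominates s l := by
    intro l s _ h
    refine tri_W hJ (fun N hN => W_Dd (Hom_J hJ l) (J_mem_W hJ l ?_)) s h
    exact (plen_le_psize l).trans hN
  refine J_eig hJ (Hom_Dd _ (Hom_J hJ l)) fun s hs he => ?_
  by_contra h
  have h1 := key l s he h
  rw [← he, ← Dd_self (Hom_J hJ s).LE (he ▸ (Hom_J hJ l).LE), hall_comm] at h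
  have h2 := key s l he.symm h
  exact hs (dom_antisymm h1 h2)

theorem hall_J_Dd {J : JPartition → SymA} (hJ : IsJackFamily J) (l : JPartition) {f : SymA}
    (hf : Hom (psize l) f) : hall (J l) (Dd (psize l) f) = ev J l * hall (J l) f := by
  rw [← Dd_self (Hom_J hJ l).LE hf.LE, Dd_J hJ, hall_smul_left]

/-- integral polynomials -/
def Zm (N : ℕ) : AddSubgroup (MvPolynomial (Fin N) F) :=
  AddSubgroup.closure (Set.range fun k : Fin N →₀ ℕ => monomial k (1 : F))

theorem mono_Zm {N : ℕ} (k : Fin N →₀ ℕ) : monomial k (1 : F) ∈ Zm N := AddSubgroup.subset_closure ⟨k, rfl⟩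

theorem Zm_map {N : ℕ} (L : MvPolynomial (Fin N) F →+ MvPolynomial (Fin N) F)
    (hL : ∀ k, L (monomial k 1) ∈ Zm N) {f : MvPolynomial (Fin N) F} (hf : f ∈ Zm N) : L f ∈ Zm N := by
  have : Zm N ≤ (Zm N).comap L := by
    apply (AddSubgroup.closure_le _).mpr
    rintro _ ⟨k, rfl⟩
    exact hL k
  exact this hf

theorem Zm_coeff {N : ℕ} {f : MvPolynomial (Fin N) F} (hf : f ∈ Zm N) (e : Fin N →₀ ℕ) :
    ∃ z : ℤ, coeff e f = z := by
  induction hf using AddSubgroup.closure_induction with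
  | mem x hx =>
    obtain ⟨k, rfl⟩ := hx
    rw [coeff_monomial]
    by_cases h : k = e
    · exact ⟨1, by rw [if_pos h, Int.cast_one]⟩
    · exact ⟨0, by rw [if_neg h, Int.cast_zero]⟩
  | zero => exact ⟨0, by simp⟩
  | add x y _ _ hx hy =>
    obtain ⟨a, ha⟩ := hx
    obtain ⟨b, hb⟩ := hy
    exact ⟨a + b, by rw [coeff_add, ha, hb, Int.cast_add]⟩
  | neg x _ hx =>
    obtain ⟨a, ha⟩ := hx
    exact ⟨-a, by rw [coeff_neg, ha, Int.cast_neg]⟩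

theorem Lam_zero_eq {N : ℕ} (i : Fin N) (f : MvPolynomial (Fin N) F) :
    Lam 0 1 i f = ∑ j ∈ Finset.univ.erase i, X j * dd i j f := by
  rw [Lam_apply]; simp

theorem Lam_split {N : ℕ} (i : Fin N) (f : MvPolynomial (Fin N) F) :
    Lam alpha 1 i f = C alpha * (X i * pderiv i f) + Lam 0 1 i f := by
  rw [Lam_zero_eq, Lam_apply]; simp

theorem Zm_Lam0 {N : ℕ} (i : Fin N) {f : MvPolynomial (Fin N) F} (hf : f ∈ Zm N) : Lam 0 1 i f ∈ Zm N := by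
  refine Zm_map (Lam 0 1 i).toAddMonoidHom (fun k => ?_) hf
  show Lam 0 1 i (monomial k 1) ∈ Zm N
  rw [Lam_zero_eq]
  refine AddSubgroup.sum_mem _ fun j hj => ?_
  obtain ⟨e, p, ks, _, h⟩ := X_mul_dd (Finset.ne_of_mem_erase hj).symm k
  rw [h F, ← zsmul_eq_mul]
  exact AddSubgroup.zsmul_mem _ (AddSubgroup.sum_mem _ fun l _ => mono_Zm _) _

theorem Zm_Xd {N : ℕ} (i : Fin N) {f : MvPolynomial (Fin N) F} (hf : f ∈ Zm N) : X i * pderiv i f ∈ Zm N := by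
  refine Zm_map ((LinearMap.mulLeft F (X i)).comp (pderiv i : Derivation F _ _).toLinearMap).toAddMonoidHom
    (fun k => ?_) hf
  show X i * pderiv i (monomial k 1) ∈ Zm N
  rw [X_pderiv_monomial, map_natCast, ← nsmul_eq_mul]
  exact AddSubgroup.nsmul_mem _ (mono_Zm k) _

theorem coeff_Lam2 {N : ℕ} (i : Fin N) (k e : Fin N →₀ ℕ) : ∃ z w : ℤ,
    coeff e (Lam alpha 1 i (Lam alpha 1 i (monomial k 1))) =
      alpha ^ 2 * (if k = e then ((k i ^ 2 : ℕ) : F) else 0) + alpha * z + w := by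
  have h1 : Lam alpha 1 i (monomial k 1) = C (alpha * (k i : F)) * monomial k 1 + Lam 0 1 i (monomial k 1) := by
    rw [Lam_split, X_pderiv_monomial, C_mul, mul_assoc]
  have hr := Zm_Lam0 i (mono_Zm k)
  obtain ⟨z1, hz1⟩ := Zm_coeff (Zm_Lam0 i hr) e
  obtain ⟨z2, hz2⟩ := Zm_coeff (Zm_Xd i hr) e
  obtain ⟨z3, hz3⟩ := Zm_coeff hr e
  refine ⟨k i * z3 + z2, z1, ?_⟩
  rw [h1, map_add, Lam_C_mul, h1, Lam_split i (Lam 0 1 i _)]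
  simp only [coeff_add, coeff_C_mul, hz1, hz2, hz3, coeff_monomial]
  push_cast
  split_ifs <;> ring

theorem coeff_lin {N : ℕ} (L : MvPolynomial (Fin N) F →ₗ[F] MvPolynomial (Fin N) F)
    (f : MvPolynomial (Fin N) F) (e : Fin N →₀ ℕ) :
    coeff e (L f) = ∑ k ∈ f.support, coeff k f * coeff e (L (monomial k 1)) := by
  conv_lhs => rw [f.as_sum]
  rw [map_sum, coeff_sum]
  refine Finset.sum_congr rfl fun k _ => ?_
  rw [show monomial k (coeff k f) = coeff k f • monomial k (1 : F) by rw [smul_monomial, smul_eq_mul, mul_one],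
    map_smul, coeff_smul, smul_eq_mul]

theorem ev_form {J : JPartition → SymA} (hJ : IsJackFamily J) (l : JPartition) : ∃ z w : ℤ,
    ev J l = alpha ^ 2 * ((∑ i ∈ Finset.range (psize l), pt l i ^ 2 : ℕ) : F) + alpha * z + w := by
  set n := psize l with hn
  have hlen : plen l ≤ n := plen_le_psize l
  set e := xexp l n with he
  set p := ph 1 n (J l) with hp
  let Q : MvPolynomial (Fin n) F →ₗ[F] MvPolynomial (Fin n) F :=
    ∑ i, (Lam alpha 1 i).comp (Lam alpha 1 i)
  have hQ : ∀ f, Q f = ∑ i, Lam alpha 1 i (Lam alpha 1 i f) := fun f => by simp [Q]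
  have ha := (J_G hJ l).1
  have hc : ∀ k : Fin n →₀ ℕ, part k = l → coeff k p = hall (G l) (J l) := fun k hk => by rw [hp, coeff_ph, hk]
  have h1 : coeff e (Q p) = (ev J l + n * alpha * n) * hall (G l) (J l) := by
    have := ph_Dd' good_one n (Hom_J hJ l)
    rw [← hn] at this
    have h2 : Q p = C (ev J l + n * alpha * n) * p := by
      rw [hQ, hp]
      have h3 := congrArg (ph 1 n) (Dd_J hJ l)
      rw [← hn] at h3
      rw [this, ph_smul] at h3
      simp only [C_1, one_mul] at h3
      rw [sub_eq_iff_eq_add.mp h3, C_add]; ring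
    rw [h2, coeff_C_mul, hc e (part_xexp l hlen)]
  have hkey : ∀ k ∈ p.support, coeff k p * coeff e (Q (monomial k 1)) ≠ 0 → part k = l := by
    intro k hk h0
    have h2 : Dm k e := J_mem_W hJ l hlen k (mem_support_iff.mp hk)
    have h3 : Q (monomial k 1) ∈ W F k := by
      rw [hQ]
      exact Submodule.sum_mem _ fun i _ => W_Lam _ _ i (W_Lam _ _ i (monomial_mem_W (Dm.refl k) 1))
    have h4 : Dm e k := h3 e (right_ne_zero_of_mul h0)
    rw [Dm_iff, he, part_xexp l hlen] at h2 h4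
    exact dom_antisymm h2 h4
  have hq : ∀ k, ∃ z w : ℤ, coeff e (Q (monomial k 1)) =
      alpha ^ 2 * (if k = e then ((∑ i, k i ^ 2 : ℕ) : F) else 0) + alpha * z + w := by
    intro k
    choose z w hzw using fun i => coeff_Lam2 i k e
    refine ⟨∑ i, z i, ∑ i, w i, ?_⟩
    rw [hQ, coeff_sum]
    simp only [hzw, Finset.sum_add_distrib, ← Finset.mul_sum]
    push_cast
    congr 3
    split_ifs <;> simp
  choose z w hzw using hq
  rw [coeff_lin] at h1
  have h2 : ∑ k ∈ p.support, coeff k p * coeff e (Q (monomial k 1)) =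
      hall (G l) (J l) * ∑ k ∈ p.support.filter (fun k : Fin n →₀ ℕ => part k = l), coeff e (Q (monomial k 1)) := by
    rw [← Finset.sum_filter_of_ne hkey, Finset.mul_sum]
    exact Finset.sum_congr rfl fun k hk => by rw [hc k (Finset.mem_filter.mp hk).2]
  rw [h2, mul_comm] at h1
  have h3 := mul_right_cancel₀ ha h1
  have h4 : e ∈ p.support.filter (fun k : Fin n →₀ ℕ => part k = l) := by
    rw [Finset.mem_filter, mem_support_iff, hc e (part_xexp l hlen)]
    exact ⟨ha, part_xexp l hlen⟩
  simp only [hzw, Finset.sum_add_distrib, ← Finset.mul_sum] at h3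
  rw [Finset.sum_ite_eq' _ e, if_pos h4] at h3
  have h5 : ∑ i, e i ^ 2 = ∑ i ∈ Finset.range n, pt l i ^ 2 := by
    rw [Finset.sum_range]; rfl
  rw [h5] at h3
  refine ⟨∑ k ∈ p.support.filter (fun k : Fin n →₀ ℕ => part k = l), z k - n * n, ∑ k ∈ p.support.filter (fun k : Fin n →₀ ℕ => part k = l), w k, ?_⟩
  rw [eq_sub_of_add_eq h3.symm]
  push_cast
  ring

theorem alpha_indep (A z w : ℤ) (h : alpha ^ 2 * (A : F) + alpha * z + w = 0) : A = 0 := by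
  have h1 : algebraMap (Polynomial ℚ) F (Polynomial.X ^ 2 * (A : Polynomial ℚ) + Polynomial.X * (z : Polynomial ℚ) + (w : Polynomial ℚ)) = 0 := by
    simp only [map_add, map_mul, map_pow, map_intCast, RatFunc.algebraMap_X]
    exact h
  have h2 := (map_eq_zero_iff _ (RatFunc.algebraMap_injective ℚ)).mp h1
  have h3 := congrArg (fun q => Polynomial.coeff q 2) h2
  simp only [← Polynomial.C_eq_intCast, Polynomial.coeff_add, Polynomial.coeff_mul_C, Polynomial.coeff_X_pow,
    Polynomial.coeff_X, Polynomial.coeff_C, Polynomial.coeff_zero] at h3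
  norm_num at h3
  exact_mod_cast h3

theorem strict {J : JPartition → SymA} (hJ : IsJackFamily J) {l m : JPartition} (h : dominates l m)
    (he : ev J l = ev J m) : l = m := by
  obtain ⟨z, w, h1⟩ := ev_form hJ l
  obtain ⟨z', w', h2⟩ := ev_form hJ m
  have h3 := alpha_indep ((∑ i ∈ Finset.range (psize l), pt l i ^ 2 : ℕ) - (∑ i ∈ Finset.range (psize m), pt m i ^ 2 : ℕ))
    (z - z') (w - w') (by
      rw [h1, h2] at he
      push_cast at he ⊢
      linear_combination he)
  rw [h.1] at h3
  refine dom_strict h (N := psize m) (h.1 ▸ plen_le_psize l) (plen_le_psize m) ?_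
  exact_mod_cast sub_eq_zero.mp h3

theorem Dd_U (u : F) {n : ℕ} {f : SymA} (hf : Hom n f) : Dd n (U u f) = U u (Dd n f) := by
  apply eq_of_ph
  intro N
  rw [ph_Dd' good_one N (Hom_U u hf), ph_U, ph_U, ph_Dd' good_one N hf, map_sub, UN_C_mul, UN_C_mul, map_sum]
  simp only [UN_Lam]

/-- eigenvalue of `U` -/
def uv (J : JPartition → SymA) (u : F) (l : JPartition) : F := hall (J l) (U u (J l)) / hall (J l) (J l)

theorem U_J {J : JPartition → SymA} (hJ : IsJackFamily J) (u : F) (l : JPartition) :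
    U u (J l) = uv J u l • J l := by
  refine J_eig hJ (Hom_U u (Hom_J hJ l)) fun s hs he => ?_
  by_contra h
  have h1 : dominates s l := by
    refine tri_W hJ (fun N hN => ?_) s h
    rw [ph_U]
    exact W_UN _ _ _ (J_mem_W hJ l ((plen_le_psize l).trans hN))
  have h2 := hall_J_Dd hJ s (f := U u (J l)) (he ▸ Hom_U u (Hom_J hJ l))
  rw [he, Dd_U u (Hom_J hJ l), Dd_J hJ, map_smul, hall_smul_right] at h2
  exact hs (strict hJ h1 (mul_right_cancel₀ h h2).symm)

theorem hall_J_U {J : JPartition → SymA} (hJ : IsJackFamily J) (u : F) (l : JPartition) {g : SymA}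
    (hg : Hom (psize l) g) : hall (J l) (U u g) = uv J u l * hall (J l) g := by
  have hl : l ∈ P (psize l) := mem_P.mpr rfl
  conv_lhs => rw [J_expand hJ hg]
  rw [map_sum, hall_sum_right, Finset.sum_eq_single_of_mem l hl]
  · rw [map_smul, U_J hJ, hall_smul_right, hall_smul_right]
    field_simp [J_norm hJ l]
  · intro s _ hs
    rw [map_smul, U_J hJ, hall_smul_right, hall_smul_right, hJ.orthogonal l s hs.symm, mul_zero, mul_zero]

theorem U_self_Hom {J : JPartition → SymA} (hJ : IsJackFamily J) (u : F) {n : ℕ} {f g : SymA}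
    (hf : Hom n f) (hg : Hom n g) : hall (U u f) g = hall f (U u g) := by
  rw [J_expand hJ hf, map_sum, hall_sum_left, hall_sum_left]
  refine Finset.sum_congr rfl fun l hl => ?_
  have hn := mem_P.mp hl
  rw [map_smul, U_J hJ, hall_smul_left, hall_smul_left, hall_smul_left, hall_J_U hJ u l (hn ▸ hg)]

theorem U_self {J : JPartition → SymA} (hJ : IsJackFamily J) (u : F) (f g : SymA) :
    hall (U u f) g = hall f (U u g) := by
  induction f using span_pPow_induction with
  | hadd f f' hf hf' => rw [map_add, hall_add_left, hall_add_left, hf, hf']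
  | hs c f hf => rw [map_smul, hall_smul_left, hall_smul_left, hf]
  | h0 l =>
    induction g using span_pPow_induction with
    | hadd f f' hf hf' => rw [map_add, hall_add_right, hall_add_right, hf, hf']
    | hs c f hf => rw [map_smul, hall_smul_right, hall_smul_right, hf]
    | h0 m =>
      by_cases h : psize m = psize l
      · exact U_self_Hom hJ u (Hom_pPow l) (h ▸ Hom_pPow m)
      · rw [hall_Hom_ne (Hom_U u (Hom_pPow l)) (Hom_pPow m) (Ne.symm h),
          hall_Hom_ne (Hom_pPow l) (Hom_U u (Hom_pPow m)) (Ne.symm h)]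

end Jk

namespace Jk
open MvPolynomial Dk

/-- lowering derivation -/
def R (u : F) : Derivation F SymA SymA :=
  mkDerivation F fun k : ℕ+ => if k = 1 then C u else C ((k : ℕ) : F) * pn ((k : ℕ) - 1)

theorem R_X (u : F) (k : ℕ+) : R u (X k) = if k = 1 then C u else C ((k : ℕ) : F) * pn ((k : ℕ) - 1) :=
  mkDerivation_X _ _ _

/-- raising derivation -/
def BD : Derivation F SymA SymA := mkDerivation F fun k : ℕ+ => C ((k : ℕ) : F) * pn ((k : ℕ) + 1)

theorem BD_X (k : ℕ+) : BD (X k) = C ((k : ℕ) : F) * pn ((k : ℕ) + 1) := mkDerivation_X _ _ _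

theorem der_finsum (D : Derivation F SymA SymA) (f : SymA) : D f = ∑ᶠ j : ℕ+, pderiv j f * D (X j) := by
  have hfin : ∀ f : SymA, (Function.support fun j => pderiv j f * D (X j)).Finite := fun f =>
    (pd_finite f).subset fun j hj h0 => hj (by show _ * _ = _; rw [show pderiv j f = 0 from h0, zero_mul])
  induction f using MvPolynomial.induction_on with
  | C a => simp
  | add f g hf hg =>
    simp only [map_add, add_mul]
    rw [finsum_add_distrib (hfin f) (hfin g), hf, hg]
  | mul_X f k hf =>
    have e : ∀ j, pderiv j (f * X k) * D (X j) = X k * (pderiv j f * D (X j)) + (if j = k then f * D (X k) else 0) := by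
      intro j
      rw [Derivation.leibniz, pderiv_X, Pi.single_apply, smul_eq_mul, smul_eq_mul]
      by_cases h : j = k
      · subst h; simp; ring
      · rw [if_neg (fun h' => h h'.symm), if_neg h]; ring
    rw [finsum_congr e, finsum_add_distrib, ← mul_finsum, ← hf, Derivation.leibniz, finsum_eq_single _ k]
    · rw [if_pos rfl, smul_eq_mul, smul_eq_mul]; ring
    · intro j hj; rw [if_neg hj]
    · exact (hfin f).subset fun j hj h0 => hj (by
        show _ * _ = _
        rw [show pderiv j f * D (X j) = 0 from h0, mul_zero])
    · exact (Set.finite_singleton k).subset fun j hj => by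
        by_contra h; exact hj (if_neg h)

theorem der_sum (D : Derivation F SymA SymA) (f : SymA) (s : Finset ℕ+) (hs : ∀ j ∉ s, pderiv j f = 0) :
    D f = ∑ j ∈ s, pderiv j f * D (X j) := by
  rw [der_finsum, finsum_eq_sum_of_support_subset]
  intro j hj
  by_contra h
  exact hj (by show _ * _ = _; rw [hs j h, zero_mul])

theorem Bn_one (u : F) (f : SymA) : Bn 1 u f = BD f + (u / alpha) • (X 1 * f) := by
  rw [Bn_eq, pow_one, map_smul, PL, LinearMap.add_apply, LinearMap.smul_apply, YL_yf, GaL_yf]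
  simp only [Finset.range_zero, Finset.sum_empty, Nat.cast_zero, zero_smul, smul_zero, add_zero, map_smul, map_add,
    map_sum, zero_add]
  rw [TL_yf _ _ one_pos]
  rw [der_sum BD f f.vars (pd_vars f)]
  simp only [smul_add, smul_smul, inv_mul_cancel₀ alpha_ne, one_smul]
  refine congrArg₂ (· + ·) ?_ ?_
  · refine Finset.sum_congr rfl fun j _ => ?_
    rw [TL_yf _ _ (by omega), BD_X, smul_eq_C_mul, add_comm 1]; ring
  · rw [div_eq_mul_inv, mul_comm u]; rfl

theorem pd_BD (k : ℕ+) (f : SymA) : pderiv k (BD f) = BD (pderiv k f) + (((k : ℕ) - 1 : ℕ) : F) • pdn ((k : ℕ) - 1) f := by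
  rw [← sub_eq_iff_eq_add', ← Derivation.commutator_apply]
  by_cases hk : k = 1
  · subst hk
    have : ⁅(pderiv 1 : Derivation F SymA SymA), BD⁆ = 0 := by
      apply derivation_ext
      intro j
      rw [Derivation.commutator_apply, BD_X, pd_C_mul, pd_pn, if_neg, pderiv_X, Pi.single_apply]
      · split_ifs <;> simp
      · have := j.pos; simp only [PNat.one_coe]; omega
    rw [this]; simp
  · obtain ⟨k', hk'⟩ : ∃ k' : ℕ+, (k : ℕ) - 1 = k' := ⟨⟨(k : ℕ) - 1, by
      have := k.pos
      have : (k : ℕ) ≠ 1 := fun h => hk (PNat.coe_injective h)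
      omega⟩, rfl⟩
    have hkk : (k : ℕ) = k' + 1 := by have := k.pos; have := k'.pos; omega
    have : ⁅(pderiv k : Derivation F SymA SymA), BD⁆ = ((k' : ℕ) : F) • pderiv k' := by
      apply derivation_ext
      intro j
      rw [Derivation.commutator_apply, BD_X, pd_C_mul, pd_pn, pderiv_X, Derivation.smul_apply, pderiv_X,
        Pi.single_apply, Pi.single_apply]
      have e0 : BD (if j = k then (1 : SymA) else 0) = 0 := by split_ifs <;> simp
      rw [e0, sub_zero]
      by_cases h : j = k'
      · subst h; rw [if_pos hkk, if_pos rfl, smul_eq_C_mul]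
      · rw [if_neg h, if_neg (fun e => h (PNat.coe_injective (by omega))), mul_zero, smul_zero]
    rw [hk', this, pdn_coe]; rfl

theorem BnL_pd (k : ℕ+) (u : F) (g : SymA) : pderiv k (Bn 1 u g) = Bn 1 u (pderiv k g) +
    (if k = 1 then (u / alpha) • g else (((k : ℕ) - 1 : ℕ) : F) • pdn ((k : ℕ) - 1) g) := by
  rw [Bn_one, Bn_one, map_add, pd_BD, Derivation.map_smul, Derivation.leibniz, pderiv_X, Pi.single_apply]
  by_cases h : k = 1
  · subst h
    simp only [PNat.one_coe, Nat.sub_self, pdn_zero, smul_zero, add_zero, if_true, smul_eq_mul, mul_one, smul_add]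
    abel
  · rw [if_neg h, if_neg (fun e => h e.symm)]
    simp only [smul_eq_mul, mul_zero, add_zero]
    abel

theorem hall_R (u : F) (f g : SymA) : hall f (Bn 1 u g) = hall (R u f) g := by
  induction f using span_pPow_induction generalizing g with
  | hadd f f' hf hf' => rw [map_add, hall_add_left, hall_add_left, hf, hf']
  | hs c f hf => rw [Derivation.map_smul, hall_smul_left, hall_smul_left, hf]
  | h0 l =>
    induction l using Multiset.induction_on generalizing g with
    | empty =>
      rw [pPow_zero, Derivation.map_one_eq_zero, hall_zero_left]
      induction g using span_pPow_induction with
      | hadd f f' hf hf' => rw [← BnL_apply, map_add, hall_add_right, BnL_apply, BnL_apply, hf, hf', add_zero]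
      | hs c f hf => rw [← BnL_apply, map_smul, hall_smul_right, BnL_apply, hf, mul_zero]
      | h0 m => exact hall_Hom_ne Hom_one (Hom_Bn 1 u (Hom_pPow m)) (by omega)
    | cons k l ih =>
      rw [pPow_cons, hall_X_mul, BnL_pd, hall_add_right, ih, Derivation.leibniz, hall_add_left, smul_eq_mul,
        hall_X_mul, mul_add, R_X, smul_eq_mul]
      congr 1
      by_cases h : k = 1
      · subst h
        rw [if_pos rfl, if_pos rfl, hall_smul_right, mul_comm (pPow l), ← smul_eq_C_mul, hall_smul_left]
        simp only [PNat.one_coe, Nat.cast_one, mul_one]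
        rw [← mul_assoc, mul_div_cancel₀ _ alpha_ne]
      · have e : pPow l * (C ((k : ℕ) : F) * pn ((k : ℕ) - 1)) = ((k : ℕ) : F) • (pn ((k : ℕ) - 1) * pPow l) := by
          rw [smul_eq_C_mul]; ring
        rw [if_neg h, if_neg h, hall_smul_right, e, hall_smul_left, hall_pn_mul]
        ring

theorem pd_U {J : JPartition → SymA} (hJ : IsJackFamily J) (u : F) (f : SymA) :
    pderiv 1 (U u f) = U u (R u f) := by
  apply hall_ext
  intro g
  have h1 := hall_X_mul 1 g (U u f)
  simp only [PNat.one_coe, Nat.cast_one, mul_one] at h1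
  apply mul_left_cancel₀ alpha_ne
  rw [← h1, ← U_self hJ, U_X_mul, hall_smul_left, ← U_self hJ, PNat.one_coe, hall_comm, hall_R, hall_comm]

theorem Hom_R_pPow (u : F) (l : JPartition) :
    (∀ m, m + 1 = psize l → Hom m (R u (pPow l))) ∧ (psize l = 0 → R u (pPow l) = 0) := by
  induction l using Multiset.induction_on with
  | empty =>
    rw [pPow_zero, Derivation.map_one_eq_zero]
    exact ⟨fun m _ => Hom_zero m, fun _ => rfl⟩
  | cons k l h2 =>
    rw [psize_cons]
    have hk := k.pos
    refine ⟨fun m hl => ?_, fun h => by omega⟩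
    rw [pPow_cons, Derivation.leibniz, smul_eq_mul, smul_eq_mul]
    refine Hom.add ?_ ?_
    · rcases Nat.eq_zero_or_pos (psize l) with h0 | h0
      · rw [h2.2 h0, mul_zero]; exact Hom_zero m
      · have := (Hom_X k).mul (h2.1 (psize l - 1) (by omega))
        rwa [show (k : ℕ) + (psize l - 1) = m by omega] at this
    · rw [R_X]
      by_cases h : k = 1
      · subst h
        rw [if_pos rfl]
        have := (Hom_pPow l).mul (Hom_C u)
        rwa [show psize l + 0 = m by simp only [PNat.one_coe] at hl; omega] at this
      · have e : pPow l * (C ((k : ℕ) : F) * pn ((k : ℕ) - 1)) = ((k : ℕ) : F) • (pn ((k : ℕ) - 1) * pPow l) := by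
          rw [smul_eq_C_mul]; ring
        rw [if_neg h, e]
        exact (Hom_pn_mul (n := m) (k := (k : ℕ) - 1) (Hom_pPow l) (by omega)).smul _

theorem Hom_R (u : F) {n : ℕ} {f : SymA} (hf : Hom n f) :
    (∀ m, m + 1 = n → Hom m (R u f)) ∧ (n = 0 → R u f = 0) := by
  refine Hom_induction (p := fun f => (∀ m, m + 1 = n → Hom m (R u f)) ∧ (n = 0 → R u f = 0)) ?_ ?_ ?_ ?_ hf
  · intro l hl
    rw [← hl]
    exact Hom_R_pPow u l
  · rw [map_zero]; exact ⟨fun m _ => Hom_zero m, fun _ => rfl⟩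
  · intro f g hf hg
    rw [map_add]
    exact ⟨fun m hm => (hf.1 m hm).add (hg.1 m hm), fun h => by rw [hf.2 h, hg.2 h, add_zero]⟩
  · intro c f hf
    rw [Derivation.map_smul]
    exact ⟨fun m hm => (hf.1 m hm).smul c, fun h => by rw [hf.2 h, smul_zero]⟩

/-- divided power of a derivation -/
def dp (D : Derivation F SymA SymA) : ℕ → SymA →ₗ[F] SymA
  | 0 => LinearMap.id
  | n + 1 => ((n + 1 : ℕ) : F)⁻¹ • (D : SymA →ₗ[F] SymA).comp (dp D n)

theorem dp_zero (D : Derivation F SymA SymA) (f : SymA) : dp D 0 f = f := rfl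

theorem dp_succ' (D : Derivation F SymA SymA) (n : ℕ) (f : SymA) :
    dp D (n + 1) f = ((n + 1 : ℕ) : F)⁻¹ • D (dp D n f) := rfl

theorem dp_succ (D : Derivation F SymA SymA) (n : ℕ) (f : SymA) :
    ((n + 1 : ℕ) : F) • dp D (n + 1) f = D (dp D n f) := by
  rw [dp_succ', smul_inv_smul₀ (Nat.cast_ne_zero.mpr (Nat.succ_ne_zero n))]

theorem dp_pred (D : Derivation F SymA SymA) (n : ℕ) (f : SymA) :
    (n : F) • dp D n f = if n = 0 then 0 else D (dp D (n - 1) f) := by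
  cases n with
  | zero => simp
  | succ n => rw [dp_succ, if_neg (Nat.succ_ne_zero n)]; rfl

theorem dp_mul (D : Derivation F SymA SymA) (n : ℕ) (f g : SymA) :
    dp D n (f * g) = ∑ x ∈ Finset.HasAntidiagonal.antidiagonal n, dp D x.1 f * dp D x.2 g := by
  induction n with
  | zero => simp [dp_zero]
  | succ n ih =>
    have hn : ((n + 1 : ℕ) : F) ≠ 0 := Nat.cast_ne_zero.mpr (Nat.succ_ne_zero n)
    apply (smul_right_injective SymA hn)
    show ((n + 1 : ℕ) : F) • _ = ((n + 1 : ℕ) : F) • _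
    rw [dp_succ, ih, map_sum, Finset.smul_sum]
    have e : ∀ x ∈ Finset.HasAntidiagonal.antidiagonal (n + 1), ((n + 1 : ℕ) : F) • (dp D x.1 f * dp D x.2 g) =
        ((x.1 : F) • dp D x.1 f) * dp D x.2 g + dp D x.1 f * ((x.2 : F) • dp D x.2 g) := by
      intro x hx
      rw [← Finset.HasAntidiagonal.mem_antidiagonal.mp hx, Nat.cast_add, add_smul, smul_mul_assoc, mul_smul_comm]
    rw [Finset.sum_congr rfl e, Finset.sum_add_distrib, Finset.Nat.sum_antidiagonal_succ,
      Finset.Nat.sum_antidiagonal_succ' (f := fun x => dp D x.1 f * ((x.2 : F) • dp D x.2 g))]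
    simp only [Nat.cast_zero, zero_smul, zero_mul, mul_zero, zero_add, dp_succ, add_zero]
    rw [← Finset.sum_add_distrib]
    refine Finset.sum_congr rfl fun x _ => ?_
    rw [Derivation.leibniz, smul_eq_mul, smul_eq_mul]; ring

theorem Hom_dp (u : F) (i : ℕ) {n : ℕ} {f : SymA} (hf : Hom n f) :
    (∀ m, m + i = n → Hom m (dp (R u) i f)) ∧ (n < i → dp (R u) i f = 0) := by
  induction i with
  | zero => exact ⟨fun m hm => by rw [dp_zero, show m = n by omega]; exact hf, fun h => by omega⟩
  | succ i ih =>
    constructor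
    · intro m hm
      rw [dp_succ']
      exact ((Hom_R u (ih.1 (m + 1) (by omega))).1 m rfl).smul _
    · intro h
      rw [dp_succ']
      by_cases h2 : n < i
      · rw [ih.2 h2, map_zero, smul_zero]
      · rw [(Hom_R u (ih.1 0 (by omega))).2 rfl, smul_zero]

theorem dp_U {J : JPartition → SymA} (hJ : IsJackFamily J) (u : F) (i : ℕ) (f : SymA) :
    dp (pderiv 1) i (U u f) = U u (dp (R u) i f) := by
  induction i with
  | zero => rfl
  | succ i ih => rw [dp_succ', dp_succ', ih, pd_U hJ, map_smul]

theorem dp_X (u : F) (k : ℕ) (i : ℕ) (h : i < k) : dp (R u) i (pn k) = (Nat.choose k i : F) • pn (k - i) := by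
  induction i with
  | zero => rw [dp_zero]; simp
  | succ i ih =>
    obtain ⟨k', hk'⟩ : ∃ k' : ℕ+, k - i = k' := ⟨⟨k - i, by omega⟩, rfl⟩
    rw [dp_succ', ih (by omega), Derivation.map_smul, hk', pn_coe, R_X, if_neg (fun e => by
      rw [e] at hk'; simp only [PNat.one_coe] at hk'; omega), ← hk', ← smul_eq_C_mul, smul_smul, smul_smul,
      show k - i - 1 = k - (i + 1) by omega]
    congr 1
    have h0 : ((i + 1 : ℕ) : F) ≠ 0 := Nat.cast_ne_zero.mpr (Nat.succ_ne_zero i)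
    have := Nat.choose_succ_right_eq k i
    rw [mul_assoc, inv_mul_eq_iff_eq_mul₀ h0, mul_comm ((i + 1 : ℕ) : F)]
    exact_mod_cast this.symm

theorem dp_X_self (u : F) (k : ℕ+) : dp (R u) k (X k) = C u := by
  obtain ⟨i, hi⟩ : ∃ i, (k : ℕ) = i + 1 := ⟨(k : ℕ) - 1, by have := k.pos; omega⟩
  rw [← pn_coe, hi, dp_succ', dp_X u (i + 1) i (by omega), Derivation.map_smul, Nat.add_sub_cancel_left]
  have h1 : pn 1 = X 1 := pn_coe 1
  rw [h1, R_X, if_pos rfl, Nat.choose_succ_self_right,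
    inv_smul_smul₀ (Nat.cast_ne_zero.mpr (Nat.succ_ne_zero i))]

end Jk

namespace Jk
open MvPolynomial Dk

theorem dp_full_pPow (u : F) (l : JPartition) : dp (R u) (psize l) (pPow l) = C (u ^ Multiset.card l) := by
  induction l using Multiset.induction_on with
  | empty => rw [psize_zero, dp_zero, pPow_zero]; simp
  | cons k l ih =>
    rw [pPow_cons, psize_cons, dp_mul, Finset.sum_eq_single ((k : ℕ), psize l)]
    · show dp (R u) (k : ℕ) (X k) * dp (R u) (psize l) (pPow l) = _
      rw [dp_X_self, ih, Multiset.card_cons, pow_succ, mul_comm (u ^ _), C_mul]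
    · intro x hx hne
      have hx := Finset.HasAntidiagonal.mem_antidiagonal.mp hx
      by_cases h : (k : ℕ) < x.1
      · rw [(Hom_dp u x.1 (Hom_X k)).2 h, zero_mul]
      · rw [(Hom_dp u x.2 (Hom_pPow l)).2, mul_zero]
        by_contra h2
        exact hne (Prod.ext (by show x.1 = k; omega) (by show x.2 = psize l; omega))
    · intro h
      exact absurd (Finset.HasAntidiagonal.mem_antidiagonal.mpr (by rfl)) h

/-- principal specialization as a polynomial -/
def spec : SymA →ₐ[F] Polynomial F := aeval fun _ => Polynomial.X

theorem spec_pPow (l : JPartition) : spec (pPow l) = Polynomial.X ^ Multiset.card l := by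
  induction l using Multiset.induction_on with
  | empty => rw [pPow_zero]; simp
  | cons k l ih => rw [pPow_cons, map_mul, ih, Multiset.card_cons, pow_succ', spec, aeval_X]

theorem dp_full (u : F) {n : ℕ} {f : SymA} (hf : Hom n f) : dp (R u) n f = C ((spec f).eval u) := by
  refine Hom_induction (p := fun f => dp (R u) n f = C ((spec f).eval u)) ?_ ?_ ?_ ?_ hf
  · intro l hl
    rw [← hl, dp_full_pPow, spec_pPow]; simp
  · simp
  · intro f g hf hg
    rw [map_add, hf, hg]; simp
  · intro c f hf
    rw [map_smul, hf]; simp [smul_eq_C_mul]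

theorem card_le_psize (l : JPartition) : Multiset.card l ≤ psize l ∧
    (Multiset.card l = psize l → toExp l = Finsupp.single 1 (psize l)) := by
  induction l using Multiset.induction_on with
  | empty => rw [toExp_zero, psize_zero]; simp
  | cons k l ih =>
    rw [Multiset.card_cons, psize_cons]
    have := k.pos
    refine ⟨by omega, fun h => ?_⟩
    have hk : k = 1 := PNat.coe_injective (by show (k : ℕ) = 1; omega)
    subst hk
    rw [toExp_cons, ih.2 (by simp only [PNat.one_coe] at h; omega), ← Finsupp.single_add, PNat.one_coe]

theorem spec_coeff {n : ℕ} {f : SymA} (hf : Hom n f) :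
    (spec f).coeff n = coeff (Finsupp.single 1 n) f := by
  refine Hom_induction (p := fun f => (spec f).coeff n = coeff (Finsupp.single 1 n) f) ?_ ?_ ?_ ?_ hf
  · intro l hl
    rw [spec_pPow, Polynomial.coeff_X_pow, pPow_eq, coeff_monomial]
    have h := card_le_psize l
    refine if_congr ⟨fun h1 => ?_, fun h1 => ?_⟩ rfl rfl
    · rw [← hl] at h1 ⊢; exact h.2 h1.symm
    · have e : l = Multiset.replicate n 1 := by
        apply toExp_inj
        rw [h1, toExp_eq]
        ext i
        rw [Multiset.toFinsupp_apply, Multiset.count_replicate, Finsupp.single_apply]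
      rw [e, Multiset.card_replicate]
  · simp
  · intro f g hf hg
    rw [map_add, Polynomial.coeff_add, hf, hg, coeff_add]
  · intro c f hf
    rw [map_smul, Polynomial.coeff_smul, hf, coeff_smul]

theorem coeff_dp (i : ℕ) (f : SymA) (m : Exp) :
    coeff m (dp (pderiv 1) i f) = (Nat.choose (m 1 + i) i : F) * coeff (m + Finsupp.single 1 i) f := by
  induction i generalizing m with
  | zero => rw [dp_zero]; simp
  | succ i ih =>
    have h0 : ((i + 1 : ℕ) : F) ≠ 0 := Nat.cast_ne_zero.mpr (Nat.succ_ne_zero i)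
    rw [dp_succ', coeff_smul, coeff_pderiv', ih, smul_eq_mul, inv_mul_eq_iff_eq_mul₀ h0, add_assoc m,
      ← Finsupp.single_add, add_comm 1 i, ← mul_assoc, ← mul_assoc]
    congr 1
    rw [Finsupp.add_apply, Finsupp.single_eq_same]
    have e : (m 1 + 1) * Nat.choose (m 1 + 1 + i) i = (i + 1) * Nat.choose (m 1 + (i + 1)) (i + 1) := by
      have e1 := Nat.choose_succ_right_eq (m 1 + i + 1) i
      rw [show m 1 + 1 + i = m 1 + i + 1 by omega, show m 1 + (i + 1) = m 1 + i + 1 by omega]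
      rw [show m 1 + i + 1 - i = m 1 + 1 by omega] at e1
      linarith
    exact_mod_cast e

theorem coeff_dp_ne {i n : ℕ} {f : SymA} (hf : Hom n f) {m : Exp} (hm : coeff m (dp (pderiv 1) i f) ≠ 0) :
    wt m + i = n := by
  rw [coeff_dp] at hm
  have := hf (right_ne_zero_of_mul hm)
  rw [wt_eq, wt_add, wt_single] at this
  simpa using this

theorem dp_pd_full {n : ℕ} {f : SymA} (hf : Hom n f) :
    dp (pderiv 1) n f = C (coeff (Finsupp.single 1 n) f) := by
  have hH : Hom 0 (dp (pderiv 1) n f) := fun m hm => by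
    have := coeff_dp_ne hf hm
    rw [wt_eq]; omega
  rw [Hom_zero_iff hH, coeff_dp]; simp

theorem uv_eq {J : JPartition → SymA} (hJ : IsJackFamily J) (u : F) (l : JPartition) :
    uv J u l = (spec (J l)).eval u := by
  have h := dp_U hJ u (psize l) (J l)
  rw [U_J hJ, map_smul, dp_pd_full (Hom_J hJ l), hJ.normalized, dp_full u (Hom_J hJ l)] at h
  rw [show (C (Polynomial.eval u (spec (J l))) : SymA) = (Polynomial.eval u (spec (J l))) • 1 by
    rw [smul_eq_C_mul, mul_one], map_smul, U_one, C_1] at h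
  have := congrArg (coeff 0) h
  simpa using this

theorem spec_ne {J : JPartition → SymA} (hJ : IsJackFamily J) (l : JPartition) : spec (J l) ≠ 0 := by
  intro h
  have := spec_coeff (Hom_J hJ l)
  rw [h, hJ.normalized] at this
  simp at this

theorem uv_ne {J : JPartition → SymA} (hJ : IsJackFamily J) (l : JPartition) :
    ∃ N : ℕ, ∀ v : ℕ, N ≤ v → uv J (-(alpha * (v : F))) l ≠ 0 := by
  have hfin : {v : ℕ | (spec (J l)).IsRoot (-(alpha * (v : F)))}.Finite := by
    refine Set.Finite.preimage (f := fun v : ℕ => (-(alpha * (v : F)))) ?_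
      (Polynomial.finite_setOfPred_isRoot (spec_ne hJ l))
    intro a _ b _ h
    have := mul_left_cancel₀ alpha_ne (neg_injective h)
    exact_mod_cast this
  obtain ⟨N, hN⟩ := hfin.bddAbove
  refine ⟨N + 1, fun v hv h => ?_⟩
  rw [uv_eq hJ] at h
  have : v ≤ N := hN h
  omega

/-- signed gg -/
def hh (n : ℕ) : SymA := C ((-1) ^ n) * gg n

theorem hh_zero : hh 0 = 1 := by rw [hh, gg_zero]; simp

theorem Hom_hh (n : ℕ) : Hom n (hh n) := by
  have := (Hom_C ((-1) ^ n)).mul (Hom_gg n)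
  rwa [zero_add] at this

theorem hh_rec (n : ℕ) : C (n : F) * hh n =
    ∑ i ∈ Finset.range n, C ((-1) ^ (i + 1) * alpha⁻¹) * (pn (i + 1) * hh (n - (i + 1))) := by
  rw [hh, mul_left_comm, gg_rec, Finset.mul_sum]
  refine Finset.sum_congr rfl fun i hi => ?_
  have hi := Finset.mem_range.mp hi
  have e : (-1 : F) ^ n = (-1) ^ (i + 1) * (-1) ^ (n - (i + 1)) := by
    rw [← pow_add]; congr 1; omega
  rw [hh, e, C_mul, C_mul]; ring

theorem R_pn (u : F) (i : ℕ) : R u (pn (i + 1)) = if i = 0 then C u else C ((i + 1 : ℕ) : F) * pn i := by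
  obtain ⟨k, hk⟩ : ∃ k : ℕ+, i + 1 = k := ⟨⟨i + 1, by omega⟩, rfl⟩
  rw [hk, pn_coe, R_X]
  by_cases h : i = 0
  · rw [if_pos h, if_pos (PNat.coe_injective (by rw [← hk, h]; rfl))]
  · rw [if_neg h, if_neg (fun e => by rw [e] at hk; simp only [PNat.one_coe] at hk; omega), ← hk]; rfl

theorem R_hh (v : F) (n : ℕ) : R (-(alpha * v)) (hh (n + 1)) = C (v - n) * hh n := by
  induction n using Nat.strong_induction_on with
  | _ n ih =>
  have hn : (C ((n + 1 : ℕ) : F) : SymA) ≠ 0 := by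
    rw [Ne, C_eq_zero]; exact Nat.cast_ne_zero.mpr (Nat.succ_ne_zero n)
  apply mul_left_cancel₀ hn
  have h1 : C ((n + 1 : ℕ) : F) * R (-(alpha * v)) (hh (n + 1)) =
      R (-(alpha * v)) (C ((n + 1 : ℕ) : F) * hh (n + 1)) := by
    rw [← smul_eq_C_mul, ← smul_eq_C_mul, Derivation.map_smul]
  rw [h1, hh_rec, map_sum]
  have h2 : ∀ i ∈ Finset.range (n + 1), R (-(alpha * v)) (C ((-1) ^ (i + 1) * alpha⁻¹) *
      (pn (i + 1) * hh (n + 1 - (i + 1)))) = C ((-1) ^ (i + 1) * alpha⁻¹) * (R (-(alpha * v)) (pn (i + 1)) * hh (n - i)) +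
      C ((-1) ^ (i + 1) * alpha⁻¹) * (pn (i + 1) * R (-(alpha * v)) (hh (n - i))) := by
    intro i _
    rw [← smul_eq_C_mul, Derivation.map_smul, Derivation.leibniz, Nat.add_sub_add_right]
    simp only [smul_eq_mul, smul_eq_C_mul]; ring
  rw [Finset.sum_congr rfl h2, Finset.sum_add_distrib, Finset.sum_range_succ', Finset.sum_range_succ (n := n),
    Nat.sub_self, hh_zero, Derivation.map_one_eq_zero, mul_zero, mul_zero, add_zero, R_pn, if_pos rfl]
  have h3 : C ((n + 1 : ℕ) : F) * (C (v - n) * hh n) = C ((v - n - 1)) * (C (n : F) * hh n) + C v * hh n := by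
    rw [← mul_assoc, ← mul_assoc, ← C_mul, ← C_mul, ← add_mul, ← C_add]
    congr 2; push_cast; ring
  rw [h3, hh_rec n, Finset.mul_sum, add_right_comm, ← Finset.sum_add_distrib]
  refine congrArg₂ (· + ·) (Finset.sum_congr rfl fun i hi => ?_) ?_
  · have hi := Finset.mem_range.mp hi
    rw [R_pn, if_neg (Nat.succ_ne_zero i)]
    have h4 := ih (n - (i + 1)) (by omega)
    rw [show n - (i + 1) + 1 = n - i by omega] at h4
    rw [h4, show ((n - (i + 1) : ℕ) : F) = n - (i + 1) by rw [Nat.cast_sub (by omega)]; push_cast; ring]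
    simp only [C_mul, C_sub, C_add, C_pow, C_neg, map_natCast, Nat.cast_add, Nat.cast_one, C_1, pow_succ]
    ring
  · have e : C ((-1) ^ (0 + 1) * alpha⁻¹) * C (-(alpha * v)) = (C v : SymA) := by
      rw [← C_mul]; congr 1; field_simp [alpha_ne]; ring
    rw [← mul_assoc, e]; rfl

theorem dp_hh (v i : ℕ) (h : i ≤ v) : dp (R (-(alpha * (v : F)))) i (hh v) = hh (v - i) := by
  induction i with
  | zero => rfl
  | succ i ih =>
    have h0 : ((i + 1 : ℕ) : F) ≠ 0 := Nat.cast_ne_zero.mpr (Nat.succ_ne_zero i)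
    rw [dp_succ', ih (by omega), show v - i = v - (i + 1) + 1 by omega, R_hh, ← smul_eq_C_mul,
      Nat.cast_sub h, sub_sub_cancel, inv_smul_smul₀ h0]

end Jk

namespace Jk
open MvPolynomial Dk

theorem ph_hh (N n : ℕ) : ph (-alpha) N (hh n) = esymm (Fin N) F n := by
  induction n using Nat.strong_induction_on with
  | _ n ih =>
  rcases Nat.eq_zero_or_pos n with rfl | hn
  · rw [hh_zero, map_one, esymm_zero]
  have hn' : (C (n : F) : MvPolynomial (Fin N) F) ≠ 0 := by
    rw [Ne, C_eq_zero]; exact Nat.cast_ne_zero.mpr (by omega)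
  apply mul_left_cancel₀ hn'
  have h1 := congrArg (ph (-alpha) N) (hh_rec n)
  rw [map_mul, ph_C] at h1
  rw [h1, map_natCast, mul_esymm_eq_sum, map_sum, Finset.sum_filter, Finset.Nat.sum_antidiagonal_eq_sum_range_succ_mk,
    Finset.sum_range_succ, if_neg (by simp), add_zero, ← Finset.sum_range_reflect, Finset.mul_sum]
  refine Finset.sum_congr rfl fun i hi => ?_
  have hi := Finset.mem_range.mp hi
  obtain ⟨j, rfl, hj⟩ : ∃ j, i = n - 1 - j ∧ j < n := ⟨n - 1 - i, by omega, by omega⟩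
  rw [show n - 1 - (n - 1 - j) = j by omega]
  clear hi
  rename' j => i, hj => hi
  rw [if_pos (by show _ < _; omega), map_mul (ph (-alpha) N), map_mul (ph (-alpha) N), ph_C,
    ph_pn _ _ (Nat.succ_pos i), ih _ (by omega)]
  show _ = _ * ((-1) ^ (n - 1 - i) * esymm (Fin N) F (n - 1 - i) * MvPolynomial.psum (Fin N) F (n - (n - 1 - i)))
  rw [show n - (n - 1 - i) = i + 1 by omega, show n - (i + 1) = n - 1 - i by omega, MvPolynomial.psum,
    ← mul_assoc, ← mul_assoc, ← mul_assoc, ← C_mul, show (-1 : F) ^ (i + 1) * alpha⁻¹ * (-alpha) = (-1) ^ i by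
      rw [pow_succ]; field_simp [alpha_ne], ← mul_assoc, ← pow_add,
    show n + 1 + (n - 1 - i) = i + 2 * (n - i) by omega, pow_add, pow_mul, neg_one_sq, one_pow, mul_one,
    C_pow, C_neg, C_1]
  ring

theorem ph_gg_zero {N n : ℕ} (h : N < n) : ph (-alpha) N (gg n) = 0 := by
  have h1 := ph_hh N n
  rw [hh, map_mul, ph_C, esymm, Finset.powersetCard_eq_empty.mpr (by simpa using h), Finset.sum_empty] at h1
  refine (mul_eq_zero.mp h1).resolve_left ?_
  rw [C_eq_zero]; exact pow_ne_zero _ (by norm_num)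

theorem ph_hh_top (N : ℕ) : ph (-alpha) N (hh N) = ∏ i, X i := by
  rw [ph_hh, esymm]
  have : Finset.powersetCard N (Finset.univ : Finset (Fin N)) = {Finset.univ} := by
    have := Finset.powersetCard_self (Finset.univ : Finset (Fin N))
    rwa [Finset.card_univ, Fintype.card_fin] at this
  rw [this, Finset.sum_singleton]

theorem prodX_ne (N : ℕ) : (∏ i : Fin N, X i : MvPolynomial (Fin N) F) ≠ 0 :=
  Finset.prod_ne_zero_iff.mpr fun i _ => X_ne_zero i

theorem Lam_prodX (a g : F) {N : ℕ} (i : Fin N) (f : MvPolynomial (Fin N) F) :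
    Lam a g i ((∏ j, X j) * f) = (∏ j, X j) * (Lam a g i f + C a * f) := by
  have h1 : ∀ j, sw i j (∏ k : Fin N, (X k : MvPolynomial (Fin N) F)) = ∏ k, X k := by
    intro j
    rw [map_prod]
    simp only [rename_X]
    exact Equiv.prod_comp (Equiv.swap i j) (fun k => (X k : MvPolynomial (Fin N) F))
  have h2 : X i * pderiv i (∏ k : Fin N, (X k : MvPolynomial (Fin N) F)) = ∏ k, X k := by
    rw [← Finset.mul_prod_erase Finset.univ (fun k => (X k : MvPolynomial (Fin N) F)) (Finset.mem_univ i),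
      Derivation.leibniz, pderiv_X_self]
    have h3 : pderiv i (∏ k ∈ Finset.univ.erase i, (X k : MvPolynomial (Fin N) F)) = 0 := by
      apply Finset.prod_induction (fun k => (X k : MvPolynomial (Fin N) F)) (fun f => pderiv i f = 0)
      · intro a b ha hb
        rw [Derivation.leibniz, ha, hb, smul_zero, smul_zero, add_zero]
      · exact Derivation.map_one_eq_zero _
      · intro k hk
        rw [pderiv_X, Pi.single_apply, if_neg (Finset.mem_erase.mp hk).1]
    rw [h3]; simp
  rw [Lam_apply, Lam_apply, Derivation.leibniz]
  simp only [smul_eq_mul]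
  have h4 : ∀ j ∈ Finset.univ.erase i, X j * dd i j ((∏ k : Fin N, X k) * f) = (∏ k, X k) * (X j * dd i j f) := by
    intro j _
    rw [dd_inv_mul (h1 j)]; ring
  rw [Finset.sum_congr rfl h4, ← Finset.mul_sum]
  linear_combination (C a * f) * h2

theorem Lam_sum {a g : F} (hag : Good a g) (N : ℕ) {n : ℕ} {f : SymA} (hf : Hom n f) :
    C g * ∑ i : Fin N, Lam a g i (ph g N f) = C (alpha * n) * ph g N f := by
  have h1 : ∀ i : Fin N, Lam a g i (ph g N f) =
      C alpha * ∑ j ∈ Finset.range (n + 1), C (j : F) * (X i ^ j * ph g N (pdn j f)) := by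
    intro i
    have := laxn hag N i 0 hf.LE
    simpa using this
  simp only [h1]
  rw [← Finset.mul_sum, Finset.sum_comm, mul_left_comm, C_mul, mul_assoc]
  congr 1
  have h2 := congrArg (ph g N) (Eu_Hom hf le_rfl)
  rw [ph_smul] at h2
  rw [← h2, Eu, map_sum, Finset.mul_sum]
  refine Finset.sum_congr rfl fun j _ => ?_
  rw [← Finset.mul_sum, mul_left_comm, Finset.mul_sum, Jk.psum, ph_smul]
  by_cases h : j = 0
  · subst h; simp
  · rw [if_neg h, add_zero]

theorem sp_cons (v : ℕ+) (l : JPartition) (h : ∀ i ∈ l, i ≤ v) :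
    sortedParts (v ::ₘ l) = (v : ℕ) :: sortedParts l := by
  apply List.Perm.eq_of_pairwise (le := (· ≥ ·))
  · intro a b _ _ h1 h2
    exact le_antisymm h2 h1
  · exact sp_sorted _
  · rw [List.pairwise_cons]
    refine ⟨fun x hx => ?_, sp_sorted l⟩
    have : x ∈ (sortedParts l : Multiset ℕ) := hx
    rw [sp_coe, Multiset.mem_map] at this
    obtain ⟨i, hi, rfl⟩ := this
    exact h i hi
  · rw [← Multiset.coe_eq_coe, ← Multiset.cons_coe, sp_coe, sp_coe, Multiset.map_cons]

theorem topSum_cons (v : ℕ+) (l : JPartition) (h : ∀ i ∈ l, i ≤ v) (k : ℕ) :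
    topSum (v ::ₘ l) (k + 1) = v + topSum l k := by
  rw [topSum, sp_cons v l h, List.take_succ_cons, List.sum_cons, topSum]

theorem exists_top {r : JPartition} (h : r ≠ 0) : ∃ k r', r = k ::ₘ r' ∧ ∀ i ∈ r', i ≤ k := by
  obtain ⟨k, hk, hm⟩ := Finset.exists_max_image r.toFinset id (by
    obtain ⟨a, ha⟩ := Multiset.exists_mem_of_ne_zero h
    exact ⟨a, Multiset.mem_toFinset.mpr ha⟩)
  obtain ⟨r', rfl⟩ := Multiset.exists_cons_of_mem (Multiset.mem_toFinset.mp hk)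
  exact ⟨k, r', rfl, fun i hi => hm i (Multiset.mem_toFinset.mpr (Multiset.mem_cons_of_mem hi))⟩

theorem SpG_red (l : JPartition) (v : ℕ+) (hv : ∀ i ∈ l, i ≤ v) {g : SymA} (hg : g ∈ SpG (v ::ₘ l)) :
    ∃ g' ∈ SpG l, ph (-alpha) v g = ph (-alpha) v (gg v) * ph (-alpha) v g' := by
  refine Submodule.span_induction (p := fun g _ => ∃ g' ∈ SpG l,
    ph (-alpha) v g = ph (-alpha) v (gg v) * ph (-alpha) v g') ?_ ?_ ?_ ?_ hg
  · rintro _ ⟨r, hd, hne, rfl⟩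
    have hr : r ≠ 0 := by
      rintro rfl
      have := hd.1
      rw [psize_cons, psize_zero] at this
      have := v.pos
      omega
    obtain ⟨k, r', rfl, hk⟩ := exists_top hr
    have h1 := hd.2 1
    rw [topSum_cons v l hv 0, topSum_cons k r' hk 0] at h1
    have h1' : (v : ℕ) ≤ k := by simpa [topSum] using h1
    rcases h1'.eq_or_lt with h2 | h2
    · have h2 : v = k := PNat.coe_injective h2
      subst h2
      refine ⟨G r', G_mem_SpG ⟨?_, fun j => ?_⟩ (fun e => hne (by rw [e])), by rw [G_cons, map_mul]⟩
      · have := hd.1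
        rw [psize_cons, psize_cons] at this
        omega
      · have := hd.2 (j + 1)
        rw [topSum_cons v l hv, topSum_cons v r' hk] at this
        omega
    · exact ⟨0, Submodule.zero_mem _, by rw [G_cons, map_mul, ph_gg_zero h2]; simp⟩
  · exact ⟨0, Submodule.zero_mem _, by simp⟩
  · rintro f g _ _ ⟨f', h1, h2⟩ ⟨g', h3, h4⟩
    exact ⟨f' + g', Submodule.add_mem _ h1 h3, by rw [map_add, map_add, h2, h4]; ring⟩
  · rintro c f _ ⟨f', h1, h2⟩
    exact ⟨c • f', Submodule.smul_mem _ _ h1, by rw [ph_smul, ph_smul, h2]; ring⟩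

theorem hall_SpG {J : JPartition → SymA} (hJ : IsJackFamily J) {l s : JPartition} {g : SymA} (hg : g ∈ SpG l)
    (hs : s = l ∨ ¬ dominates l s) : hall (J s) g = 0 := by
  refine Submodule.span_induction (p := fun g _ => hall (J s) g = 0) ?_ ?_ ?_ ?_ hg
  · rintro _ ⟨r, hd, hne, rfl⟩
    rw [hall_comm]
    apply tri hJ
    intro h
    rcases hs with rfl | hs
    · exact hne (dom_antisymm h hd)
    · exact hs (dom_trans hd h)
  · exact hall_zero_right _
  · intro f g _ _ hf hg
    rw [hall_add_right, hf, hg, add_zero]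
  · intro c f _ hf
    rw [hall_smul_right, hf, mul_zero]

theorem Hom_SpG {l : JPartition} {g : SymA} (hg : g ∈ SpG l) : Hom (psize l) g := by
  refine Submodule.span_induction (p := fun g _ => Hom (psize l) g) ?_ ?_ ?_ ?_ hg
  · rintro _ ⟨r, hd, hne, rfl⟩
    rw [hd.1]; exact Hom_G r
  · exact Hom_zero _
  · intro f g _ _ hf hg
    exact hf.add hg
  · intro c f _ hf
    exact hf.smul c

theorem parts_le {l : JPartition} {v : ℕ+} (hv : psize l ≤ v) : ∀ i ∈ l, i ≤ v := by
  intro i hi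
  obtain ⟨l', rfl⟩ := Multiset.exists_cons_of_mem hi
  rw [psize_cons] at hv
  exact_mod_cast (show (i : ℕ) ≤ v by omega)

theorem row_ph {J : JPartition → SymA} (hJ : IsJackFamily J) (l : JPartition) (v : ℕ+) (hv : psize l ≤ v) :
    ∃ c : F, c ≠ 0 ∧ ph (-alpha) v (J (v ::ₘ l)) = ph (-alpha) v (c • (hh v * J l)) := by
  obtain ⟨-, c, hc, hJG⟩ := J_G hJ (v ::ₘ l)
  obtain ⟨g', hg', he⟩ := SpG_red l v (parts_le hv) hJG
  set A : SymA := c • G l + g' with hA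
  have hHA : Hom (psize l) A := ((Hom_G l).smul c).add (Hom_SpG hg')
  set s : F := (-1) ^ (v : ℕ) with hs
  have hs0 : s ≠ 0 := pow_ne_zero _ (by norm_num)
  have hss : s * s = 1 := by rw [hs, ← mul_pow]; norm_num
  have hgg : gg v = C s * hh v := by
    rw [hh, ← mul_assoc, ← C_mul, hss, C_1, one_mul]
  have e1 : ph (-alpha) v (J (v ::ₘ l)) = (∏ i, X i) * (C s * ph (-alpha) v A) := by
    rw [map_sub, sub_eq_iff_eq_add, ph_smul, G_cons, map_mul] at he
    rw [he, hA, map_add, ph_smul, hgg, map_mul, ph_C, ph_hh_top]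
    ring
  have hHs : Hom (psize l) (s • A) := hHA.smul s
  have e2 := ph_Dd' good_neg v (Hom_J hJ (v ::ₘ l))
  rw [Dd_J hJ, ph_smul, ← ph_smul, ph_smul, e1] at e2
  set Q := C s * ph (-alpha) v A with hQ
  have hQ' : Q = ph (-alpha) v (s • A) := by rw [ph_smul]
  simp only [Lam_prodX, map_add, Lam_C_mul] at e2
  have e3 := ph_Dd' good_neg v hHs
  rw [← hQ'] at e3
  have e4 := Lam_sum good_neg v hHs
  rw [← hQ'] at e4
  rw [← Finset.mul_sum, Finset.sum_congr rfl (fun i _ => show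
    Lam (-1 : F) (-alpha) i (Lam (-1) (-alpha) i Q) + C (-1) * Lam (-1) (-alpha) i Q +
      C (-1) * (Lam (-1) (-alpha) i Q + C (-1) * Q) =
    Lam (-1 : F) (-alpha) i (Lam (-1) (-alpha) i Q) + C (-2) * Lam (-1) (-alpha) i Q + Q by
      simp only [C_neg, C_1, show (2 : F) = 1 + 1 by norm_num, C_add]; ring)] at e2
  rw [Finset.sum_add_distrib, Finset.sum_add_distrib, ← Finset.mul_sum, Finset.sum_const, Finset.card_univ,
    Fintype.card_fin, nsmul_eq_mul] at e2
  have hP := prodX_ne (v : ℕ)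
  set κ : F := ev J (v ::ₘ l) + 2 * alpha * psize l + alpha * v + (-alpha * v * alpha * psize (v ::ₘ l)) -
    (-alpha * v * alpha * psize l) with hκ
  have e5 : ph (-alpha) v (Dd (psize l) (s • A)) = C κ * Q := by
    apply mul_left_cancel₀ hP
    rw [e3, hκ]
    simp only [C_add, C_sub, C_mul, C_neg, map_natCast, map_ofNat] at e2 e4 ⊢
    linear_combination (-1 : MvPolynomial (Fin v) F) * e2 + 2 * (∏ i, X i) * e4
  have e6 : Dd (psize l) (s • A) = κ • (s • A) := by
    apply ph_inj2 (neg_ne_zero.mpr alpha_ne) ((Hom_Dd _ hHs).LE.mono hv) ((hHs.smul κ).LE.mono hv)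
    rw [e5, ph_smul, hQ']
  have hn : hall (J l) (s • A) ≠ 0 := by
    rw [hall_smul_right, hA, hall_add_right, hall_smul_right, hall_SpG hJ hg' (Or.inl rfl), add_zero, hall_comm]
    exact mul_ne_zero hs0 (mul_ne_zero hc (J_G hJ l).1)
  have hev : ∀ r, psize r = psize l → hall (J r) (s • A) ≠ 0 → ev J r = κ := by
    intro r hr h
    have := hall_J_Dd hJ r (hr ▸ hHs)
    rw [hr, e6, hall_smul_right] at this
    exact (mul_right_cancel₀ h this).symm
  have e7 := J_eig hJ hHs (fun r hr hrs => by
    by_contra h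
    have h1 := (hev l rfl hn).trans (hev r hrs h).symm
    refine hr (strict hJ ?_ h1).symm
    by_contra h2
    apply h
    rw [hall_smul_right, hA, hall_add_right, hall_smul_right, hall_SpG hJ hg' (Or.inr h2), hall_comm, tri hJ h2]
    ring)
  refine ⟨_, div_ne_zero hn (J_norm hJ l), ?_⟩
  rw [e1, hQ', e7, ph_smul, ph_smul, map_mul, ph_hh_top]
  rw [← e7]
  ring

/-- sum of all partial derivatives -/
def Dv (N : ℕ) : Derivation F (MvPolynomial (Fin N) F) (MvPolynomial (Fin N) F) := ∑ i, pderiv i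

theorem Dv_apply {N : ℕ} (f : MvPolynomial (Fin N) F) : Dv N f = ∑ i, pderiv i f := by
  rw [Dv, ← Derivation.coeFnAddMonoidHom_apply, map_sum, Finset.sum_apply]
  rfl

theorem ph_R (N : ℕ) (f : SymA) : ph (-alpha) N (R (-(alpha * (N : F))) f) = Dv N (ph (-alpha) N f) := by
  induction f using MvPolynomial.induction_on with
  | C a => rw [ph_C]; simp [← algebraMap_eq]
  | add f g hf hg => rw [map_add, map_add, hf, hg, map_add, map_add]
  | mul_X f k hf =>
    rw [Derivation.leibniz, map_add, smul_eq_mul, smul_eq_mul, map_mul, map_mul, hf, map_mul, Derivation.leibniz,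
      smul_eq_mul, smul_eq_mul]
    refine congrArg₂ (fun a b => _ * a + _ * b) ?_ rfl
    rw [ph_X, Dv_apply]
    have h1 : ∀ i : Fin N, pderiv i (C (-alpha) * ∑ j : Fin N, (X j : MvPolynomial (Fin N) F) ^ (k : ℕ)) =
        C (-alpha) * (C ((k : ℕ) : F) * X i ^ ((k : ℕ) - 1)) := by
      intro i
      rw [← smul_eq_C_mul, Derivation.map_smul, map_sum, smul_eq_C_mul, Finset.sum_eq_single i]
      · rw [Derivation.leibniz_pow, pderiv_X_self, nsmul_eq_mul, smul_eq_mul, mul_one, map_natCast]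
      · intro j _ hj
        rw [Derivation.leibniz_pow, pderiv_X, Pi.single_apply, if_neg hj, smul_zero, smul_zero]
      · intro h; exact absurd (Finset.mem_univ i) h
    rw [Finset.sum_congr rfl fun i _ => h1 i, ← Finset.mul_sum, ← Finset.mul_sum, R_X]
    by_cases h : k = 1
    · subst h
      rw [if_pos rfl, ph_C]
      simp
    · have hk : 0 < (k : ℕ) - 1 := by
        have := k.pos
        have : (k : ℕ) ≠ 1 := fun e => h (PNat.coe_injective e)
        omega
      rw [if_neg h, map_mul, ph_C, ph_pn _ _ hk]
      ring

theorem ph_dp (N i : ℕ) {f g : SymA} (h : ph (-alpha) N f = ph (-alpha) N g) :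
    ph (-alpha) N (dp (R (-(alpha * (N : F)))) i f) = ph (-alpha) N (dp (R (-(alpha * (N : F)))) i g) := by
  induction i with
  | zero => exact h
  | succ i ih => rw [dp_succ', dp_succ', ph_smul, ph_smul, ph_R, ph_R, ih]

theorem row_dp {J : JPartition → SymA} (hJ : IsJackFamily J) (l : JPartition) (v : ℕ+) (hv : psize l ≤ v) :
    ∃ c : F, c ≠ 0 ∧ ∀ k b, k ≤ (v : ℕ) → k + b = psize l + v →
      dp (R (-(alpha * ((v : ℕ) : F)))) b (J (v ::ₘ l)) =
      c • ∑ x ∈ Finset.HasAntidiagonal.antidiagonal k, if x.2 ≤ psize l then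
        hh x.1 * dp (R (-(alpha * ((v : ℕ) : F)))) (psize l - x.2) (J l) else 0 := by
  obtain ⟨c, hc, h⟩ := row_ph hJ l v hv
  refine ⟨c, hc, fun k b hk hb => ?_⟩
  have h1 := ph_dp v b h
  have hH := (Hom_hh v).mul (Hom_J hJ l)
  have h2 : dp (R (-(alpha * ((v : ℕ) : F)))) b (J (v ::ₘ l)) =
      dp (R (-(alpha * ((v : ℕ) : F)))) b (c • (hh v * J l)) := by
    apply ph_inj2 (neg_ne_zero.mpr alpha_ne) _ _ h1
    · exact ((Hom_dp _ b (Hom_J hJ (v ::ₘ l))).1 k (by rw [psize_cons]; omega)).LE.mono hk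
    · exact ((Hom_dp _ b (hH.smul c)).1 k (by omega)).LE.mono hk
  rw [h2, map_smul, dp_mul]
  congr 1
  symm
  refine Finset.sum_bij_ne_zero (fun x _ _ => ((v : ℕ) - x.1, psize l - x.2)) ?_ ?_ ?_ ?_
  · intro x hx hne
    have hx := Finset.HasAntidiagonal.mem_antidiagonal.mp hx
    have hx2 : x.2 ≤ psize l := by
      by_contra h; exact hne (if_neg h)
    apply Finset.HasAntidiagonal.mem_antidiagonal.mpr
    show (v : ℕ) - x.1 + (psize l - x.2) = b
    omega
  · intro x hx hne y hy hny he
    have hx := Finset.HasAntidiagonal.mem_antidiagonal.mp hx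
    have hy := Finset.HasAntidiagonal.mem_antidiagonal.mp hy
    have h1 : (v : ℕ) - x.1 = v - y.1 := congrArg Prod.fst he
    exact Prod.ext (by omega) (by omega)
  · intro y hy hne
    have hy := Finset.HasAntidiagonal.mem_antidiagonal.mp hy
    have h1 : y.1 ≤ v := by
      by_contra h
      exact hne (by rw [(Hom_dp _ y.1 (Hom_hh v)).2 (by omega), zero_mul])
    have h2 : y.2 ≤ psize l := by
      by_contra h
      exact hne (by rw [(Hom_dp _ y.2 (Hom_J hJ l)).2 (by omega), mul_zero])
    refine ⟨((v : ℕ) - y.1, psize l - y.2), Finset.HasAntidiagonal.mem_antidiagonal.mpr (by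
      show (v : ℕ) - y.1 + (psize l - y.2) = k; omega), ?_, ?_⟩
    · show (if psize l - y.2 ≤ psize l then _ else _) ≠ 0
      rw [if_pos (Nat.sub_le _ _), Nat.sub_sub_self h2, ← dp_hh v y.1 h1]
      exact hne
    · exact Prod.ext (Nat.sub_sub_self h1) (Nat.sub_sub_self h2)
  · intro x hx hne
    have hx := Finset.HasAntidiagonal.mem_antidiagonal.mp hx
    have hx2 : x.2 ≤ psize l := by
      by_contra h; exact hne (if_neg h)
    rw [if_pos hx2]
    show _ = dp _ ((v : ℕ) - x.1) (hh v) * _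
    rw [dp_hh v _ (Nat.sub_le _ _), Nat.sub_sub_self (by omega)]

end Jk

namespace Jk
open MvPolynomial Dk

/-- lists of length k of positive integers with sum N -/
def Ls : ℕ → ℕ → Finset (List ℕ)
  | 0, N => if N = 0 then {[]} else ∅
  | k + 1, N => (Finset.HasAntidiagonal.antidiagonal N).biUnion fun x =>
      if x.1 = 0 then ∅ else (Ls k x.2).image (List.cons x.1)

theorem mem_Ls (k N : ℕ) (L : List ℕ) : L ∈ Ls k N ↔ L.length = k ∧ L.sum = N ∧ ∀ n ∈ L, 1 ≤ n := by
  induction k generalizing N L with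
  | zero =>
    rw [Ls, List.length_eq_zero_iff]
    constructor
    · intro h
      split_ifs at h with h0
      · rw [Finset.mem_singleton] at h; subst h; simp [h0]
      · simp at h
    · rintro ⟨rfl, h, -⟩
      simp at h; simp [← h]
  | succ k ih =>
    rw [Ls, Finset.mem_biUnion]
    constructor
    · rintro ⟨x, hx, h⟩
      have hx := Finset.HasAntidiagonal.mem_antidiagonal.mp hx
      split_ifs at h with h0
      · simp at h
      · obtain ⟨L', hL', rfl⟩ := Finset.mem_image.mp h
        obtain ⟨h1, h2, h3⟩ := (ih _ _).mp hL'
        refine ⟨by simp [h1], by simp [h2, hx], ?_⟩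
        intro n hn
        rcases List.mem_cons.mp hn with rfl | hn
        · omega
        · exact h3 n hn
    · rintro ⟨h1, h2, h3⟩
      cases L with
      | nil => simp at h1
      | cons a L =>
        have ha := h3 a List.mem_cons_self
        refine ⟨(a, L.sum), Finset.HasAntidiagonal.mem_antidiagonal.mpr (by simpa using h2), ?_⟩
        rw [if_neg (by show a ≠ 0; omega)]
        refine Finset.mem_image.mpr ⟨L, (ih _ _).mpr ⟨by simpa using h1, rfl, fun n hn => h3 n (List.mem_cons_of_mem _ hn)⟩, rfl⟩

theorem sum_Ls {M : Type} [AddCommMonoid M] (k N : ℕ) (Φ : List ℕ → M) :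
    ∑ L ∈ Ls (k + 1) N, Φ L = ∑ x ∈ Finset.HasAntidiagonal.antidiagonal N,
      if x.1 = 0 then 0 else ∑ L ∈ Ls k x.2, Φ (x.1 :: L) := by
  rw [Ls, Finset.sum_biUnion]
  · refine Finset.sum_congr rfl fun x _ => ?_
    split_ifs
    · rfl
    · rw [Finset.sum_image]
      intro a _ b _ h
      exact (List.cons.inj h).2
  · intro x hx y hy hne
    rw [Function.onFun, Finset.disjoint_left]
    intro L h1 h2
    have hx := Finset.HasAntidiagonal.mem_antidiagonal.mp hx
    have hy := Finset.HasAntidiagonal.mem_antidiagonal.mp hy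
    split_ifs at h1 h2 with h3 h4
    · simp at h1
    · simp at h1
    · simp at h2
    · obtain ⟨L1, -, rfl⟩ := Finset.mem_image.mp h1
      obtain ⟨L2, -, h5⟩ := Finset.mem_image.mp h2
      have := (List.cons.inj h5).1
      exact hne (Prod.ext (by omega) (by omega))

/-- compositions of N -/
def Cs (N : ℕ) : Finset (List ℕ) := (Finset.range (N + 1)).biUnion fun k => Ls k N

theorem len_le_sum (L : List ℕ) (h : ∀ n ∈ L, 1 ≤ n) : L.length ≤ L.sum := by
  induction L with
  | nil => simp
  | cons a L ih =>
    have h1 := h a List.mem_cons_self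
    have h2 := ih fun n hn => h n (List.mem_cons_of_mem _ hn)
    simp; omega

theorem mem_Cs (N : ℕ) (L : List ℕ) : L ∈ Cs N ↔ L.sum = N ∧ ∀ n ∈ L, 1 ≤ n := by
  rw [Cs, Finset.mem_biUnion]
  constructor
  · rintro ⟨k, -, h⟩; exact ((mem_Ls _ _ _).mp h).2
  · intro h
    refine ⟨L.length, Finset.mem_range.mpr ?_, (mem_Ls _ _ _).mpr ⟨rfl, h⟩⟩
    have := len_le_sum L h.2
    omega

theorem finsum_Cs {M : Type} [AddCommMonoid M] (N : ℕ) (Φ : List ℕ → M) :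
    (∑ᶠ L : List ℕ, if L.sum = N ∧ ∀ n ∈ L, 1 ≤ n then Φ L else 0) = ∑ L ∈ Cs N, Φ L := by
  rw [finsum_eq_sum_of_support_subset (s := Cs N)]
  · refine Finset.sum_congr rfl fun L hL => ?_
    rw [if_pos ((mem_Cs N L).mp hL)]
  · intro L hL
    by_contra h
    exact hL (if_neg (fun h' => h ((mem_Cs N L).mpr h')))

theorem sum_Cs {M : Type} [AddCommMonoid M] (N : ℕ) (Φ : List ℕ → M) :
    ∑ L ∈ Cs N, Φ L = ∑ k ∈ Finset.range (N + 1), ∑ L ∈ Ls k N, Φ L := by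
  rw [Cs, Finset.sum_biUnion]
  intro x _ y _ hne
  rw [Function.onFun, Finset.disjoint_left]
  intro L h1 h2
  exact hne (((mem_Ls _ _ _).mp h1).1.symm.trans ((mem_Ls _ _ _).mp h2).1)

/-- the weight of a list -/
def lw (L : List ℕ) : F := (L.map fun n : ℕ => (-1 : F) ^ n / (n : F)).prod / (Nat.factorial L.length : F)

theorem expB_eq (c : F) (N : ℕ) (f : SymA) : expBcoef c N f = ∑ L ∈ Cs N, lw L • BnList c L f :=
  finsum_Cs N (fun L => lw L • BnList c L f)

theorem expBperp_eq (c : F) (N : ℕ) (f : SymA) : expBperpCoef c N f = ∑ L ∈ Cs N, lw L • BnPerpList c L f :=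
  finsum_Cs N (fun L => lw L • BnPerpList c L f)

/-- terms of the log series -/
def ac (n : ℕ) : SymA := C ((-1) ^ n / (n : F)) * (C alpha⁻¹ * pn n)

theorem ac_zero : ac 0 = 0 := by rw [ac, pn_zero]; simp

/-- the log series -/
def As : PowerSeries SymA := PowerSeries.mk ac

theorem coeff_As_pow (k N : ℕ) : PowerSeries.coeff N (As ^ k) = ∑ L ∈ Ls k N, (L.map ac).prod := by
  induction k generalizing N with
  | zero =>
    rw [pow_zero, PowerSeries.coeff_one, Ls]
    split_ifs <;> simp
  | succ k ih =>
    rw [sum_Ls, pow_succ', PowerSeries.coeff_mul]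
    refine Finset.sum_congr rfl fun x _ => ?_
    rw [ih, As, PowerSeries.coeff_mk]
    split_ifs with h
    · rw [h, ac_zero, zero_mul]
    · rw [Finset.mul_sum]; simp

theorem As_pow_zero {k N : ℕ} (h : N < k) : PowerSeries.coeff N (As ^ k) = 0 := by
  rw [coeff_As_pow]
  apply Finset.sum_eq_zero
  intro L hL
  obtain ⟨h1, h2, h3⟩ := (mem_Ls _ _ _).mp hL
  have := len_le_sum L h3
  omega

theorem ps_rec {A : Type*} [CommRing A] (g : PowerSeries A) (k N : ℕ) :
    ((N + 1 : ℕ) : A) * PowerSeries.coeff (N + 1) (g ^ (k + 1)) =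
    ((k + 1 : ℕ) : A) * ∑ x ∈ Finset.HasAntidiagonal.antidiagonal N,
      PowerSeries.coeff x.1 (g ^ k) * (((x.2 + 1 : ℕ) : A) * PowerSeries.coeff (x.2 + 1) g) := by
  have h := congrArg (PowerSeries.coeff N) (PowerSeries.derivative_pow g (k + 1))
  rw [PowerSeries.coeff_derivative, Nat.add_sub_cancel, mul_assoc, ← nsmul_eq_mul, map_nsmul,
    PowerSeries.coeff_mul, nsmul_eq_mul] at h
  rw [mul_comm, Nat.cast_add_one, h]
  congr 1
  refine Finset.sum_congr rfl fun x _ => ?_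
  rw [PowerSeries.coeff_derivative]
  push_cast; ring

theorem As_rec (k N : ℕ) : C ((N + 1 : ℕ) : F) * PowerSeries.coeff (N + 1) (As ^ (k + 1)) =
    C ((k + 1 : ℕ) : F) * ∑ x ∈ Finset.HasAntidiagonal.antidiagonal N,
      PowerSeries.coeff x.1 (As ^ k) * (C ((x.2 + 1 : ℕ) : F) * ac (x.2 + 1)) := by
  have hc : ∀ n : ℕ, (C (n : F) : SymA) = (n : SymA) := fun n => map_natCast _ n
  have hA : ∀ n : ℕ, ac n = PowerSeries.coeff n As := fun n => (PowerSeries.coeff_mk n ac).symm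
  simp only [hc, hA]
  exact ps_rec As k N

/-- exponential coefficient -/
def He (N : ℕ) : SymA := ∑ k ∈ Finset.range (N + 1), C (Nat.factorial k : F)⁻¹ * PowerSeries.coeff N (As ^ k)

theorem He_ext {M N : ℕ} (h : N ≤ M) :
    ∑ k ∈ Finset.range (M + 1), C (Nat.factorial k : F)⁻¹ * PowerSeries.coeff N (As ^ k) = He N := by
  rw [He]
  symm
  apply Finset.sum_subset
  · intro x hx; rw [Finset.mem_range] at hx ⊢; omega
  · intro x _ hx
    rw [As_pow_zero (by rw [Finset.mem_range] at hx; omega), mul_zero]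

theorem He_rec (N : ℕ) : C ((N + 1 : ℕ) : F) * He (N + 1) =
    ∑ x ∈ Finset.HasAntidiagonal.antidiagonal N, He x.1 * (C ((x.2 + 1 : ℕ) : F) * ac (x.2 + 1)) := by
  rw [He, Finset.sum_range_succ', pow_zero, PowerSeries.coeff_one, if_neg (Nat.succ_ne_zero N), mul_zero, add_zero,
    Finset.mul_sum]
  have h1 : ∀ k ∈ Finset.range (N + 1), C ((N + 1 : ℕ) : F) * (C (Nat.factorial (k + 1) : F)⁻¹ *
      PowerSeries.coeff (N + 1) (As ^ (k + 1))) = ∑ x ∈ Finset.HasAntidiagonal.antidiagonal N,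
      (C (Nat.factorial k : F)⁻¹ * PowerSeries.coeff x.1 (As ^ k)) * (C ((x.2 + 1 : ℕ) : F) * ac (x.2 + 1)) := by
    intro k _
    have hk : ((k + 1 : ℕ) : F) ≠ 0 := Nat.cast_ne_zero.mpr (Nat.succ_ne_zero k)
    rw [mul_left_comm, As_rec, ← mul_assoc, ← C_mul, Nat.factorial_succ, Nat.cast_mul, mul_inv, mul_right_comm,
      inv_mul_cancel₀ hk, one_mul, Finset.mul_sum]
    refine Finset.sum_congr rfl fun x _ => ?_
    rw [mul_assoc]
  rw [Finset.sum_congr rfl h1, Finset.sum_comm]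
  refine Finset.sum_congr rfl fun x hx => ?_
  have hx := Finset.HasAntidiagonal.mem_antidiagonal.mp hx
  rw [← Finset.sum_mul, He_ext (by omega)]

theorem He_eq (N : ℕ) : He N = hh N := by
  induction N using Nat.strong_induction_on with
  | _ N ih =>
  cases N with
  | zero => rw [hh_zero, He]; simp
  | succ N =>
    have hn : (C ((N + 1 : ℕ) : F) : SymA) ≠ 0 := by
      rw [Ne, C_eq_zero]; exact Nat.cast_ne_zero.mpr (Nat.succ_ne_zero N)
    apply mul_left_cancel₀ hn
    rw [He_rec, hh_rec, ← Finset.Nat.sum_antidiagonal_swap, Finset.Nat.sum_antidiagonal_eq_sum_range_succ_mk]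
    refine Finset.sum_congr rfl fun i hi => ?_
    have hi := Finset.mem_range.mp hi
    have h0 : ((i + 1 : ℕ) : F) ≠ 0 := Nat.cast_ne_zero.mpr (Nat.succ_ne_zero i)
    show He (N - i) * (C ((i + 1 : ℕ) : F) * ac (i + 1)) = _
    rw [ih _ (by omega), ac, ← mul_assoc (C ((i + 1 : ℕ) : F)), ← C_mul, mul_div_cancel₀ _ h0, C_mul,
      Nat.add_sub_add_right]
    ring

theorem BnList_U (c : F) (L : List ℕ) (hL : ∀ n ∈ L, 1 ≤ n) (f : SymA) :
    BnList c L (U c f) = U c ((L.map fun n => C alpha⁻¹ * pn n).prod * f) := by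
  induction L with
  | nil => simp [BnList]
  | cons n L ih =>
    rw [BnList, ih fun m hm => hL m (List.mem_cons_of_mem _ hm), List.map_cons, List.prod_cons]
    obtain ⟨k, rfl⟩ : ∃ k : ℕ+, n = k := ⟨⟨n, hL n List.mem_cons_self⟩, rfl⟩
    rw [pn_coe, mul_assoc, mul_assoc, ← smul_eq_C_mul, map_smul, U_X_mul, inv_smul_smul₀ alpha_ne]

theorem ac_prod (L : List ℕ) : (L.map ac).prod =
    (L.map fun n : ℕ => (-1 : F) ^ n / (n : F)).prod • (L.map fun n => C alpha⁻¹ * pn n).prod := by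
  induction L with
  | nil => simp
  | cons n L ih =>
    simp only [List.map_cons, List.prod_cons]
    rw [ih, ac]; simp only [smul_eq_C_mul, C_mul]; ring

theorem exp_U (c : F) (N : ℕ) (f : SymA) : expBcoef c N (U c f) = U c (hh N * f) := by
  rw [expB_eq, ← He_eq, He, Finset.sum_mul, map_sum, sum_Cs]
  refine Finset.sum_congr rfl fun k _ => ?_
  rw [coeff_As_pow, Finset.mul_sum, Finset.sum_mul, map_sum]
  refine Finset.sum_congr rfl fun L hL => ?_
  obtain ⟨h1, h2, h3⟩ := (mem_Ls _ _ _).mp hL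
  rw [BnList_U c L h3, ← map_smul, ac_prod, lw, h1]
  congr 1
  rw [div_eq_inv_mul]
  simp only [smul_eq_C_mul, C_mul]; ring

end Jk

namespace Jk
open MvPolynomial Dk

theorem wt_finite (k : ℕ) : {m : Exp | wt m = k}.Finite := by
  refine ((P_finite k).image toExp).subset ?_
  intro m hm
  obtain ⟨l, rfl⟩ := toExp_surj m
  exact ⟨l, (wt_toExp l).symm.trans hm, rfl⟩

theorem Bmat_ne {n l : ℕ} {m' m : Exp} (h : Bmat n l m' m ≠ 0) : wt m + n = wt m' := by
  obtain ⟨p, rfl⟩ := toExp_surj m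
  rw [Bmat, ← pPow_eq] at h
  have := Hom_Bc n l (Hom_pPow p) h
  rw [wt_eq] at this
  rw [wt_toExp, this]

theorem Bperp_inner (n l : ℕ) (m' m : Exp) :
    coeff m (∑ᶠ e : Exp, (Bmat n l m' e * zalpha m' / zalpha e) • (monomial e (1 : F))) =
      Bmat n l m' m * zalpha m' / zalpha m := by
  have hfin : (Function.support fun e : Exp =>
      (Bmat n l m' e * zalpha m' / zalpha e) • (monomial e (1 : F))).Finite := by
    refine (wt_finite (wt m' - n)).subset ?_
    intro e he
    rw [Function.mem_support] at he
    have : Bmat n l m' e ≠ 0 := by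
      intro h; apply he; rw [h, zero_mul, zero_div, zero_smul]
    have := Bmat_ne this
    show wt e = _
    omega
  have h1 := (lcoeff F m).toAddMonoidHom.map_finsum hfin
  refine h1.trans ?_
  rw [finsum_eq_single _ m]
  · show coeff m ((Bmat n l m' m * zalpha m' / zalpha m) • (monomial m (1 : F))) = _
    rw [coeff_smul, coeff_monomial, if_pos rfl, smul_eq_mul, mul_one]
  · intro e he
    show coeff m ((Bmat n l m' e * zalpha m' / zalpha e) • (monomial e (1 : F))) = _
    rw [coeff_smul, coeff_monomial, if_neg he, smul_zero]

theorem coeff_Bperp (n l : ℕ) (f : SymA) (p : JPartition) :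
    hall (Bperp n l f) (pPow p) = hall f (Bc n l (pPow p)) := by
  rw [hall_comm, hall_pPow, Bperp, coeff_sum, Finset.sum_mul, hall]
  refine Finset.sum_congr rfl fun m' _ => ?_
  rw [coeff_smul, Bperp_inner, Bmat, ← pPow_eq, smul_eq_mul, mul_assoc, div_mul_cancel₀ _ (zalpha_ne _), mul_assoc]

theorem hall_BnPerp (n : ℕ) (c : F) (f g : SymA) : hall (BnPerp n c f) g = hall f (BnL n c g) := by
  induction g using span_pPow_induction with
  | h0 l =>
    rw [BnL_apply, Bn, BnPerp, hall_sum_left, hall_sum_right]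
    refine Finset.sum_congr rfl fun i _ => ?_
    rw [hall_smul_left, hall_smul_right, coeff_Bperp]
  | hadd g g' hg hg' => rw [map_add, hall_add_right, hall_add_right, hg, hg']
  | hs d g hg => rw [map_smul, hall_smul_right, hall_smul_right, hg]

/-- linear version -/
def BnLL (c : F) : List ℕ → SymA →ₗ[F] SymA
  | [] => LinearMap.id
  | n :: L => BnL n c ∘ₗ BnLL c L

theorem BnLL_apply (c : F) (L : List ℕ) (f : SymA) : BnLL c L f = BnList c L f := by
  induction L with
  | nil => rfl
  | cons n L ih => rw [BnList, ← ih, ← BnL_apply]; rfl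

theorem BnLL_append (c : F) (L M : List ℕ) (f : SymA) : BnLL c (L ++ M) f = BnLL c L (BnLL c M f) := by
  induction L with
  | nil => rfl
  | cons n L ih => rw [List.cons_append, BnLL, LinearMap.comp_apply, ih]; rfl

theorem hall_BnPerpList (c : F) (L : List ℕ) (f g : SymA) :
    hall (BnPerpList c L f) g = hall f (BnLL c L.reverse g) := by
  induction L generalizing g with
  | nil => rfl
  | cons n L ih =>
    rw [BnPerpList, hall_BnPerp, ih, List.reverse_cons, BnLL_append]; rfl

/-- linear version -/
def expL (c : F) (N : ℕ) : SymA →ₗ[F] SymA := ∑ L ∈ Cs N, lw L • BnLL c L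

theorem expL_apply (c : F) (N : ℕ) (f : SymA) : expL c N f = expBcoef c N f := by
  rw [expB_eq, expL, LinearMap.sum_apply]
  refine Finset.sum_congr rfl fun L _ => ?_
  rw [LinearMap.smul_apply, BnLL_apply]

theorem lw_reverse (L : List ℕ) : lw L.reverse = lw L := by
  rw [lw, lw, List.map_reverse, List.prod_reverse, List.length_reverse]

theorem hall_exp (c : F) (N : ℕ) (f g : SymA) : hall (expBperpCoef c N f) g = hall f (expL c N g) := by
  rw [expBperp_eq, expL, LinearMap.sum_apply, hall_sum_left, hall_sum_right]
  refine Finset.sum_nbij' List.reverse List.reverse ?_ ?_ ?_ ?_ ?_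
  · intro L hL
    rw [mem_Cs] at hL ⊢
    exact ⟨by rw [List.sum_reverse]; exact hL.1, fun n hn => hL.2 n (List.mem_reverse.mp hn)⟩
  · intro L hL
    rw [mem_Cs] at hL ⊢
    exact ⟨by rw [List.sum_reverse]; exact hL.1, fun n hn => hL.2 n (List.mem_reverse.mp hn)⟩
  · intro L _; exact List.reverse_reverse L
  · intro L _; exact List.reverse_reverse L
  · intro L _
    rw [LinearMap.smul_apply, hall_smul_left, hall_smul_right, lw_reverse, hall_BnPerpList]

theorem coeff_expPerp (c : F) (N : ℕ) (mu nu : JPartition) :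
    coeff (toExp nu) (expBperpCoef c N (pPow mu)) =
      zalpha (toExp mu) / zalpha (toExp nu) * coeff (toExp mu) (expL c N (pPow nu)) := by
  have h := hall_exp c N (pPow mu) (pPow nu)
  rw [hall_comm, hall_pPow, hall_pPow] at h
  field_simp [zalpha_ne]
  rw [h]; ring

/-- polynomial families -/
def PF : Submodule F (F → SymA) := Submodule.span F {h | ∃ (i : ℕ) (g : SymA), h = fun c => c ^ i • g}

theorem PF_BnL (n : ℕ) {h : F → SymA} (hh : h ∈ PF) : (fun c => BnL n c (h c)) ∈ PF := by
  induction hh using Submodule.span_induction with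
  | mem h hh =>
    obtain ⟨i, g, rfl⟩ := hh
    have : (fun c => BnL n c (c ^ i • g)) = ∑ l ∈ Finset.range (n + 1), fun c : F => c ^ (i + l) • Bc n l g := by
      funext c
      rw [map_smul, BnL_apply, Bn, Finset.smul_sum, Finset.sum_apply]
      refine Finset.sum_congr rfl fun l _ => ?_
      rw [smul_smul, ← pow_add]
    show (fun c => BnL n c (c ^ i • g)) ∈ PF
    rw [this]
    exact Submodule.sum_mem _ fun l _ => Submodule.subset_span ⟨_, _, rfl⟩
  | zero =>
    have : (fun c : F => BnL n c ((0 : F → SymA) c)) = 0 := by funext c; exact map_zero _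
    rw [this]; exact Submodule.zero_mem _
  | add x y _ _ hx hy =>
    have : (fun c : F => BnL n c ((x + y) c)) = (fun c => BnL n c (x c)) + fun c => BnL n c (y c) := by
      funext c; exact map_add _ _ _
    rw [this]; exact Submodule.add_mem _ hx hy
  | smul a x _ hx =>
    have : (fun c : F => BnL n c ((a • x) c)) = a • (fun c => BnL n c (x c)) := by
      funext c; exact (BnL n c).map_smul _ _
    rw [this]; exact Submodule.smul_mem _ _ hx

theorem PF_BnLL (L : List ℕ) (f : SymA) : (fun c => BnLL c L f) ∈ PF := by
  induction L with
  | nil =>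
    refine Submodule.subset_span ⟨0, f, ?_⟩
    funext c; rw [pow_zero, one_smul]; rfl
  | cons n L ih => exact PF_BnL n ih

theorem PF_expL (N : ℕ) (f : SymA) : (fun c => expL c N f) ∈ PF := by
  have : (fun c => expL c N f) = ∑ L ∈ Cs N, lw L • fun c : F => BnLL c L f := by
    funext c
    rw [expL, LinearMap.sum_apply, Finset.sum_apply]
    rfl
  rw [this]
  exact Submodule.sum_mem _ fun L _ => Submodule.smul_mem _ _ (PF_BnLL L f)

theorem PF_coeff (m : Exp) {h : F → SymA} (hh : h ∈ PF) : ∃ Q : Polynomial F, ∀ c, coeff m (h c) = Q.eval c := by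
  induction hh using Submodule.span_induction with
  | mem h hh =>
    obtain ⟨i, g, rfl⟩ := hh
    exact ⟨Polynomial.C (coeff m g) * Polynomial.X ^ i, fun c => by
      rw [coeff_smul, Polynomial.eval_mul, Polynomial.eval_C, Polynomial.eval_pow, Polynomial.eval_X, smul_eq_mul,
        mul_comm]⟩
  | zero => exact ⟨0, fun c => by rw [Polynomial.eval_zero, Pi.zero_apply, coeff_zero]⟩
  | add x y _ _ hx hy =>
    obtain ⟨Q, hQ⟩ := hx
    obtain ⟨Q', hQ'⟩ := hy
    exact ⟨Q + Q', fun c => by rw [Pi.add_apply, coeff_add, hQ, hQ', Polynomial.eval_add]⟩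
  | smul a x _ hx =>
    obtain ⟨Q, hQ⟩ := hx
    exact ⟨Polynomial.C a * Q, fun c => by
      rw [Pi.smul_apply, coeff_smul, hQ, Polynomial.eval_mul, Polynomial.eval_C, smul_eq_mul]⟩

theorem expL_poly (N : ℕ) (f : SymA) (m : Exp) :
    ∃ Q : Polynomial F, ∀ v : F, coeff m (expL (-(alpha * v)) N f) = Q.eval v := by
  obtain ⟨Q, hQ⟩ := PF_coeff m (PF_expL N f)
  refine ⟨Q.comp (Polynomial.C (-alpha) * Polynomial.X), fun v => ?_⟩
  rw [hQ, Polynomial.eval_comp, Polynomial.eval_mul, Polynomial.eval_C, Polynomial.eval_X, neg_mul]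

theorem poly_eq {P Q : Polynomial F} (N : ℕ) (h : ∀ v : ℕ, N ≤ v → P.eval (v : F) = Q.eval (v : F)) : P = Q := by
  refine Polynomial.eq_of_infinite_eval_eq P Q ?_
  have : Set.Infinite ((fun v : ℕ => (v : F)) '' Set.Ici N) :=
    (Set.Ici_infinite N).image (fun a _ b _ hab => Nat.cast_injective hab)
  refine this.mono ?_
  rintro _ ⟨v, hv, rfl⟩
  exact h v hv

end Jk

namespace Jk
open MvPolynomial Dk

/-- generating function of the Jack characters of degree k -/
def FF (J : JPartition → SymA) (l : JPartition) (k : ℕ) : SymA :=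
  if k ≤ psize l then dp (pderiv 1) (psize l - k) (J l) else 0

theorem toExp_replicate (d : ℕ) : toExp (Multiset.replicate d 1) = Finsupp.single 1 d := by
  rw [toExp_eq]
  ext i
  rw [Multiset.toFinsupp_apply, Multiset.count_replicate, Finsupp.single_apply]

theorem coeff_FF (J : JPartition → SymA) (l mu : JPartition) :
    coeff (toExp mu) (FF J l (psize mu)) = theta J mu l := by
  rw [FF, theta]
  by_cases h : psize mu ≤ psize l
  · rw [if_pos h, if_neg (not_lt.mpr h), coeff_dp, addOnes, toExp_add, toExp_replicate]
    congr 2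
    rw [toExp_eq, Multiset.toFinsupp_apply, pmult, add_comm]
    exact Nat.choose_symm_add
  · rw [if_neg h, if_pos (not_le.mp h), coeff_zero]

theorem Hom_FF {J : JPartition → SymA} (hJ : IsJackFamily J) (l : JPartition) (k : ℕ) : Hom k (FF J l k) := by
  rw [FF]
  split_ifs with h
  · intro m hm
    have := coeff_dp_ne (Hom_J hJ l) hm
    rw [wt_eq]; omega
  · exact Hom_zero k

theorem Hom_expand {n : ℕ} {f : SymA} (hf : Hom n f) : f = ∑ l ∈ P n, coeff (toExp l) f • pPow l := by
  rw [← sub_eq_zero]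
  refine Hom_coeff_ext (hf.sub (Hom_sum _ _ fun l hl => ?_)) fun m hm => ?_
  · have := Hom_pPow l
    rw [mem_P.mp hl] at this
    exact this.smul _
  · rw [hall_sub_right, hall_sum_right, Finset.sum_eq_single m, hall_smul_right, hall_pPow, hall_pPow, pPow_eq m,
      coeff_monomial, if_pos rfl, one_mul, sub_self]
    · intro l _ hl
      rw [hall_smul_right, hall_pPow, pPow_eq l, coeff_monomial, if_neg (fun h => hl (toExp_inj h)), zero_mul,
        mul_zero]
    · intro h; exact absurd (mem_P.mpr hm) h

theorem FF_zero {J : JPartition → SymA} (hJ : IsJackFamily J) (l : JPartition) : FF J l 0 = 1 := by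
  rw [FF, if_pos (Nat.zero_le _), Nat.sub_zero, dp_pd_full (Hom_J hJ l), hJ.normalized, C_1]

theorem expL_zero (c : F) (f : SymA) : expL c 0 f = f := by
  rw [expL, sum_Cs]
  simp [Ls, lw, BnLL]

theorem row_U {J : JPartition → SymA} (hJ : IsJackFamily J) (l : JPartition) (v : ℕ+) (hv : psize l ≤ (v : ℕ)) :
    ∃ c : F, c ≠ 0 ∧ ∀ k, k ≤ (v : ℕ) →
      uv J (-(alpha * ((v : ℕ) : F))) (v ::ₘ l) • FF J (v ::ₘ l) k =
      (c * uv J (-(alpha * ((v : ℕ) : F))) l) • ∑ x ∈ Finset.HasAntidiagonal.antidiagonal k,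
        expL (-(alpha * ((v : ℕ) : F))) x.1 (FF J l x.2) := by
  obtain ⟨c, hc, h⟩ := row_dp hJ l v hv
  refine ⟨c, hc, fun k hk => ?_⟩
  have hb : k + (psize l + v - k) = psize l + v := by omega
  have h1 := congrArg (U (-(alpha * ((v : ℕ) : F)))) (h k _ hk hb)
  rw [← dp_U hJ, U_J hJ, map_smul, map_smul, map_sum] at h1
  have h2 : FF J (v ::ₘ l) k = dp (pderiv 1) (psize l + v - k) (J (v ::ₘ l)) := by
    rw [FF, psize_cons, if_pos (by omega), add_comm (v : ℕ)]
  rw [h2, h1, mul_smul, Finset.smul_sum (r := uv J _ l)]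
  congr 1
  refine Finset.sum_congr rfl fun x _ => ?_
  rw [FF]
  split_ifs with hx
  · rw [← exp_U, ← dp_U hJ, U_J hJ, ← expL_apply, map_smul, map_smul]
  · rw [map_zero, map_zero, smul_zero]

theorem FF_row {J : JPartition → SymA} (hJ : IsJackFamily J) (l : JPartition) (v : ℕ+) (hv : psize l ≤ (v : ℕ))
    (hu : uv J (-(alpha * ((v : ℕ) : F))) l ≠ 0) (k : ℕ) (hk : k ≤ (v : ℕ)) :
    FF J (v ::ₘ l) k = ∑ x ∈ Finset.HasAntidiagonal.antidiagonal k,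
        expL (-(alpha * ((v : ℕ) : F))) x.1 (FF J l x.2) := by
  obtain ⟨c, hc, h⟩ := row_U hJ l v hv
  have h0 := h 0 (Nat.zero_le _)
  rw [Finset.Nat.antidiagonal_zero, Finset.sum_singleton, expL_zero, FF_zero hJ, FF_zero hJ] at h0
  have h1 := congrArg (coeff 0) h0
  rw [coeff_smul, coeff_smul, coeff_zero_one, smul_eq_mul, smul_eq_mul, mul_one, mul_one] at h1
  have h2 := h k hk
  rw [h1] at h2
  have h3 := congrArg (fun f => (c * uv J (-(alpha * ((v : ℕ) : F))) l)⁻¹ • f) h2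
  have hne := mul_ne_zero hc hu
  simpa only [inv_smul_smul₀ hne] using h3

/-- partitions of size at most k -/
def PL' (k : ℕ) : Finset JPartition := (Finset.range (k + 1)).biUnion P

theorem mem_PL' {k : ℕ} {l : JPartition} : l ∈ PL' k ↔ psize l ≤ k := by
  rw [PL', Finset.mem_biUnion]
  constructor
  · rintro ⟨a, ha, h⟩
    rw [mem_P.mp h]; have := Finset.mem_range.mp ha; omega
  · intro h
    exact ⟨psize l, Finset.mem_range.mpr (by omega), mem_P.mpr rfl⟩

theorem sum_PL' (k : ℕ) (Φ : JPartition → F) : ∑ l ∈ PL' k, Φ l = ∑ a ∈ Finset.range (k + 1), ∑ l ∈ P a, Φ l := by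
  rw [PL', Finset.sum_biUnion]
  intro a _ b _ hab
  refine Finset.disjoint_left.mpr fun l h1 h2 => hab ?_
  rw [← mem_P.mp h1, mem_P.mp h2]

theorem theta_row {J : JPartition → SymA} (hJ : IsJackFamily J) (mu l : JPartition) (v : ℕ+)
    (hv : psize l ≤ (v : ℕ)) (hu : uv J (-(alpha * ((v : ℕ) : F))) l ≠ 0) (hk : psize mu ≤ (v : ℕ)) :
    theta J mu (v ::ₘ l) = ∑ nu ∈ PL' (psize mu),
      coeff (toExp mu) (expL (-(alpha * ((v : ℕ) : F))) (psize mu - psize nu) (pPow nu)) * theta J nu l := by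
  rw [← coeff_FF, FF_row hJ l v hv hu _ hk, coeff_sum, sum_PL', ← Finset.Nat.sum_antidiagonal_swap,
    Finset.Nat.sum_antidiagonal_eq_sum_range_succ_mk]
  refine Finset.sum_congr rfl fun a _ => ?_
  show coeff (toExp mu) (expL (-(alpha * ((v : ℕ) : F))) (psize mu - a) (FF J l a)) = _
  conv_lhs => rw [Hom_expand (Hom_FF hJ l a)]
  rw [map_sum, coeff_sum]
  refine Finset.sum_congr rfl fun nu hnu => ?_
  have hnu := mem_P.mp hnu
  rw [map_smul, coeff_smul, smul_eq_mul, ← hnu, coeff_FF, mul_comm]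

theorem theta_indep {J : JPartition → SymA} (hJ : IsJackFamily J) (T : Finset JPartition) (d : JPartition → F)
    (h : ∀ l, ∑ nu ∈ T, d nu * theta J nu l = 0) : ∀ nu ∈ T, d nu = 0 := by
  have key : ∀ n, ∀ nu ∈ T, psize nu = n → d nu = 0 := by
    intro n
    induction n using Nat.strong_induction_on with
    | _ n ih =>
    set f : SymA := ∑ nu ∈ T.filter (fun nu => psize nu = n), (d nu / zalpha (toExp nu)) • pPow nu with hf
    have hH : Hom n f := by
      refine Hom_sum _ _ fun nu hnu => ?_
      have := Hom_pPow nu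
      rw [(Finset.mem_filter.mp hnu).2] at this
      exact this.smul _
    have hz : f = 0 := by
      refine J_ext hJ hH (Hom_zero n) fun l hl => ?_
      rw [hall_zero_right, hall_comm, hf, hall_sum_left, ← h l, Finset.sum_filter]
      refine Finset.sum_congr rfl fun nu hnu => ?_
      split_ifs with hn
      · rw [hall_smul_left, hall_pPow, ← coeff_FF, hn, FF, if_pos hl.ge, hl, Nat.sub_self, dp_zero]
        have := zalpha_ne (toExp nu)
        field_simp
      · rcases lt_or_gt_of_ne hn with hlt | hgt
        · rw [ih _ hlt nu hnu rfl, zero_mul]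
        · rw [theta, if_pos (by omega), mul_zero]
    intro nu hnu hn
    have h1 := congrArg (hall (pPow nu)) hz
    rw [hall_zero_right, hf, hall_sum_right, Finset.sum_eq_single nu, hall_smul_right, hall_pPow, pPow_eq,
      coeff_monomial, if_pos rfl, one_mul, div_mul_cancel₀ _ (zalpha_ne _)] at h1
    · exact h1
    · intro l _ hl
      rw [hall_smul_right, hall_pPow, pPow_eq l, coeff_monomial, if_neg (fun h => hl (toExp_inj h)), zero_mul,
        mul_zero]
    · intro h; exact absurd (Finset.mem_filter.mpr ⟨hnu, hn⟩) h
  exact fun nu hnu => key _ nu hnu rfl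

theorem main {J : JPartition → SymA} (hJ : IsJackFamily J)
    (Th : JPartition → JPartition → Polynomial F) (hTh : IsSkewTheta J Th)
    (mu nu : JPartition) (hsize : psize nu ≤ psize mu) (v : F) :
    Polynomial.eval v (Th mu nu) = coeff (toExp mu) (expL (-(alpha * v)) (psize mu - psize nu) (pPow nu)) := by
  choose Q hQ using fun nu => expL_poly (psize mu - psize nu) (pPow nu) (toExp mu)
  set Q' : JPartition → Polynomial F := fun nu => if psize nu ≤ psize mu then Q nu else 0 with hQ'
  set T : Finset JPartition := (hTh.1 mu).toFinset ∪ PL' (psize mu) with hT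
  have hid : ∀ l, ∑ r ∈ T, Th mu r * Polynomial.C (theta J r l) = ∑ r ∈ T, Q' r * Polynomial.C (theta J r l) := by
    intro l
    obtain ⟨N, hN⟩ := uv_ne hJ l
    refine poly_eq (N + psize l + psize mu + 1) fun w hw => ?_
    obtain ⟨w', rfl⟩ : ∃ w' : ℕ+, w = w' := ⟨⟨w, by omega⟩, rfl⟩
    have h1 := hTh.2 mu l w' (parts_le (by omega))
    have h2 := theta_row hJ mu l w' (by omega) (hN _ (by omega)) (by omega)
    rw [h2, finsum_eq_sum_of_support_subset (s := T)] at h1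
    · simp only [Polynomial.eval_finsetSum, Polynomial.eval_mul, Polynomial.eval_C]
      rw [← h1]
      rw [← Finset.sum_subset (Finset.subset_union_right : PL' (psize mu) ⊆ T)]
      · refine Finset.sum_congr rfl fun r hr => ?_
        show _ = Polynomial.eval _ (if psize r ≤ psize mu then Q r else 0) * _
        rw [if_pos (mem_PL'.mp hr), hQ]
      · intro r _ hr
        show Polynomial.eval _ (if psize r ≤ psize mu then Q r else 0) * _ = 0
        rw [if_neg (fun h => hr (mem_PL'.mpr h)), Polynomial.eval_zero, zero_mul]
    · intro r hr
      rw [hT, Finset.coe_union]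
      left
      rw [Set.Finite.coe_toFinset]
      intro h0
      apply hr
      show Polynomial.eval _ (Th mu r) * _ = 0
      rw [h0, Polynomial.eval_zero, zero_mul]
  have hz := theta_indep hJ T (fun r => (Th mu r - Q' r).eval v) (fun l => by
    have := congrArg (Polynomial.eval v) (hid l)
    simp only [Polynomial.eval_finsetSum, Polynomial.eval_mul, Polynomial.eval_C] at this
    simp only [Polynomial.eval_sub, sub_mul, Finset.sum_sub_distrib]
    rw [this, sub_self]) nu (Finset.mem_union_right _ (mem_PL'.mpr hsize))
  have hz' : Polynomial.eval v (Th mu nu) - Polynomial.eval v (Q' nu) = 0 := by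
    rw [← Polynomial.eval_sub]; exact hz
  rw [sub_eq_zero.mp hz']
  show Polynomial.eval v (if psize nu ≤ psize mu then Q nu else 0) = _
  rw [if_pos hsize, hQ]

end Jk

/-- **Proposition 4.4, Eq. (4.3).** For any partitions `μ, ν` with `|μ| ≥ |ν|`:
`(α^{ℓ(μ)} z_μ)/(α^{ℓ(ν)} z_ν) ⬝ θ_{μ/ν}^{(α)}(v)
   = [t^{|μ|-|ν|} p_ν] exp(B_∞^{(α)⊥}(-t, p, -αv)) ⬝ p_μ`
(an identity of polynomials in `v`, stated for every value `v ∈ ℚ(α)`). -/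
theorem statement10
    (J : JPartition → SymA) (hJ : IsJackFamily J)
    (Th : JPartition → JPartition → Polynomial F) (hTh : IsSkewTheta J Th)
    (mu nu : JPartition) (hsize : psize nu ≤ psize mu) (v : F) :
    (zalpha (toExp mu) / zalpha (toExp nu)) * Polynomial.eval v (Th mu nu) =
      MvPolynomial.coeff (toExp nu)
        (expBperpCoef (-(alpha * v)) (psize mu - psize nu) (pPow mu)) := by
  rw [Jk.coeff_expPerp, Jk.main hJ Th hTh mu nu hsize v]

end
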